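/- Let (a_n)_{n≥1} be a strictly increasing sequence of positive integers. Then for Lebesgue-almost all α ∈ [0,1] there are infinitely many N such that δ_min^α(N) ≤ (1/C_N) · (log₂ a_N)/(log N · log₂ N). -/

import Mathlib

open MeasureTheory Filter

/-- Distance to the nearest integer. -/
noncomputable def nint (x : ℝ) : ℝ := |x - round x|

/-- `δ_min^α(N) = min { ‖(a_m - a_n) α‖ : 1 ≤ m, n ≤ N, m ≠ n }`. -/
noncomputable def deltaMin (a : ℕ → ℕ) (α : ℝ) (N : ℕ) : ℝ :=
  sInf {x : ℝ | ∃ m n : ℕ, 1 ≤ m ∧ m ≤ N ∧ 1 ≤ n ∧ n ≤ N ∧ m ≠ n ∧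
    x = nint (((a m : ℝ) - (a n : ℝ)) * α)}

/-- `C_N = #(A_N - A_N)` where `A_N = {a_1, …, a_N}`. -/
noncomputable def diffCard (a : ℕ → ℕ) (N : ℕ) : ℕ :=
  (((Finset.Icc 1 N) ×ˢ (Finset.Icc 1 N)).image
    (fun p : ℕ × ℕ => (a p.1 : ℤ) - (a p.2 : ℤ))).card

/-- `log x`, read as `max {1, log x}`. -/
noncomputable def L (x : ℝ) : ℝ := max 1 (Real.log x)

/-- `log₂ x = log log x`, with the `max {1, ·}` convention. -/
noncomputable def LL (x : ℝ) : ℝ := L (L x)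

namespace DuffinSchaeffer

/-- Kernel with geometric off-diagonal decay. -/
noncomputable def kern (s : ℝ) (i j : ℕ) : ℝ :=
  if i = j then 1 else Real.exp 1 * s ^ (i - j + (j - i))

lemma kern_nonneg {s : ℝ} (hs : 0 ≤ s) (i j : ℕ) : 0 ≤ kern s i j := by
  unfold kern; split_ifs <;> positivity

lemma kern_self (s : ℝ) (i : ℕ) : kern s i i = 1 := by simp [kern]

lemma kern_comm (s : ℝ) (i j : ℕ) : kern s i j = kern s j i := by
  simp only [kern, eq_comm (a := i), add_comm (i - j)]

lemma sum_pow_le_of_injOn {s : ℝ} (hs : 0 ≤ s) (hs1 : s < 1) {ι : Type*} (J : Finset ι)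
    (d : ι → ℕ) (hd : Set.InjOn d J) (hpos : ∀ j ∈ J, 1 ≤ d j) :
    ∑ j ∈ J, s ^ d j ≤ s / (1 - s) := by
  classical
  have h1 : ∑ j ∈ J, s ^ d j = ∑ k ∈ J.image (fun j => d j - 1), s * s ^ k := by
    rw [Finset.sum_image]
    · refine Finset.sum_congr rfl fun j hj => ?_
      rw [← pow_succ', Nat.sub_add_cancel (hpos j hj)]
    · intro a ha b hb hab
      have := hpos a ha
      have := hpos b hb
      exact hd ha hb (by simp only at hab; omega)
  rw [h1, ← Finset.mul_sum, div_eq_mul_inv, ← tsum_geometric_of_lt_one hs hs1]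
  exact mul_le_mul_of_nonneg_left
    ((summable_geometric_of_lt_one hs hs1).sum_le_tsum _ fun _ _ => by positivity) hs

lemma sum_dist_pow_le {s : ℝ} (hs : 0 ≤ s) (hs1 : s < 1) (J : Finset ℕ) (i : ℕ) (hi : i ∉ J) :
    ∑ j ∈ J, s ^ (i - j + (j - i)) ≤ 2 * s / (1 - s) := by
  rw [← Finset.sum_filter_add_sum_filter_not J (fun j => j < i)]
  have h1 := sum_pow_le_of_injOn hs hs1 (J.filter (fun j => j < i)) (fun j => i - j + (j - i))
    (by intro a ha b hb hab; simp at ha hb hab; omega)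
    (by intro j hj; simp at hj; omega)
  have h2 := sum_pow_le_of_injOn hs hs1 (J.filter (fun j => ¬ j < i)) (fun j => i - j + (j - i))
    (by intro a ha b hb hab; simp at ha hb hab; omega)
    (by
      intro j hj; simp at hj
      have : j ≠ i := fun h => hi (h ▸ hj.1)
      omega)
  calc _ ≤ _ := add_le_add h1 h2
    _ = _ := by ring

lemma kern_row_le {s : ℝ} (hs : 0 ≤ s) (hs1 : s < 1) (J : Finset ℕ) (i : ℕ) :
    ∑ j ∈ J, kern s i j ≤ 1 + Real.exp 1 * (2 * s / (1 - s)) := by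
  classical
  rw [← Finset.sum_filter_add_sum_filter_not J (fun j => i = j)]
  refine add_le_add ?_ ?_
  · rw [Finset.filter_eq]
    split_ifs <;> simp [kern_self]
  · have h := sum_dist_pow_le hs hs1 (J.filter (fun j => ¬ i = j)) i (by simp)
    rw [Finset.sum_congr rfl (g := fun j => Real.exp 1 * s ^ (i - j + (j - i)))]
    · rw [← Finset.mul_sum]; exact mul_le_mul_of_nonneg_left h (by positivity)
    · intro j hj
      simp only [Finset.mem_filter] at hj
      simp [kern, hj.2]

lemma rpow_three_quarters_le {x y : ℝ} (hx : 0 ≤ x) (hy : 0 ≤ y) (hxy : x * y ≤ 1) :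
    (x * y) ^ (3 / 4 : ℝ) ≤ (x + y) / 2 := by
  have h0 : 0 ≤ x * y := by positivity
  calc (x * y) ^ (3 / 4 : ℝ) ≤ (x * y) ^ (1 / 2 : ℝ) :=
        Real.rpow_le_rpow_of_exponent_ge' h0 hxy (by norm_num) (by norm_num)
    _ = Real.sqrt (x * y) := by rw [Real.sqrt_eq_rpow]
    _ ≤ (x + y) / 2 := by
        rw [Real.sqrt_le_left (by positivity)]
        nlinarith [sq_nonneg (x - y)]

/-- Schur test for `kern`. -/
lemma kern_sum_avg_le {s ρ : ℝ} (hs : 0 ≤ s) (hs1 : s < 1)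
    (hρ : 1 + Real.exp 1 * (2 * s / (1 - s)) ≤ ρ) (I J : Finset ℕ) (m n : ℕ → ℝ)
    (hm : ∀ i, 0 ≤ m i) (hn : ∀ j, 0 ≤ n j) :
    ∑ i ∈ I, ∑ j ∈ J, kern s i j * ((m i + n j) / 2) ≤
      ρ * ((∑ i ∈ I, m i + ∑ j ∈ J, n j) / 2) := by
  have h1 : ∑ i ∈ I, ∑ j ∈ J, kern s i j * m i ≤ ρ * ∑ i ∈ I, m i := by
    rw [Finset.mul_sum]
    refine Finset.sum_le_sum fun i _ => ?_
    rw [← Finset.sum_mul]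
    exact mul_le_mul_of_nonneg_right ((kern_row_le hs hs1 J i).trans hρ) (hm i)
  have h2 : ∑ i ∈ I, ∑ j ∈ J, kern s i j * n j ≤ ρ * ∑ j ∈ J, n j := by
    rw [Finset.sum_comm, Finset.mul_sum]
    refine Finset.sum_le_sum fun j _ => ?_
    rw [← Finset.sum_mul]
    refine mul_le_mul_of_nonneg_right (le_trans ?_ hρ) (hn j)
    simp_rw [kern_comm s _ j]
    exact kern_row_le hs hs1 I j
  have h3 : ∑ i ∈ I, ∑ j ∈ J, kern s i j * ((m i + n j) / 2) =
      (∑ i ∈ I, ∑ j ∈ J, kern s i j * m i + ∑ i ∈ I, ∑ j ∈ J, kern s i j * n j) / 2 := by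
    simp_rw [mul_div_assoc', mul_add, ← Finset.sum_div, Finset.sum_add_distrib]
  rw [h3]; linarith

lemma kern_sum_le_of_sum_eq_one {s ρ : ℝ} (hs : 0 ≤ s) (hs1 : s < 1)
    (hρ : 1 + Real.exp 1 * (2 * s / (1 - s)) ≤ ρ) (I J : Finset ℕ) (m n : ℕ → ℝ)
    (hm : ∀ i, 0 ≤ m i) (hn : ∀ j, 0 ≤ n j) (hI : ∑ i ∈ I, m i = 1) (hJ : ∑ j ∈ J, n j = 1) :
    ∑ i ∈ I, ∑ j ∈ J, kern s i j * (m i * n j) ^ (3 / 4 : ℝ) ≤ ρ := by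
  have hmi : ∀ i ∈ I, m i ≤ 1 := fun i hi =>
    hI ▸ Finset.single_le_sum (f := m) (fun i _ => hm i) hi
  have hnj : ∀ j ∈ J, n j ≤ 1 := fun j hj =>
    hJ ▸ Finset.single_le_sum (f := n) (fun i _ => hn i) hj
  calc _ ≤ ∑ i ∈ I, ∑ j ∈ J, kern s i j * ((m i + n j) / 2) := by
        refine Finset.sum_le_sum fun i hi => Finset.sum_le_sum fun j hj => ?_
        refine mul_le_mul_of_nonneg_left ?_ (kern_nonneg hs i j)
        exact rpow_three_quarters_le (hm i) (hn j) (mul_le_one₀ (hmi i hi) (hn j) (hnj j hj))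
    _ ≤ ρ * ((∑ i ∈ I, m i + ∑ j ∈ J, n j) / 2) := kern_sum_avg_le hs hs1 hρ I J m n hm hn
    _ = ρ := by rw [hI, hJ]; ring

lemma sum_kern_normalize {s : ℝ} (I J : Finset ℕ) (m n : ℕ → ℝ) {M N : ℝ}
    (hm : ∀ i, 0 ≤ m i) (hn : ∀ j, 0 ≤ n j) (hM : 0 < M) (hN : 0 < N) :
    ∑ i ∈ I, ∑ j ∈ J, kern s i j * (m i * n j) ^ (3 / 4 : ℝ) =
      (∑ i ∈ I, ∑ j ∈ J, kern s i j * (m i / M * (n j / N)) ^ (3 / 4 : ℝ)) *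
        (M * N) ^ (3 / 4 : ℝ) := by
  simp_rw [Finset.sum_mul]
  refine Finset.sum_congr rfl fun i _ => Finset.sum_congr rfl fun j _ => ?_
  rw [mul_assoc, ← Real.mul_rpow]
  · congr 2; field_simp
  · have := hm i; have := hn j; positivity
  · positivity

lemma kern_sum_le {s ρ : ℝ} (hs : 0 ≤ s) (hs1 : s < 1)
    (hρ : 1 + Real.exp 1 * (2 * s / (1 - s)) ≤ ρ) (I J : Finset ℕ) (m n : ℕ → ℝ)
    (hm : ∀ i, 0 ≤ m i) (hn : ∀ j, 0 ≤ n j) :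
    ∑ i ∈ I, ∑ j ∈ J, kern s i j * (m i * n j) ^ (3 / 4 : ℝ) ≤
      ρ * ((∑ i ∈ I, m i) * ∑ j ∈ J, n j) ^ (3 / 4 : ℝ) := by
  have hM0 : 0 ≤ ∑ i ∈ I, m i := Finset.sum_nonneg fun i _ => hm i
  have hN0 : 0 ≤ ∑ j ∈ J, n j := Finset.sum_nonneg fun i _ => hn i
  rcases hM0.eq_or_lt' with hM | hM
  · have h := (Finset.sum_eq_zero_iff_of_nonneg fun i _ => hm i).1 hM
    rw [hM, Finset.sum_eq_zero]
    · simp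
    · intro i hi
      simp [h i hi]
  rcases hN0.eq_or_lt' with hN | hN
  · have h := (Finset.sum_eq_zero_iff_of_nonneg fun i _ => hn i).1 hN
    rw [hN, Finset.sum_eq_zero]
    · simp
    · intro i hi
      refine Finset.sum_eq_zero fun j hj => ?_
      simp [h j hj]
  rw [sum_kern_normalize I J m n hm hn hM hN]
  refine mul_le_mul_of_nonneg_right ?_ (by positivity)
  refine kern_sum_le_of_sum_eq_one hs hs1 hρ I J _ _ (fun i => div_nonneg (hm i) hM.le)
    (fun i => div_nonneg (hn i) hN.le) ?_ ?_
  · rw [← Finset.sum_div, div_self hM.ne']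
  · rw [← Finset.sum_div, div_self hN.ne']

lemma rpow_three_quarters_le_mul {x y t : ℝ} (hx : 0 ≤ x) (hy : 0 ≤ y) (ht : 0 ≤ t)
    (hxy : x * y ≤ t ^ 4) : (x * y) ^ (3 / 4 : ℝ) ≤ t * ((x + y) / 2) := by
  have h0 : 0 ≤ x * y := by positivity
  have h1 : (x * y) ^ (3 / 4 : ℝ) = (x * y) ^ (1 / 4 : ℝ) * (x * y) ^ (1 / 2 : ℝ) := by
    rw [← Real.rpow_add_of_nonneg h0 (by norm_num) (by norm_num)]; norm_num
  rw [h1]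
  refine mul_le_mul ?_ ?_ (by positivity) ht
  · calc (x * y) ^ (1 / 4 : ℝ) ≤ (t ^ 4) ^ (1 / 4 : ℝ) :=
          Real.rpow_le_rpow h0 hxy (by norm_num)
      _ = t := by
          rw [← Real.rpow_natCast, ← Real.rpow_mul ht]; norm_num
  · rw [← Real.sqrt_eq_rpow, Real.sqrt_le_left (by positivity)]
    nlinarith [sq_nonneg (x - y)]

lemma mul_rpow_three_quarters_le {a x : ℝ} (hx : 0 ≤ x) :
    a * x ^ (3 / 4 : ℝ) ≤ 1024 * a ^ 4 + 3 / 64 * x := by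
  set b := x ^ (1 / 4 : ℝ) with hb
  have h3 : x ^ (3 / 4 : ℝ) = b ^ 3 := by
    rw [hb, ← Real.rpow_natCast, ← Real.rpow_mul hx]; norm_num
  have h4 : x = b ^ 4 := by
    rw [hb, ← Real.rpow_natCast, ← Real.rpow_mul hx]; norm_num
  rw [h3, h4]
  have : 0 ≤ (8 * a - b / 2) ^ 2 * ((8 * a + b / 2) ^ 2 + 2 * (b / 2) ^ 2) := by positivity
  nlinarith

lemma sum_erase_kern_le {s : ℝ} (hs : 0 ≤ s) (hs1 : s ≤ 1 / 10000) (R : Finset ℕ) (k : ℕ)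
    (x : ℝ) (n : ℕ → ℝ) (hx : 0 ≤ x) (hx1 : x ≤ 1) (hn : ∀ j, 0 ≤ n j) :
    ∑ j ∈ R.erase k, kern s k j * (x * n j) ^ (3 / 4 : ℝ) ≤
      6000 * s ^ 4 + 13 / 100 * ∑ j ∈ R.erase k, n j := by
  have he := Real.exp_one_lt_d9
  have hS : 0 ≤ ∑ j ∈ R.erase k, n j := Finset.sum_nonneg fun j _ => hn j
  have hd := sum_dist_pow_le (s := s ^ 4) (by positivity)
    (by nlinarith [pow_le_pow_left₀ hs hs1 4]) (R.erase k) k (by simp)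
  have hd2 : 2 * s ^ 4 / (1 - s ^ 4) ≤ 2.001 * s ^ 4 := by
    have h4 : s ^ 4 ≤ (1 / 10000) ^ 4 := pow_le_pow_left₀ hs hs1 4
    rw [div_le_iff₀ (by norm_num at h4 ⊢; linarith)]
    nlinarith [pow_nonneg hs 4]
  calc _ ≤ ∑ j ∈ R.erase k, (Real.exp 1 * 1024 * (s ^ 4) ^ (k - j + (j - k)) +
        Real.exp 1 * (3 / 64) * n j) := by
        refine Finset.sum_le_sum fun j hj => ?_
        have hj' : k ≠ j := fun h => by simp [h] at hj
        simp only [kern, if_neg hj']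
        have h1 : (x * n j) ^ (3 / 4 : ℝ) ≤ n j ^ (3 / 4 : ℝ) :=
          Real.rpow_le_rpow (mul_nonneg hx (hn j)) (mul_le_of_le_one_left (hn j) hx1)
            (by norm_num)
        have h2 := mul_rpow_three_quarters_le (a := s ^ (k - j + (j - k))) (hn j)
        have h3 : s ^ (k - j + (j - k)) * (x * n j) ^ (3 / 4 : ℝ) ≤
            s ^ (k - j + (j - k)) * n j ^ (3 / 4 : ℝ) :=
          mul_le_mul_of_nonneg_left h1 (by positivity)
        rw [← pow_mul, mul_comm _ 4] at *
        have h5 := mul_le_mul_of_nonneg_left (h3.trans h2) (Real.exp_pos 1).le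
        rw [mul_assoc]
        exact h5.trans_eq (by ring)
    _ = Real.exp 1 * 1024 * ∑ j ∈ R.erase k, (s ^ 4) ^ (k - j + (j - k)) +
        Real.exp 1 * (3 / 64) * ∑ j ∈ R.erase k, n j := by
        rw [Finset.sum_add_distrib, Finset.mul_sum, Finset.mul_sum]
    _ ≤ 2.7182818286 * 1024 * (2.001 * s ^ 4) + 2.7182818286 * (3 / 64) *
          ∑ j ∈ R.erase k, n j := by
        gcongr
        exact hd.trans hd2
    _ ≤ _ := by
        have := pow_nonneg hs 4
        nlinarith

lemma kern_concentration_of_sum_eq_one {s : ℝ} (hs : 0 ≤ s) (hs1 : s ≤ 1 / 10000)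
    (R : Finset ℕ) (m n : ℕ → ℝ)
    (hm : ∀ i, 0 ≤ m i) (hn : ∀ j, 0 ≤ n j) (hI : ∑ i ∈ R, m i = 1) (hJ : ∑ j ∈ R, n j = 1)
    (h : 1 < ∑ i ∈ R, ∑ j ∈ R, kern s i j * (m i * n j) ^ (3 / 4 : ℝ)) :
    ∃ k ∈ R, 1 - m k ≤ 100000 * s ^ 4 ∧ 1 - n k ≤ 100000 * s ^ 4 := by
  classical
  have he := Real.exp_one_lt_d9
  have hmi : ∀ i ∈ R, m i ≤ 1 := fun i hi =>
    hI ▸ Finset.single_le_sum (f := m) (fun i _ => hm i) hi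
  have hnj : ∀ j ∈ R, n j ≤ 1 := fun j hj =>
    hJ ▸ Finset.single_le_sum (f := n) (fun i _ => hn i) hj
  have hρ : 1 + Real.exp 1 * (2 * s / (1 - s)) ≤ 1.001 := by
    have : 2 * s / (1 - s) ≤ 0.00021 := by
      rw [div_le_iff₀ (by linarith)]; linarith
    have h0 : 0 ≤ 2 * s / (1 - s) := div_nonneg (by linarith) (by linarith)
    nlinarith
  have hschur := kern_sum_avg_le hs (by linarith) hρ R R m n hm hn
  have hk : ∃ k ∈ R, (998 / 1000 : ℝ) ^ 4 < m k * n k := by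
    by_contra! hcon
    have hdiag : ∑ i ∈ R, ((m i + n i) / 2 - (m i * n i) ^ (3 / 4 : ℝ)) ≤
        ∑ i ∈ R, ∑ j ∈ R, (kern s i j * ((m i + n j) / 2) -
          kern s i j * (m i * n j) ^ (3 / 4 : ℝ)) := by
      refine Finset.sum_le_sum fun i hi => ?_
      refine le_trans ?_ (Finset.single_le_sum (f := fun j => kern s i j * ((m i + n j) / 2) -
          kern s i j * (m i * n j) ^ (3 / 4 : ℝ)) (fun j hj => ?_) hi)
      · simp [kern_self]
      · have := rpow_three_quarters_le (hm i) (hn j) (mul_le_one₀ (hmi i hi) (hn j) (hnj j hj))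
        have := mul_le_mul_of_nonneg_left this (kern_nonneg hs i j)
        linarith
    have h2 : ∑ i ∈ R, (m i * n i) ^ (3 / 4 : ℝ) ≤ ∑ i ∈ R, 998 / 1000 * ((m i + n i) / 2) :=
      Finset.sum_le_sum fun i hi =>
        rpow_three_quarters_le_mul (hm i) (hn i) (by norm_num) (hcon i hi)
    have h3 : ∑ i ∈ R, (m i + n i) / 2 = 1 := by
      rw [← Finset.sum_div, Finset.sum_add_distrib, hI, hJ]; norm_num
    rw [← Finset.mul_sum, h3] at h2
    simp_rw [Finset.sum_sub_distrib] at hdiag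
    rw [h3] at hdiag
    rw [hI, hJ] at hschur
    norm_num at *
    linarith
  obtain ⟨k, hkR, hk⟩ := hk
  refine ⟨k, hkR, ?_⟩
  have hmk := hmi k hkR
  have hnk := hnj k hkR
  have hmk' : 99 / 100 ≤ m k := by nlinarith [hm k, hn k]
  have hnk' : 99 / 100 ≤ n k := by nlinarith [hm k, hn k]
  have hme : ∑ i ∈ R.erase k, m i = 1 - m k := by
    rw [← hI, ← Finset.sum_erase_add R m hkR]; ring
  have hne : ∑ i ∈ R.erase k, n i = 1 - n k := by
    rw [← hJ, ← Finset.sum_erase_add R n hkR]; ring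
  have hsplit : ∑ i ∈ R, ∑ j ∈ R, kern s i j * (m i * n j) ^ (3 / 4 : ℝ) =
      ∑ i ∈ R.erase k, ∑ j ∈ R.erase k, kern s i j * (m i * n j) ^ (3 / 4 : ℝ) +
      ∑ i ∈ R.erase k, kern s i k * (m i * n k) ^ (3 / 4 : ℝ) +
      (∑ j ∈ R.erase k, kern s k j * (m k * n j) ^ (3 / 4 : ℝ) +
      kern s k k * (m k * n k) ^ (3 / 4 : ℝ)) := by
    have hrow (i : ℕ) := Finset.sum_erase_add R
      (fun j => kern s i j * (m i * n j) ^ (3 / 4 : ℝ)) hkR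
    rw [← Finset.sum_erase_add R (fun i => ∑ j ∈ R, kern s i j * (m i * n j) ^ (3 / 4 : ℝ)) hkR,
      ← Finset.sum_add_distrib]
    simp only [hrow]
  have hA : ∑ i ∈ R.erase k, ∑ j ∈ R.erase k, kern s i j * (m i * n j) ^ (3 / 4 : ℝ) ≤
      1 / 10 * (1.001 * ((1 - m k + (1 - n k)) / 2)) := by
    rw [← hme, ← hne]
    refine le_trans ?_ (mul_le_mul_of_nonneg_left
      (kern_sum_avg_le hs (by linarith) hρ (R.erase k) (R.erase k) m n hm hn) (by norm_num))
    rw [Finset.mul_sum]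
    refine Finset.sum_le_sum fun i hi => ?_
    rw [Finset.mul_sum]
    refine Finset.sum_le_sum fun j hj => ?_
    have hi' : m i ≤ 1 / 100 := by
      have := Finset.single_le_sum (f := m) (fun i _ => hm i) hi
      linarith
    have hj' : n j ≤ 1 / 100 := by
      have := Finset.single_le_sum (f := n) (fun i _ => hn i) hj
      linarith
    have h1 := rpow_three_quarters_le_mul (t := 1 / 10) (hm i) (hn j) (by norm_num)
      (by nlinarith [hm i, hn j])
    have := mul_le_mul_of_nonneg_left h1 (kern_nonneg hs i j)
    linarith
  have hB := sum_erase_kern_le hs hs1 R k (m k) n (hm k) hmk hn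
  have hC := sum_erase_kern_le hs hs1 R k (n k) m (hn k) hnk hm
  have hC' : ∑ i ∈ R.erase k, kern s i k * (m i * n k) ^ (3 / 4 : ℝ) =
      ∑ i ∈ R.erase k, kern s k i * (n k * m i) ^ (3 / 4 : ℝ) :=
    Finset.sum_congr rfl fun i _ => by rw [kern_comm, mul_comm (m i)]
  have hD := rpow_three_quarters_le (hm k) (hn k) (mul_le_one₀ hmk (hn k) hnk)
  rw [hne] at hB
  rw [hme] at hC
  rw [hsplit, hC', kern_self, one_mul] at h
  norm_num at hA
  have := pow_nonneg hs 4
  constructor <;> linarith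

lemma kern_concentration {s : ℝ} (hs : 0 ≤ s) (hs1 : s ≤ 1 / 10000)
    (R : Finset ℕ) (m n : ℕ → ℝ) (hm : ∀ i, 0 ≤ m i) (hn : ∀ j, 0 ≤ n j)
    (h : ((∑ i ∈ R, m i) * ∑ j ∈ R, n j) ^ (3 / 4 : ℝ) <
      ∑ i ∈ R, ∑ j ∈ R, kern s i j * (m i * n j) ^ (3 / 4 : ℝ)) :
    ∃ k ∈ R, ∑ i ∈ R.erase k, m i ≤ 100000 * s ^ 4 * ∑ i ∈ R, m i ∧
      ∑ i ∈ R.erase k, n i ≤ 100000 * s ^ 4 * ∑ i ∈ R, n i := by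
  have hρ := kern_sum_le hs (by linarith) le_rfl R R m n hm hn
  have hM0 : 0 ≤ ∑ i ∈ R, m i := Finset.sum_nonneg fun i _ => hm i
  have hN0 : 0 ≤ ∑ j ∈ R, n j := Finset.sum_nonneg fun i _ => hn i
  rcases hM0.eq_or_lt' with hM | hM
  · rw [hM] at hρ h
    norm_num at hρ h
    linarith
  rcases hN0.eq_or_lt' with hN | hN
  · rw [hN] at hρ h
    norm_num at hρ h
    linarith
  rw [sum_kern_normalize R R m n hm hn hM hN] at h
  have h' := (lt_mul_iff_one_lt_left (by positivity)).1 h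
  obtain ⟨k, hk, h1, h2⟩ := kern_concentration_of_sum_eq_one hs hs1 R _ _
    (fun i => div_nonneg (hm i) hM.le) (fun i => div_nonneg (hn i) hN.le)
    (by rw [← Finset.sum_div, div_self hM.ne']) (by rw [← Finset.sum_div, div_self hN.ne']) h'
  refine ⟨k, hk, ?_, ?_⟩
  · have := Finset.sum_erase_add R m hk
    have h3 := mul_le_mul_of_nonneg_right h1 hM.le
    rw [sub_mul, div_mul_cancel₀ _ hM.ne'] at h3
    linarith
  · have := Finset.sum_erase_add R n hk
    have h3 := mul_le_mul_of_nonneg_right h2 hN.le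
    rw [sub_mul, div_mul_cancel₀ _ hN.ne'] at h3
    linarith

open Classical in
/-- A weighted bipartite graph in which some vertex can always be removed cheaply has few edges. -/
lemma sum_edges_le_of_removal {ι κ : Type*} (E : ι → κ → Prop)
    (μ G s : ι → ℝ) (ν G' s' : κ → ℝ) (C l l' : ℝ) (hC : 0 < C) (hl : 0 < l) (hl' : 0 < l')
    (hll : C ^ 2 ≤ l * l') (hμ : ∀ v, 0 ≤ μ v) (hν : ∀ w, 0 ≤ ν w)
    (hG : ∀ v, 0 < G v) (hG' : ∀ w, 0 < G' w)
    (V₀ : Finset ι) (W₀ : Finset κ) (hs : ∀ v ∈ V₀, 0 < s v) (hs' : ∀ w ∈ W₀, 0 < s' w)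
    (hV : ∀ V ⊆ V₀, ∀ X : ℝ, 0 < X → (∀ v ∈ V, s v ≤ X * G v) → ∀ w ∈ W₀,
      s' w * ∑ v ∈ V, (if E v w then μ v * G v else 0) ≤ C * X)
    (hW : ∀ W ⊆ W₀, ∀ X : ℝ, 0 < X → (∀ w ∈ W, s' w ≤ X * G' w) → ∀ v ∈ V₀,
      s v * ∑ w ∈ W, (if E v w then ν w * G' w else 0) ≤ C * X) :
    ∀ (n : ℕ) (V : Finset ι) (W : Finset κ), V ⊆ V₀ → W ⊆ W₀ → V.card + W.card ≤ n →
      ∑ v ∈ V, ∑ w ∈ W, (if E v w then μ v * G v * (ν w * G' w) else 0) ≤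
        l * ∑ w ∈ W, ν w + l' * ∑ v ∈ V, μ v := by
  intro n
  induction n with
  | zero =>
    intro V W _ _ h
    have h1 : V = ∅ := Finset.card_eq_zero.1 (by omega)
    have h2 : W = ∅ := Finset.card_eq_zero.1 (by omega)
    simp [h1, h2]
  | succ n ih =>
    intro V W hVV hWW hn
    have hpos : 0 ≤ l * ∑ w ∈ W, ν w + l' * ∑ v ∈ V, μ v :=
      add_nonneg (mul_nonneg hl.le (Finset.sum_nonneg fun w _ => hν w))
        (mul_nonneg hl'.le (Finset.sum_nonneg fun w _ => hμ w))
    rcases V.eq_empty_or_nonempty with rfl | hVne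
    · simpa using hpos
    rcases W.eq_empty_or_nonempty with rfl | hWne
    · simpa using hpos
    obtain ⟨v₀, hv₀, hvmax⟩ := Finset.exists_max_image V (fun v => s v / G v) hVne
    obtain ⟨w₀, hw₀, hwmax⟩ := Finset.exists_max_image W (fun w => s' w / G' w) hWne
    set X := s v₀ / G v₀ with hX
    set Y := s' w₀ / G' w₀ with hY
    have hX0 : 0 < X := div_pos (hs _ (hVV hv₀)) (hG _)
    have hY0 : 0 < Y := div_pos (hs' _ (hWW hw₀)) (hG' _)
    have hVX : ∀ v ∈ V, s v ≤ X * G v := fun v hv => (div_le_iff₀ (hG v)).1 (hvmax v hv)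
    have hWY : ∀ w ∈ W, s' w ≤ Y * G' w := fun w hw => (div_le_iff₀ (hG' w)).1 (hwmax w hw)
    have hsv : s v₀ = X * G v₀ := by rw [hX, div_mul_cancel₀ _ (hG _).ne']
    have hsw : s' w₀ = Y * G' w₀ := by rw [hY, div_mul_cancel₀ _ (hG' _).ne']
    have h1 := hV V hVV X hX0 hVX w₀ (hWW hw₀)
    have h2 := hW W hWW Y hY0 hWY v₀ (hVV hv₀)
    rw [hsw] at h1
    rw [hsv] at h2
    rcases le_total (C * X) (l * Y) with hcase | hcase
    · have hrec := ih V (W.erase w₀) hVV ((Finset.erase_subset _ _).trans hWW)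
        (by rw [Finset.card_erase_of_mem hw₀]; have := Finset.card_pos.2 hWne; omega)
      have h3 : G' w₀ * ∑ v ∈ V, (if E v w₀ then μ v * G v else 0) ≤ l := by
        have : Y * (G' w₀ * ∑ v ∈ V, (if E v w₀ then μ v * G v else 0)) ≤ Y * l := by
          linarith
        exact le_of_mul_le_mul_left this hY0
      have h4 : ∑ v ∈ V, (if E v w₀ then μ v * G v * (ν w₀ * G' w₀) else 0) ≤ l * ν w₀ := by
        calc _ = ν w₀ * (G' w₀ * ∑ v ∈ V, (if E v w₀ then μ v * G v else 0)) := by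
              rw [Finset.mul_sum, Finset.mul_sum]
              refine Finset.sum_congr rfl fun v _ => ?_
              split_ifs <;> ring
          _ ≤ ν w₀ * l := mul_le_mul_of_nonneg_left h3 (hν _)
          _ = _ := mul_comm _ _
      have h5 : ∑ v ∈ V, ∑ w ∈ W, (if E v w then μ v * G v * (ν w * G' w) else 0) =
          ∑ v ∈ V, ∑ w ∈ W.erase w₀, (if E v w then μ v * G v * (ν w * G' w) else 0) +
          ∑ v ∈ V, (if E v w₀ then μ v * G v * (ν w₀ * G' w₀) else 0) := by
        rw [← Finset.sum_add_distrib]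
        exact Finset.sum_congr rfl fun v _ => (Finset.sum_erase_add W _ hw₀).symm
      rw [h5, ← Finset.sum_erase_add W ν hw₀]
      linarith
    · have hcase' : C * Y ≤ l' * X := by
        have : C * (C * Y) ≤ C * (l' * X) := by nlinarith
        exact le_of_mul_le_mul_left this hC
      have hrec := ih (V.erase v₀) W ((Finset.erase_subset _ _).trans hVV) hWW
        (by rw [Finset.card_erase_of_mem hv₀]; have := Finset.card_pos.2 hVne; omega)
      have h3 : G v₀ * ∑ w ∈ W, (if E v₀ w then ν w * G' w else 0) ≤ l' := by
        have : X * (G v₀ * ∑ w ∈ W, (if E v₀ w then ν w * G' w else 0)) ≤ X * l' := by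
          linarith
        exact le_of_mul_le_mul_left this hX0
      have h4 : ∑ w ∈ W, (if E v₀ w then μ v₀ * G v₀ * (ν w * G' w) else 0) ≤ l' * μ v₀ := by
        calc _ = μ v₀ * (G v₀ * ∑ w ∈ W, (if E v₀ w then ν w * G' w else 0)) := by
              rw [Finset.mul_sum, Finset.mul_sum]
              refine Finset.sum_congr rfl fun v _ => ?_
              split_ifs <;> ring
          _ ≤ μ v₀ * l' := mul_le_mul_of_nonneg_left h3 (hμ _)
          _ = _ := mul_comm _ _
      rw [← Finset.sum_erase_add V _ hv₀, ← Finset.sum_erase_add V μ hv₀]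
      linarith

open Classical in
/-- Cauchy–Schwarz form of `sum_edges_le_of_removal`. -/
lemma sum_edges_sqrt_le {ι κ : Type*} (E : ι → κ → Prop)
    (μ H s : ι → ℝ) (ν H' s' : κ → ℝ) (C : ℝ) (hC : 0 < C)
    (hμ : ∀ v, 0 ≤ μ v) (hν : ∀ w, 0 ≤ ν w)
    (hH : ∀ v, 0 < H v) (hH' : ∀ w, 0 < H' w)
    (V : Finset ι) (W : Finset κ) (hs : ∀ v ∈ V, 0 < s v) (hs' : ∀ w ∈ W, 0 < s' w)
    (hV : ∀ V' ⊆ V, ∀ X : ℝ, 0 < X → (∀ v ∈ V', s v ≤ X * H v ^ 2) → ∀ w ∈ W,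
      s' w * ∑ v ∈ V', (if E v w then μ v * H v ^ 2 else 0) ≤ C * X)
    (hW : ∀ W' ⊆ W, ∀ X : ℝ, 0 < X → (∀ w ∈ W', s' w ≤ X * H' w ^ 2) → ∀ v ∈ V,
      s v * ∑ w ∈ W', (if E v w then ν w * H' w ^ 2 else 0) ≤ C * X) :
    ∑ v ∈ V, ∑ w ∈ W, (if E v w then μ v * H v * (ν w * H' w) else 0) ≤
      Real.sqrt (2 * C) * ((∑ v ∈ V, μ v) * ∑ w ∈ W, ν w) ^ (3 / 4 : ℝ) := by
  have hM0 : 0 ≤ ∑ v ∈ V, μ v := Finset.sum_nonneg fun v _ => hμ v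
  have hN0 : 0 ≤ ∑ w ∈ W, ν w := Finset.sum_nonneg fun v _ => hν v
  set M := ∑ v ∈ V, μ v with hM
  set N := ∑ w ∈ W, ν w with hN
  have hz : M = 0 ∨ N = 0 → ∑ v ∈ V, ∑ w ∈ W, (if E v w then μ v * H v * (ν w * H' w) else 0) ≤
      Real.sqrt (2 * C) * (M * N) ^ (3 / 4 : ℝ) := by
    intro h
    rw [Finset.sum_eq_zero]
    · positivity
    · intro v hv
      refine Finset.sum_eq_zero fun w hw => ?_
      rcases h with h | h
      · rw [(Finset.sum_eq_zero_iff_of_nonneg fun i _ => hμ i).1 h v hv]; simp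
      · rw [(Finset.sum_eq_zero_iff_of_nonneg fun i _ => hν i).1 h w hw]; simp
  rcases hM0.eq_or_lt' with h | hMpos
  · exact hz (Or.inl h)
  rcases hN0.eq_or_lt' with h | hNpos
  · exact hz (Or.inr h)
  have hT := sum_edges_le_of_removal E μ (fun v => H v ^ 2) s ν (fun w => H' w ^ 2) s' C
    (C * Real.sqrt (M / N)) (C * Real.sqrt (N / M)) hC
    (by positivity) (by positivity) (by
      have : Real.sqrt (M / N) * Real.sqrt (N / M) = 1 := by
        rw [← Real.sqrt_mul (by positivity)]
        rw [show M / N * (N / M) = 1 by field_simp]; simp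
      nlinarith) hμ hν (fun v => pow_pos (hH v) 2) (fun w => pow_pos (hH' w) 2) V W hs hs' hV hW
    _ V W subset_rfl subset_rfl le_rfl
  set S := ∑ v ∈ V, ∑ w ∈ W, (if E v w then μ v * H v * (ν w * H' w) else 0) with hS
  set T := ∑ v ∈ V, ∑ w ∈ W, (if E v w then μ v * H v ^ 2 * (ν w * H' w ^ 2) else 0) with hTdef
  have hT2 : T ≤ 2 * C * Real.sqrt (M * N) := by
    refine hT.trans_eq ?_
    rw [← hM, ← hN, Real.sqrt_div hM0, Real.sqrt_div hN0, Real.sqrt_mul hM0]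
    have h3 : 0 < Real.sqrt M := Real.sqrt_pos.2 hMpos
    have h4 : 0 < Real.sqrt N := Real.sqrt_pos.2 hNpos
    field_simp
    have h1 := Real.sq_sqrt hM0
    have h2 := Real.sq_sqrt hN0
    rw [h1, h2]; ring
  have hCS : S ^ 2 ≤ (M * N) * T := by
    have h := Finset.sum_sq_le_sum_mul_sum_of_sq_le_mul (V ×ˢ W)
      (r := fun p => if E p.1 p.2 then μ p.1 * H p.1 * (ν p.2 * H' p.2) else 0)
      (f := fun p => μ p.1 * ν p.2)
      (g := fun p => if E p.1 p.2 then μ p.1 * H p.1 ^ 2 * (ν p.2 * H' p.2 ^ 2) else 0)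
      (fun p _ => mul_nonneg (hμ _) (hν _))
      (fun p _ => by
        have := hμ p.1; have := hν p.2; have := hH p.1; have := hH' p.2
        split_ifs <;> positivity)
      (fun p _ => le_of_eq (by split_ifs <;> ring))
    rw [Finset.sum_product, Finset.sum_product, Finset.sum_product] at h
    rw [hM, hN, Finset.sum_mul_sum]
    exact h
  have hMN : 0 ≤ M * N := by positivity
  have h34 : (M * N) ^ (3 / 4 : ℝ) = Real.sqrt (M * N * Real.sqrt (M * N)) := by
    rw [Real.sqrt_eq_rpow, Real.sqrt_eq_rpow, ← Real.rpow_one_add' hMN (by norm_num),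
      ← Real.rpow_mul hMN]
    norm_num
  rw [h34, ← Real.sqrt_mul (by positivity)]
  refine Real.le_sqrt_of_sq_le (hCS.trans ?_)
  calc M * N * T ≤ M * N * (2 * C * Real.sqrt (M * N)) := mul_le_mul_of_nonneg_left hT2 hMN
    _ = _ := by ring

/-- The density `φ(n) / n`. -/
noncomputable def totRatio (n : ℕ) : ℝ := ∏ p ∈ n.primeFactors, (1 - (p : ℝ)⁻¹)

lemma totRatio_factor_pos {p : ℕ} (hp : p.Prime) : 0 < 1 - (p : ℝ)⁻¹ := by
  have : (p : ℝ)⁻¹ < 1 := inv_lt_one_of_one_lt₀ (by exact_mod_cast hp.one_lt)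
  linarith

lemma totRatio_factor_le_one (p : ℕ) : 1 - (p : ℝ)⁻¹ ≤ 1 := by
  have : 0 ≤ (p : ℝ)⁻¹ := by positivity
  linarith

lemma totRatio_pos (n : ℕ) : 0 < totRatio n :=
  Finset.prod_pos fun _ hp => totRatio_factor_pos (Nat.prime_of_mem_primeFactors hp)

lemma totRatio_le_one (n : ℕ) : totRatio n ≤ 1 :=
  Finset.prod_le_one (fun _ hp => (totRatio_factor_pos (Nat.prime_of_mem_primeFactors hp)).le)
    fun p _ => totRatio_factor_le_one p

lemma totient_eq_mul_totRatio (n : ℕ) : (n.totient : ℝ) = n * totRatio n := by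
  have h := Nat.totient_eq_mul_prod_factors n
  have h2 : ((n.totient : ℚ) : ℝ) = ((n * ∏ p ∈ n.primeFactors, (1 - (p : ℚ)⁻¹) : ℚ) : ℝ) := by
    rw [h]
  push_cast at h2
  exact h2

lemma totRatio_le_of_dvd {m n : ℕ} (h : m ∣ n) (hn : n ≠ 0) : totRatio n ≤ totRatio m := by
  unfold totRatio
  rw [← Finset.prod_sdiff (Nat.primeFactors_mono h hn)]
  refine mul_le_of_le_one_left (totRatio_pos m).le (Finset.prod_le_one (fun p hp => ?_)
    fun p _ => totRatio_factor_le_one p)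
  exact (totRatio_factor_pos (Nat.prime_of_mem_primeFactors (Finset.mem_sdiff.1 hp).1)).le

/-- The strongly multiplicative function with value `γ p` at the prime `p`. -/
noncomputable def wprod (γ : ℕ → ℝ) (n : ℕ) : ℝ := ∏ p ∈ n.primeFactors, γ p

lemma one_le_wprod {γ : ℕ → ℝ} (hγ : ∀ p, 1 ≤ γ p) (n : ℕ) : 1 ≤ wprod γ n := by
  unfold wprod
  exact Finset.prod_induction γ (fun x => 1 ≤ x) (fun a b ha hb => one_le_mul_of_one_le_of_one_le ha hb)
    le_rfl fun p _ => hγ p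

lemma wprod_pos {γ : ℕ → ℝ} (hγ : ∀ p, 1 ≤ γ p) (n : ℕ) : 0 < wprod γ n :=
  one_pos.trans_le (one_le_wprod hγ n)

lemma wprod_mul_of_coprime (γ : ℕ → ℝ) {m n : ℕ} (h : m.Coprime n) :
    wprod γ (m * n) = wprod γ m * wprod γ n := by
  unfold wprod
  rw [h.primeFactors_mul, Finset.prod_union h.disjoint_primeFactors]

lemma wprod_mul_le {γ : ℕ → ℝ} (hγ : ∀ p, 1 ≤ γ p) {m n : ℕ} (hm : m ≠ 0) (hn : n ≠ 0) :
    wprod γ (m * n) ≤ wprod γ m * wprod γ n := by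
  unfold wprod
  rw [Nat.primeFactors_mul hm hn, ← Finset.prod_union_inter]
  refine le_mul_of_one_le_right (Finset.prod_nonneg fun p _ => zero_le_one.trans (hγ p)) ?_
  exact Finset.prod_induction γ (fun x => 1 ≤ x) (fun a b ha hb => one_le_mul_of_one_le_of_one_le ha hb)
    le_rfl fun p _ => hγ p

lemma wprod_pow (γ : ℕ → ℝ) (n k : ℕ) : wprod γ n ^ k = wprod (fun p => γ p ^ k) n := by
  simp [wprod, Finset.prod_pow]

lemma wprod_eq_sum {γ : ℕ → ℝ} (P : Finset ℕ) (hP : ∀ p ∈ P, p.Prime) {n : ℕ} (hn : n ≠ 0)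
    (hnP : n.primeFactors ⊆ P) :
    wprod γ n = ∑ T ∈ P.powerset, if (∏ p ∈ T, p) ∣ n then ∏ p ∈ T, (γ p - 1) else 0 := by
  have h1 : wprod γ n = ∏ p ∈ P, (1 + if p ∣ n then γ p - 1 else 0) := by
    unfold wprod
    rw [← Finset.prod_subset hnP]
    · refine Finset.prod_congr rfl fun p hp => ?_
      rw [if_pos (Nat.dvd_of_mem_primeFactors hp)]; ring
    · intro p hp hpn
      rw [if_neg]
      · ring
      · exact fun h => hpn (Nat.mem_primeFactors.2 ⟨hP p hp, h, hn⟩)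
  rw [h1, Finset.prod_one_add]
  refine Finset.sum_congr rfl fun T hT => ?_
  have hTP := Finset.mem_powerset.1 hT
  split_ifs with h
  · refine Finset.prod_congr rfl fun p hp => ?_
    rw [if_pos ((Finset.dvd_prod_of_mem (fun p => p) hp).trans h)]
  · by_contra hne
    apply h
    refine Finset.prod_primes_dvd n (fun p hp => (hP p (hTP hp)).prime) fun p hp => ?_
    by_contra hpn
    exact hne (Finset.prod_eq_zero hp (if_neg hpn))

lemma sum_wprod_mul_le {γ : ℕ → ℝ} (hγ : ∀ p, 1 ≤ γ p) (P : Finset ℕ) (hP : ∀ p ∈ P, p.Prime)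
    (S : Finset ℕ) (hS : ∀ n ∈ S, n ≠ 0) (hSP : ∀ n ∈ S, n.primeFactors ⊆ P) (w : ℕ → ℝ) (Y : ℝ)
    (hY : ∀ d : ℕ, d ≠ 0 → ∑ n ∈ S.filter (d ∣ ·), w n ≤ Y / d) :
    ∑ n ∈ S, wprod γ n * w n ≤ Y * ∏ p ∈ P, (1 + (γ p - 1) / p) := by
  calc ∑ n ∈ S, wprod γ n * w n
      = ∑ n ∈ S, ∑ T ∈ P.powerset,
          (if (∏ p ∈ T, p) ∣ n then (∏ p ∈ T, (γ p - 1)) * w n else 0) := by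
        refine Finset.sum_congr rfl fun n hn => ?_
        rw [wprod_eq_sum P hP (hS n hn) (hSP n hn), Finset.sum_mul]
        exact Finset.sum_congr rfl fun T _ => by split_ifs <;> simp
    _ = ∑ T ∈ P.powerset, (∏ p ∈ T, (γ p - 1)) * ∑ n ∈ S.filter ((∏ p ∈ T, p) ∣ ·), w n := by
        rw [Finset.sum_comm]
        refine Finset.sum_congr rfl fun T _ => ?_
        rw [← Finset.sum_filter, Finset.mul_sum]
    _ ≤ ∑ T ∈ P.powerset, (∏ p ∈ T, (γ p - 1)) * (Y / (∏ p ∈ T, p : ℕ)) := by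
        refine Finset.sum_le_sum fun T hT => mul_le_mul_of_nonneg_left (hY _ ?_) ?_
        · exact Finset.prod_ne_zero_iff.2 fun p hp =>
            (hP p (Finset.mem_powerset.1 hT hp)).ne_zero
        · exact Finset.prod_nonneg fun p _ => by linarith [hγ p]
    _ = _ := by
        rw [Finset.prod_one_add, Finset.mul_sum]
        refine Finset.sum_congr rfl fun T _ => ?_
        rw [Finset.prod_div_distrib]; push_cast; ring

lemma sum_sq_div_sq_le {d X : ℝ} (hd : 0 < d) (hX : 0 < X) (M : ℕ) :
    ∑ k ∈ Finset.Icc 1 M, X ^ 2 / (d * k + X) ^ 2 ≤ X / d := by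
  have h : ∀ M : ℕ, ∑ k ∈ Finset.Icc 1 M, X ^ 2 / (d * k + X) ^ 2 ≤
      X / d * (1 - X / (d * M + X)) := by
    intro M
    induction M with
    | zero => simp [hX.ne']
    | succ M ih =>
      rw [Finset.sum_Icc_succ_top (by omega)]
      have h1 : X ^ 2 / (d * ((M + 1 : ℕ) : ℝ) + X) ^ 2 ≤
          X / d * (X / (d * M + X) - X / (d * ((M + 1 : ℕ) : ℝ) + X)) := by
        push_cast
        have hA : 0 < d * M + X := by positivity
        have hB : d * (M + 1) + X = d * M + X + d := by ring
        rw [hB]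
        set A := d * M + X
        have : X / d * (X / A - X / (A + d)) = X ^ 2 / (A * (A + d)) := by
          have : A + d ≠ 0 := by positivity
          field_simp; ring
        rw [this]
        exact div_le_div_of_nonneg_left (by positivity) (by positivity) (by nlinarith)
      linarith
  refine (h M).trans (mul_le_of_le_one_right (by positivity) ?_)
  have : 0 ≤ X / (d * M + X) := by positivity
  linarith

lemma sum_filter_dvd_sq_le (S : Finset ℕ) (hS : ∀ n ∈ S, n ≠ 0) {X : ℝ} (hX : 0 < X) (d : ℕ)
    (hd : d ≠ 0) :
    ∑ n ∈ S.filter (d ∣ ·), 4 * X ^ 2 / ((n : ℝ) + X) ^ 2 ≤ 4 * X / d := by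
  have hd0 : 0 < (d : ℝ) := by positivity
  have h1 : ∑ n ∈ S.filter (d ∣ ·), X ^ 2 / ((n : ℝ) + X) ^ 2 =
      ∑ k ∈ (S.filter (d ∣ ·)).image (· / d), X ^ 2 / (d * (k : ℝ) + X) ^ 2 := by
    rw [Finset.sum_image]
    · refine Finset.sum_congr rfl fun n hn => ?_
      rw [Nat.cast_div (Finset.mem_filter.1 hn).2 hd0.ne', mul_div_cancel₀ _ hd0.ne']
    · intro a ha b hb hab
      have ha := (Finset.mem_filter.1 ha).2
      have hb := (Finset.mem_filter.1 hb).2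
      rw [← Nat.div_mul_cancel ha, ← Nat.div_mul_cancel hb]
      simp only at hab; rw [hab]
  have h2 := sum_sq_div_sq_le hd0 hX (((S.filter (d ∣ ·)).image (· / d)).sup id)
  have h3 : ∑ n ∈ S.filter (d ∣ ·), X ^ 2 / ((n : ℝ) + X) ^ 2 ≤ X / d := by
    rw [h1]
    refine le_trans (Finset.sum_le_sum_of_subset_of_nonneg ?_ fun _ _ _ => by positivity) h2
    intro k hk
    refine Finset.mem_Icc.2 ⟨?_, Finset.le_sup (f := id) hk⟩
    obtain ⟨n, hn, rfl⟩ := Finset.mem_image.1 hk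
    obtain ⟨hn1, hn2⟩ := Finset.mem_filter.1 hn
    exact Nat.div_pos (Nat.le_of_dvd (Nat.pos_of_ne_zero (hS n hn1)) hn2) (Nat.pos_of_ne_zero hd)
  simp_rw [mul_div_assoc, ← Finset.mul_sum]
  linarith

lemma sum_filter_dvd_totient_le {N : ℕ} (hN : N ≠ 0) (S : Finset ℕ) (hS : ∀ r ∈ S, r ∣ N) (d : ℕ)
    (hd : d ≠ 0) :
    ∑ r ∈ S.filter (d ∣ ·), ((N / r).totient : ℝ) / N ≤ 1 / d := by
  by_cases hdN : d ∣ N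
  · have h1 : ∑ r ∈ S.filter (d ∣ ·), (N / r).totient ≤ N / d := by
      calc ∑ r ∈ S.filter (d ∣ ·), (N / r).totient
          = ∑ e ∈ (S.filter (d ∣ ·)).image (N / ·), e.totient := by
            rw [Finset.sum_image]
            intro a ha b hb hab
            have ha := hS a (Finset.mem_filter.1 ha).1
            have hb := hS b (Finset.mem_filter.1 hb).1
            simp only at hab
            rw [← Nat.div_div_self ha hN, ← Nat.div_div_self hb hN, hab]
        _ ≤ ∑ e ∈ (N / d).divisors, e.totient := by
            refine Finset.sum_le_sum_of_subset fun e he => ?_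
            obtain ⟨r, hr, rfl⟩ := Finset.mem_image.1 he
            obtain ⟨hr1, hr2⟩ := Finset.mem_filter.1 hr
            refine Nat.mem_divisors.2 ⟨Nat.div_dvd_div_left (hS r hr1) hr2, ?_⟩
            exact (Nat.div_pos (Nat.le_of_dvd (Nat.pos_of_ne_zero hN) hdN)
              (Nat.pos_of_ne_zero hd)).ne'
        _ = N / d := Nat.sum_totient _
    have h2 : ((∑ r ∈ S.filter (d ∣ ·), (N / r).totient : ℕ) : ℝ) ≤ (N / d : ℕ) := by
      exact_mod_cast h1
    have hd0 : 0 < (d : ℝ) := by positivity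
    have hN0 : 0 < (N : ℝ) := by positivity
    rw [Nat.cast_div hdN hd0.ne'] at h2
    push_cast at h2
    rw [← Finset.sum_div, div_le_div_iff₀ hN0 hd0]
    rw [le_div_iff₀ hd0] at h2
    linarith
  · rw [Finset.sum_eq_zero]
    · positivity
    · intro r hr
      obtain ⟨hr1, hr2⟩ := Finset.mem_filter.1 hr
      exact absurd (hr2.trans (hS r hr1)) hdN

/-- The key counting estimate: the `a v` are determined by their parts above and below `N`. -/
lemma sum_counting_le {γ : ℕ → ℝ} (hγ : ∀ p, 1 ≤ γ p) (P : Finset ℕ) (hP : ∀ p ∈ P, p.Prime)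
    {N : ℕ} (hN : N ≠ 0) (hNP : N.primeFactors ⊆ P) (V : Finset ℕ) (a : ℕ → ℕ)
    (ha : Set.InjOn a V) (ha0 : ∀ v ∈ V, a v ≠ 0) (haP : ∀ v ∈ V, (a v).primeFactors ⊆ P)
    (f : ℕ → ℝ) (hf : ∀ v ∈ V, f v ≤ totRatio (a v)) {X : ℝ} (hX : 0 < X)
    (hXV : ∀ v ∈ V, ((a v / (a v).gcd N : ℕ) : ℝ) ≤
      X * wprod γ (a v / (a v).gcd N * (N / (a v).gcd N))) :
    ∑ v ∈ V, f v * wprod γ (a v / (a v).gcd N * (N / (a v).gcd N)) / (N / (a v).gcd N : ℕ) ≤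
      4 * (∏ p ∈ P, (1 + (γ p ^ 3 - 1) / p)) ^ 2 * X := by
  set s : ℕ → ℕ := fun v => a v / (a v).gcd N with hs
  set r : ℕ → ℕ := fun v => N / (a v).gcd N with hr
  set cΓ := ∏ p ∈ P, (1 + (γ p ^ 3 - 1) / (p : ℝ)) with hcΓ
  set Γ : ℕ → ℝ := wprod (fun p => γ p ^ 3) with hΓ
  have hγ3 : ∀ p, 1 ≤ γ p ^ 3 := fun p => one_le_pow₀ (hγ p)
  have hgpos : ∀ v, 0 < (a v).gcd N := fun v => Nat.gcd_pos_of_pos_right _ (Nat.pos_of_ne_zero hN)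
  have hs0 : ∀ v ∈ V, s v ≠ 0 := fun v hv =>
    (Nat.div_pos (Nat.gcd_le_left _ (Nat.pos_of_ne_zero (ha0 v hv))) (hgpos v)).ne'
  have hr0 : ∀ v, r v ≠ 0 := fun v =>
    (Nat.div_pos (Nat.gcd_le_right _ (Nat.pos_of_ne_zero hN)) (hgpos v)).ne'
  have hrN : ∀ v, r v ∣ N := fun v => Nat.div_dvd_of_dvd (Nat.gcd_dvd_right _ _)
  have hsa : ∀ v, s v ∣ a v := fun v => Nat.div_dvd_of_dvd (Nat.gcd_dvd_left _ _)
  have hgr : ∀ v, (a v).gcd N * r v = N := fun v => Nat.mul_div_cancel' (Nat.gcd_dvd_right _ _)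
  have hgs : ∀ v, (a v).gcd N * s v = a v := fun v => Nat.mul_div_cancel' (Nat.gcd_dvd_left _ _)
  have hNr : ∀ v, N / r v = (a v).gcd N := fun v =>
    Nat.div_eq_of_eq_mul_left (Nat.pos_of_ne_zero (hr0 v)) (hgr v).symm
  set A : ℕ → ℝ := fun r => Γ r * (((N / r).totient : ℝ) / N) with hA
  set B : ℕ → ℝ := fun s => Γ s * (4 * X ^ 2 / ((s : ℝ) + X) ^ 2) with hB
  have hΓpos : ∀ n, 0 < Γ n := wprod_pos hγ3
  have hA0 : ∀ r, 0 ≤ A r := fun r => mul_nonneg (hΓpos r).le (by positivity)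
  have hB0 : ∀ r, 0 ≤ B r := fun r => mul_nonneg (hΓpos r).le (by positivity)
  have hterm : ∀ v ∈ V, f v * wprod γ (s v * r v) / (r v : ℕ) ≤ A (r v) * B (s v) := by
    intro v hv
    have hG := wprod_pos hγ (s v * r v)
    set G := wprod γ (s v * r v) with hGdef
    have hG3 : G ^ 3 ≤ Γ (s v) * Γ (r v) := by
      rw [hGdef, wprod_pow]
      exact wprod_mul_le hγ3 (hs0 v hv) (hr0 v)
    have hsX : (s v : ℝ) ≤ X * G := hXV v hv
    have hs1 : (1 : ℝ) ≤ s v := by exact_mod_cast Nat.one_le_iff_ne_zero.2 (hs0 v hv)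
    have hG1 : 1 ≤ G := one_le_wprod hγ _
    have hone : 1 ≤ G ^ 2 * (4 * X ^ 2 / ((s v : ℝ) + X) ^ 2) := by
      rw [mul_div_assoc', le_div_iff₀ (by positivity), one_mul,
        show G ^ 2 * (4 * X ^ 2) = (2 * X * G) ^ 2 by ring]
      exact pow_le_pow_left₀ (by positivity) (by nlinarith) 2
    have hfr : f v / r v ≤ ((N / r v).totient : ℝ) / N := by
      have h1 : totRatio (a v) ≤ totRatio ((a v).gcd N) :=
        totRatio_le_of_dvd (Nat.gcd_dvd_left _ _) (ha0 v hv)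
      have h2 : ((N / r v).totient : ℝ) / N = totRatio ((a v).gcd N) / r v := by
        rw [hNr, totient_eq_mul_totRatio]
        have hN' : (N : ℝ) = ((a v).gcd N : ℕ) * (r v : ℕ) := by
          rw [← Nat.cast_mul, hgr]
        have hg0 : (((a v).gcd N : ℕ) : ℝ) ≠ 0 := by exact_mod_cast (hgpos v).ne'
        rw [hN', mul_div_mul_left _ _ hg0]
      rw [h2]
      exact div_le_div_of_nonneg_right ((hf v hv).trans h1) (by positivity)
    calc f v * G / (r v : ℕ) = f v / r v * G := by ring
      _ ≤ ((N / r v).totient : ℝ) / N * G := mul_le_mul_of_nonneg_right hfr hG.le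
      _ ≤ ((N / r v).totient : ℝ) / N * G * (G ^ 2 * (4 * X ^ 2 / ((s v : ℝ) + X) ^ 2)) :=
          le_mul_of_one_le_right (by positivity) hone
      _ = G ^ 3 * (((N / r v).totient : ℝ) / N * (4 * X ^ 2 / ((s v : ℝ) + X) ^ 2)) := by ring
      _ ≤ (Γ (s v) * Γ (r v)) *
          (((N / r v).totient : ℝ) / N * (4 * X ^ 2 / ((s v : ℝ) + X) ^ 2)) :=
          mul_le_mul_of_nonneg_right hG3 (by positivity)
      _ = A (r v) * B (s v) := by rw [hA, hB]; ring
  have hinj : Set.InjOn (fun v => (r v, s v)) V := by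
    intro v hv w hw h
    obtain ⟨h1, h2⟩ := Prod.mk.inj h
    apply ha hv hw
    rw [← hgs v, ← hgs w, ← hNr v, ← hNr w, h1, h2]
  have hAsum : ∑ x ∈ V.image r, A x ≤ 1 * cΓ := by
    refine sum_wprod_mul_le hγ3 P hP _ ?_ ?_ _ 1 ?_
    · simp only [Finset.mem_image]; rintro _ ⟨v, _, rfl⟩; exact hr0 v
    · simp only [Finset.mem_image]
      rintro _ ⟨v, _, rfl⟩
      exact (Nat.primeFactors_mono (hrN v) hN).trans hNP
    · refine fun d hd => sum_filter_dvd_totient_le hN _ ?_ d hd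
      simp only [Finset.mem_image]; rintro _ ⟨v, _, rfl⟩; exact hrN v
  have hBsum : ∑ x ∈ V.image s, B x ≤ 4 * X * cΓ := by
    refine sum_wprod_mul_le hγ3 P hP _ ?_ ?_ _ (4 * X) ?_
    · simp only [Finset.mem_image]; rintro _ ⟨v, hv, rfl⟩; exact hs0 v hv
    · simp only [Finset.mem_image]
      rintro _ ⟨v, hv, rfl⟩
      exact (Nat.primeFactors_mono (hsa v) (ha0 v hv)).trans (haP v hv)
    · refine fun d hd => sum_filter_dvd_sq_le _ ?_ hX d hd
      simp only [Finset.mem_image]; rintro _ ⟨v, hv, rfl⟩; exact hs0 v hv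
  have hc0 : 0 ≤ cΓ := Finset.prod_nonneg fun p _ => by
    have := hγ3 p
    have : 0 ≤ (γ p ^ 3 - 1) / (p : ℝ) := div_nonneg (by linarith) (by positivity)
    linarith
  calc _ ≤ ∑ v ∈ V, A (r v) * B (s v) := Finset.sum_le_sum hterm
    _ = ∑ x ∈ V.image (fun v => (r v, s v)), A x.1 * B x.2 := by rw [Finset.sum_image hinj]
    _ ≤ ∑ x ∈ V.image r ×ˢ V.image s, A x.1 * B x.2 := by
        refine Finset.sum_le_sum_of_subset_of_nonneg ?_ fun x _ _ => mul_nonneg (hA0 _) (hB0 _)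
        intro x hx
        obtain ⟨v, hv, rfl⟩ := Finset.mem_image.1 hx
        exact Finset.mem_product.2 ⟨Finset.mem_image_of_mem _ hv, Finset.mem_image_of_mem _ hv⟩
    _ = (∑ x ∈ V.image r, A x) * ∑ x ∈ V.image s, B x := by
        rw [Finset.sum_product, Finset.sum_mul_sum]
    _ ≤ (1 * cΓ) * (4 * X * cΓ) := by
        refine mul_le_mul hAsum hBsum (Finset.sum_nonneg fun x _ => hB0 x) (by positivity)
    _ = _ := by ring

lemma div_gcd_eq_of_mul_eq {a b X Y : ℕ} (ha : a ≠ 0) (hXY : X.Coprime Y) (h : a * Y = b * X) :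
    a / a.gcd b = X ∧ b / a.gcd b = Y := by
  have hX : X ≠ 0 := by
    rintro rfl
    rw [Nat.coprime_zero_left] at hXY
    simp [hXY, ha] at h
  obtain ⟨k, rfl⟩ : X ∣ a := hXY.dvd_of_dvd_mul_right ⟨b, by rw [h, mul_comm]⟩
  have hb : b = Y * k := by
    apply Nat.eq_of_mul_eq_mul_right (Nat.pos_of_ne_zero hX)
    rw [← h]; ring
  subst hb
  have hk : 0 < k := Nat.pos_of_ne_zero (right_ne_zero_of_mul ha)
  rw [Nat.gcd_mul_right, hXY.gcd_eq_one, one_mul, Nat.mul_div_cancel _ hk, Nat.mul_div_cancel _ hk]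
  exact ⟨rfl, rfl⟩

lemma div_gcd_pow_mul {p a b : ℕ} (hp : p.Prime) (hpa : ¬ p ∣ a) (hpb : ¬ p ∣ b)
    (ha0 : a ≠ 0) (i j : ℕ) :
    p ^ i * a / (p ^ i * a).gcd (p ^ j * b) = p ^ (i - j) * (a / a.gcd b) ∧
      p ^ j * b / (p ^ i * a).gcd (p ^ j * b) = p ^ (j - i) * (b / a.gcd b) := by
  have hg : 0 < a.gcd b := Nat.gcd_pos_of_pos_left _ (Nat.pos_of_ne_zero ha0)
  have hda : a.gcd b * (a / a.gcd b) = a := Nat.mul_div_cancel' (Nat.gcd_dvd_left _ _)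
  have hdb : a.gcd b * (b / a.gcd b) = b := Nat.mul_div_cancel' (Nat.gcd_dvd_right _ _)
  have hcop : (a / a.gcd b).Coprime (b / a.gcd b) := Nat.coprime_div_gcd_div_gcd hg
  set x := a / a.gcd b
  set y := b / a.gcd b
  have hpx : p.Coprime x := (Nat.Prime.coprime_iff_not_dvd hp).2
    fun h => hpa (h.trans (Dvd.intro_left _ hda))
  have hpy : p.Coprime y := (Nat.Prime.coprime_iff_not_dvd hp).2
    fun h => hpb (h.trans (Dvd.intro_left _ hdb))
  refine div_gcd_eq_of_mul_eq (mul_ne_zero (pow_ne_zero _ hp.ne_zero) ha0) ?_ ?_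
  · refine Nat.Coprime.mul_left ?_ ?_
    · refine Nat.Coprime.mul_right ?_ (hpy.pow_left _)
      rcases le_total i j with h | h
      · simp [Nat.sub_eq_zero_of_le h]
      · simp [Nat.sub_eq_zero_of_le h]
    · exact Nat.Coprime.mul_right (hpx.symm.pow_right _) hcop
  · have h1 : i + (j - i) = j + (i - j) := by omega
    calc p ^ i * a * (p ^ (j - i) * y) = p ^ (i + (j - i)) * (a * y) := by rw [pow_add]; ring
      _ = p ^ (j + (i - j)) * (b * x) := by
        rw [h1]; congr 1
        conv_lhs => rw [← hda]
        conv_rhs => rw [← hdb]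
        ring
      _ = _ := by rw [pow_add]; ring

/-- The local weight penalising prime factors `p ≥ z`. -/
noncomputable def expWeight (z p : ℕ) : ℝ := if z ≤ p then Real.exp ((z : ℝ) / p) else 1

lemma one_le_expWeight (z p : ℕ) : 1 ≤ expWeight z p := by
  unfold expWeight
  split_ifs
  · exact Real.one_le_exp (by positivity)
  · exact le_rfl

lemma expWeight_le (z p : ℕ) : expWeight z p ≤ Real.exp 1 := by
  unfold expWeight
  split_ifs with h
  · exact Real.exp_le_exp.2 (div_le_one_of_le₀ (by exact_mod_cast h) (by positivity))
  · exact Real.one_le_exp zero_le_one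

/-- The bilinear sum controlled in the main estimate. -/
noncomputable def bil (z : ℕ) (V W : Finset ℕ) (a b : ℕ → ℕ) (ψ f θ g : ℕ → ℝ) : ℝ :=
  ∑ v ∈ V, ∑ w ∈ W,
    if ψ v * (b w / (a v).gcd (b w) : ℕ) ≤ 1 ∧ θ w * (a v / (a v).gcd (b w) : ℕ) ≤ 1 then
      ψ v * f v * (θ w * g w) *
        wprod (expWeight z) (a v / (a v).gcd (b w) * (b w / (a v).gcd (b w)))
    else 0

/-- Admissible families of moduli `a` with densities `f`, indexed by `V`. -/
structure Adm (P V : Finset ℕ) (a : ℕ → ℕ) (f : ℕ → ℝ) : Prop where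
  inj : Set.InjOn a V
  ne_zero : ∀ v ∈ V, a v ≠ 0
  subset : ∀ v ∈ V, (a v).primeFactors ⊆ P
  nonneg : ∀ v, 0 ≤ f v
  le : ∀ v ∈ V, f v ≤ totRatio (a v)

/-- The bilinear estimate for moduli composed of primes in `P`. -/
def BilBound (z : ℕ) (P : Finset ℕ) (B : ℝ) : Prop :=
  ∀ (V W : Finset ℕ) (a b : ℕ → ℕ) (ψ f θ g : ℕ → ℝ), (∀ v, 0 ≤ ψ v) → (∀ w, 0 ≤ θ w) →
    Adm P V a f → Adm P W b g →
    bil z V W a b ψ f θ g ≤ B * ((∑ v ∈ V, ψ v * f v) * ∑ w ∈ W, θ w * g w) ^ (3 / 4 : ℝ)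

lemma Adm.mono {P V V' : Finset ℕ} {a : ℕ → ℕ} {f : ℕ → ℝ} (h : Adm P V a f) (hV : V' ⊆ V) :
    Adm P V' a f :=
  ⟨h.inj.mono (by exact_mod_cast hV), fun v hv => h.ne_zero v (hV hv),
    fun v hv => h.subset v (hV hv), h.nonneg, fun v hv => h.le v (hV hv)⟩

lemma Adm.erase {P V : Finset ℕ} {a : ℕ → ℕ} {f : ℕ → ℝ} (h : Adm P V a f) {p : ℕ}
    (hp : p.Prime) (i : ℕ) (hi : ∀ v ∈ V, (a v).factorization p = i) :
    Adm (P.erase p) V (fun v => a v / p ^ i) f := by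
  have hmul : ∀ v ∈ V, p ^ i * (a v / p ^ i) = a v := fun v hv => by
    rw [← hi v hv]; exact Nat.ordProj_mul_ordCompl_eq_self _ _
  have hdvd : ∀ v ∈ V, a v / p ^ i ∣ a v := fun v hv => Dvd.intro_left _ (hmul v hv)
  have hne : ∀ v ∈ V, a v / p ^ i ≠ 0 := fun v hv h0 => by
    have := hmul v hv
    rw [h0, mul_zero] at this
    exact h.ne_zero v hv this.symm
  refine ⟨?_, hne, ?_, h.nonneg, ?_⟩
  · intro v hv w hw hvw
    apply h.inj hv hw
    simp only at hvw
    rw [← hmul v hv, ← hmul w hw, hvw]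
  · intro v hv q hq
    refine Finset.mem_erase.2 ⟨?_, h.subset v hv (Nat.primeFactors_mono (hdvd v hv)
      (h.ne_zero v hv) hq)⟩
    rintro rfl
    have := Nat.dvd_of_mem_primeFactors hq
    rw [← hi v hv] at this
    exact Nat.not_dvd_ordCompl hp (h.ne_zero v hv) this
  · exact fun v hv => (h.le v hv).trans (totRatio_le_of_dvd (hdvd v hv) (h.ne_zero v hv))

/-- Removing a prime from all moduli when both valuations are constant. -/
lemma bil_le_of_factorization_eq {z : ℕ} {P : Finset ℕ} {B : ℝ} {p : ℕ} (hp : p.Prime)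
    (hB : BilBound z (P.erase p) B) {V W : Finset ℕ} {a b : ℕ → ℕ} {ψ f θ g : ℕ → ℝ}
    (hψ : ∀ v, 0 ≤ ψ v) (hθ : ∀ w, 0 ≤ θ w) (hV : Adm P V a f) (hW : Adm P W b g) {i j : ℕ}
    (hi : ∀ v ∈ V, (a v).factorization p = i) (hj : ∀ w ∈ W, (b w).factorization p = j) :
    bil z V W a b ψ f θ g ≤ B * (kern ((p : ℝ) ^ (-(1 / 4) : ℝ)) i j *
      ((∑ v ∈ V, ψ v * f v) * ∑ w ∈ W, θ w * g w) ^ (3 / 4 : ℝ)) := by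
  have hp0 : (0 : ℝ) < p := by exact_mod_cast hp.pos
  set e : ℝ := if i = j then 1 else Real.exp 1 with he
  have he0 : 0 < e := by rw [he]; split_ifs <;> positivity
  set d := i - j + (j - i) with hd
  have key := hB V W (fun v => a v / p ^ i) (fun w => b w / p ^ j)
    (fun v => (p : ℝ) ^ (j - i) * ψ v) f (fun w => (p : ℝ) ^ (i - j) * θ w) g
    (fun v => mul_nonneg (by positivity) (hψ v)) (fun v => mul_nonneg (by positivity) (hθ v))
    (hV.erase hp i hi) (hW.erase hp j hj)
  have hle : bil z V W a b ψ f θ g ≤ e / (p : ℝ) ^ d * bil z V W (fun v => a v / p ^ i)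
      (fun w => b w / p ^ j) (fun v => (p : ℝ) ^ (j - i) * ψ v) f
      (fun w => (p : ℝ) ^ (i - j) * θ w) g := by
    unfold bil
    rw [Finset.mul_sum]
    refine Finset.sum_le_sum fun v hv => ?_
    rw [Finset.mul_sum]
    refine Finset.sum_le_sum fun w hw => ?_
    have ha : p ^ i * (a v / p ^ i) = a v := by
      rw [← hi v hv]; exact Nat.ordProj_mul_ordCompl_eq_self _ _
    have hb : p ^ j * (b w / p ^ j) = b w := by
      rw [← hj w hw]; exact Nat.ordProj_mul_ordCompl_eq_self _ _
    have hpa : ¬ p ∣ a v / p ^ i := by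
      rw [← hi v hv]; exact Nat.not_dvd_ordCompl hp (hV.ne_zero v hv)
    have hpb : ¬ p ∣ b w / p ^ j := by
      rw [← hj w hw]; exact Nat.not_dvd_ordCompl hp (hW.ne_zero w hw)
    have ha0 : a v / p ^ i ≠ 0 := fun h => hpa (h ▸ dvd_zero p)
    have hb0 : b w / p ^ j ≠ 0 := fun h => hpb (h ▸ dvd_zero p)
    have hq := div_gcd_pow_mul hp hpa hpb ha0 i j
    rw [ha, hb] at hq
    obtain ⟨hx, hy⟩ := hq
    have hg : 0 < (a v / p ^ i).gcd (b w / p ^ j) :=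
      Nat.gcd_pos_of_pos_left _ (Nat.pos_of_ne_zero ha0)
    have hx0 : a v / p ^ i / (a v / p ^ i).gcd (b w / p ^ j) ≠ 0 :=
      (Nat.div_pos (Nat.le_of_dvd (Nat.pos_of_ne_zero ha0) (Nat.gcd_dvd_left _ _)) hg).ne'
    have hy0 : b w / p ^ j / (a v / p ^ i).gcd (b w / p ^ j) ≠ 0 :=
      (Nat.div_pos (Nat.le_of_dvd (Nat.pos_of_ne_zero hb0) (Nat.gcd_dvd_right _ _)) hg).ne'
    rw [hx, hy]
    set x := a v / p ^ i / (a v / p ^ i).gcd (b w / p ^ j)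
    set y := b w / p ^ j / (a v / p ^ i).gcd (b w / p ^ j)
    have hc1 : ψ v * (p ^ (j - i) * y : ℕ) = p ^ (j - i) * ψ v * y := by push_cast; ring
    have hc2 : θ w * (p ^ (i - j) * x : ℕ) = p ^ (i - j) * θ w * x := by push_cast; ring
    rw [hc1, hc2]
    split_ifs with hc
    · have hw1 : wprod (expWeight z) (p ^ (i - j) * x * (p ^ (j - i) * y)) ≤
          e * wprod (expWeight z) (x * y) := by
        rw [show p ^ (i - j) * x * (p ^ (j - i) * y) = p ^ d * (x * y) by
          rw [hd, pow_add]; ring]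
        refine (wprod_mul_le (one_le_expWeight z) (pow_ne_zero _ hp.ne_zero)
          (mul_ne_zero hx0 hy0)).trans (mul_le_mul_of_nonneg_right ?_
          (wprod_pos (one_le_expWeight z) _).le)
        by_cases hij : i = j
        · simp [hd, he, hij, wprod]
        · have : d ≠ 0 := by omega
          rw [he, if_neg hij, wprod, Nat.primeFactors_prime_pow this hp, Finset.prod_singleton]
          exact expWeight_le z p
      have hwt : 0 ≤ ψ v * f v * (θ w * g w) :=
        mul_nonneg (mul_nonneg (hψ v) (hV.nonneg v)) (mul_nonneg (hθ w) (hW.nonneg w))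
      calc _ ≤ ψ v * f v * (θ w * g w) * (e * wprod (expWeight z) (x * y)) :=
            mul_le_mul_of_nonneg_left hw1 hwt
        _ = _ := by
            rw [hd, pow_add]
            field_simp
    · simp
  have hsum1 : ∑ v ∈ V, (p : ℝ) ^ (j - i) * ψ v * f v = p ^ (j - i) * ∑ v ∈ V, ψ v * f v := by
    rw [Finset.mul_sum]; exact Finset.sum_congr rfl fun v _ => by ring
  have hsum2 : ∑ w ∈ W, (p : ℝ) ^ (i - j) * θ w * g w = p ^ (i - j) * ∑ w ∈ W, θ w * g w := by
    rw [Finset.mul_sum]; exact Finset.sum_congr rfl fun v _ => by ring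
  rw [hsum1, hsum2] at key
  have hM : 0 ≤ (∑ v ∈ V, ψ v * f v) * ∑ w ∈ W, θ w * g w :=
    mul_nonneg (Finset.sum_nonneg fun v _ => mul_nonneg (hψ v) (hV.nonneg v))
      (Finset.sum_nonneg fun v _ => mul_nonneg (hθ v) (hW.nonneg v))
  have hkern : kern ((p : ℝ) ^ (-(1 / 4) : ℝ)) i j =
      e / (p : ℝ) ^ d * ((p : ℝ) ^ d) ^ (3 / 4 : ℝ) := by
    have h1 : ((p : ℝ) ^ (-(1 / 4) : ℝ)) ^ d = 1 / (p : ℝ) ^ d * ((p : ℝ) ^ d) ^ (3 / 4 : ℝ) := by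
      rw [← Real.rpow_natCast, ← Real.rpow_natCast (p : ℝ) d, ← Real.rpow_mul hp0.le,
        ← Real.rpow_mul hp0.le, div_mul_eq_mul_div, one_mul, ← Real.rpow_sub hp0]
      congr 1; ring
    unfold kern
    rw [he, h1]
    split_ifs with hij
    · simp [hd, hij]
    · ring
  calc _ ≤ _ := hle
    _ ≤ e / (p : ℝ) ^ d * _ := mul_le_mul_of_nonneg_left key (by positivity)
    _ = _ := by
      rw [hkern, show (p : ℝ) ^ (j - i) * (∑ v ∈ V, ψ v * f v) * (p ^ (i - j) * ∑ w ∈ W, θ w * g w) =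
          p ^ d * ((∑ v ∈ V, ψ v * f v) * ∑ w ∈ W, θ w * g w) by rw [hd, pow_add]; ring,
        Real.mul_rpow (by positivity) hM]
      ring

lemma sum_fiber {V : Finset ℕ} {q : ℕ → ℕ} {R : Finset ℕ} (hR : ∀ v ∈ V, q v ∈ R) (h : ℕ → ℝ) :
    ∑ v ∈ V, h v = ∑ i ∈ R, ∑ v ∈ V.filter (fun v => q v = i), h v :=
  (Finset.sum_fiberwise_of_maps_to hR h).symm

/-- Splitting the bilinear sum according to `p`-adic valuations. -/
lemma bil_le_sum_kern {z : ℕ} {P : Finset ℕ} {B : ℝ} {p : ℕ} (hp : p.Prime)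
    (hB : BilBound z (P.erase p) B) {V W : Finset ℕ} {a b : ℕ → ℕ} {ψ f θ g : ℕ → ℝ}
    (hψ : ∀ v, 0 ≤ ψ v) (hθ : ∀ w, 0 ≤ θ w) (hV : Adm P V a f) (hW : Adm P W b g) (R : Finset ℕ)
    (hRV : ∀ v ∈ V, (a v).factorization p ∈ R) (hRW : ∀ w ∈ W, (b w).factorization p ∈ R) :
    bil z V W a b ψ f θ g ≤ B * ∑ i ∈ R, ∑ j ∈ R, kern ((p : ℝ) ^ (-(1 / 4) : ℝ)) i j *
      ((∑ v ∈ V.filter (fun v => (a v).factorization p = i), ψ v * f v) *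
        ∑ w ∈ W.filter (fun w => (b w).factorization p = j), θ w * g w) ^ (3 / 4 : ℝ) := by
  have h1 : bil z V W a b ψ f θ g = ∑ i ∈ R, ∑ j ∈ R,
      bil z (V.filter (fun v => (a v).factorization p = i))
        (W.filter (fun w => (b w).factorization p = j)) a b ψ f θ g := by
    unfold bil
    rw [sum_fiber hRV]
    refine Finset.sum_congr rfl fun i _ => ?_
    rw [Finset.sum_comm]
    rw [sum_fiber hRW]
    exact Finset.sum_congr rfl fun j _ => Finset.sum_comm
  rw [h1, Finset.mul_sum]
  refine Finset.sum_le_sum fun i _ => ?_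
  rw [Finset.mul_sum]
  refine Finset.sum_le_sum fun j _ => ?_
  exact bil_le_of_factorization_eq hp hB hψ hθ (hV.mono (Finset.filter_subset _ _))
    (hW.mono (Finset.filter_subset _ _)) (fun v hv => (Finset.mem_filter.1 hv).2)
    (fun v hv => (Finset.mem_filter.1 hv).2)

lemma bil_le_mul_rpow {z : ℕ} {P : Finset ℕ} {B : ℝ} (hB0 : 0 ≤ B) {p : ℕ} (hp : p.Prime)
    (hB : BilBound z (P.erase p) B) {V W : Finset ℕ} {a b : ℕ → ℕ} {ψ f θ g : ℕ → ℝ}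
    (hψ : ∀ v, 0 ≤ ψ v) (hθ : ∀ w, 0 ≤ θ w) (hV : Adm P V a f) (hW : Adm P W b g)
    {s ρ : ℝ} (hs : s = (p : ℝ) ^ (-(1 / 4) : ℝ)) (hs1 : s < 1)
    (hρ : 1 + Real.exp 1 * (2 * s / (1 - s)) ≤ ρ) :
    bil z V W a b ψ f θ g ≤
      B * ρ * ((∑ v ∈ V, ψ v * f v) * ∑ w ∈ W, θ w * g w) ^ (3 / 4 : ℝ) := by
  set R := V.image (fun v => (a v).factorization p) ∪ W.image (fun v => (b v).factorization p)
  have hRV : ∀ v ∈ V, (a v).factorization p ∈ R := fun v hv =>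
    Finset.mem_union_left _ (Finset.mem_image_of_mem _ hv)
  have hRW : ∀ v ∈ W, (b v).factorization p ∈ R := fun v hv =>
    Finset.mem_union_right _ (Finset.mem_image_of_mem _ hv)
  have h := bil_le_sum_kern hp hB hψ hθ hV hW R hRV hRW
  rw [← hs] at h
  have h2 := kern_sum_le (by rw [hs]; positivity) hs1 hρ R R
    (fun i => ∑ v ∈ V.filter (fun v => (a v).factorization p = i), ψ v * f v)
    (fun j => ∑ w ∈ W.filter (fun w => (b w).factorization p = j), θ w * g w)
    (fun i => Finset.sum_nonneg fun v _ => mul_nonneg (hψ v) (hV.nonneg v))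
    (fun i => Finset.sum_nonneg fun v _ => mul_nonneg (hθ v) (hW.nonneg v))
  rw [← sum_fiber hRV, ← sum_fiber hRW] at h2
  rw [mul_assoc]
  exact h.trans (mul_le_mul_of_nonneg_left h2 hB0)

lemma sum_le_of_telescope (h u : ℕ → ℝ) (z : ℕ) (hh : ∀ n, 0 ≤ h n) (hu : ∀ n, 0 ≤ u n)
    (hhu : ∀ n, z ≤ n → h n ≤ u n - u (n + 1)) (P : Finset ℕ) (hP : ∀ p ∈ P, z ≤ p) :
    ∑ p ∈ P, h p ≤ u z := by
  have key : ∀ k, ∑ n ∈ Finset.Ico z (z + k), h n ≤ u z - u (z + k) := by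
    intro k
    induction k with
    | zero => simp
    | succ k ih =>
      rw [← add_assoc, Finset.sum_Ico_succ_top (by omega)]
      have := hhu (z + k) (by omega)
      linarith
  have hsub : P ⊆ Finset.Ico z (z + (P.sup id + 1)) := fun p hp => by
    have : p ≤ P.sup id := Finset.le_sup (f := id) hp
    exact Finset.mem_Ico.2 ⟨hP p hp, by omega⟩
  have := key (P.sup id + 1)
  have := hu (z + (P.sup id + 1))
  have := Finset.sum_le_sum_of_subset_of_nonneg hsub fun n _ _ => hh n
  linarith

lemma sum_inv_sq_le {z : ℕ} (hz : 1 ≤ z) (P : Finset ℕ) (hP : ∀ p ∈ P, z ≤ p) :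
    ∑ p ∈ P, 1 / (p : ℝ) ^ 2 ≤ (2 : ℝ) / z := by
  refine sum_le_of_telescope (fun n => 1 / (n : ℝ) ^ 2) (fun n => 2 / n) z
    (fun n => by positivity) (fun n => by positivity) (fun n hn => ?_) P hP
  have hn1 : (1 : ℝ) ≤ n := by exact_mod_cast hz.trans hn
  push_cast
  rw [div_sub_div _ _ (by positivity) (by positivity), div_le_div_iff₀ (by positivity)
    (by positivity)]
  nlinarith

lemma sum_inv_mul_sqrt_le {z : ℕ} (hz : 1 ≤ z) (P : Finset ℕ) (hP : ∀ p ∈ P, z ≤ p) :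
    ∑ p ∈ P, 1 / Real.sqrt p ^ 3 ≤ 6 / Real.sqrt z := by
  refine sum_le_of_telescope (fun n => 1 / Real.sqrt n ^ 3) (fun n => 6 / Real.sqrt n) z
    (fun n => by positivity) (fun n => by positivity) (fun n hn => ?_) P hP
  have hn1 : (1 : ℝ) ≤ n := by exact_mod_cast hz.trans hn
  have h1 : 1 ≤ Real.sqrt n := Real.one_le_sqrt.2 hn1
  have h2 := Real.sq_sqrt (show (0 : ℝ) ≤ n by positivity)
  have h3 := Real.sq_sqrt (show (0 : ℝ) ≤ ((n + 1 : ℕ) : ℝ) by positivity)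
  have h4 : Real.sqrt n ≤ Real.sqrt ((n + 1 : ℕ) : ℝ) := Real.sqrt_le_sqrt (by push_cast; linarith)
  push_cast at *
  set t := Real.sqrt n
  set u := Real.sqrt ((n : ℝ) + 1)
  have h5 : u ≤ 2 * t := by nlinarith
  have h6 : u ^ 2 - t ^ 2 = 1 := by rw [h2, h3]; ring
  have hu : 0 < u := by linarith
  have h7 : 6 / t - 6 / u = 6 / (t * u * (t + u)) := by
    rw [div_sub_div _ _ (by positivity) (by positivity), div_eq_div_iff (by positivity)
      (by positivity)]
    linear_combination (6 * t * u) * h6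
  rw [h7, div_le_div_iff₀ (by positivity) (by positivity)]
  have : t * u * (t + u) ≤ t * (2 * t) * (t + 2 * t) := by gcongr
  nlinarith

lemma prod_expWeight_le {z : ℕ} (hz : 1 ≤ z) (P : Finset ℕ) (hP : ∀ p ∈ P, z ≤ p) :
    ∏ p ∈ P, (1 + ((expWeight z p ^ 2) ^ 3 - 1) / p) ≤ Real.exp (12 * Real.exp 6) := by
  have hz0 : (0 : ℝ) < z := by exact_mod_cast hz
  calc ∏ p ∈ P, (1 + ((expWeight z p ^ 2) ^ 3 - 1) / p)
      ≤ ∏ p ∈ P, Real.exp (6 * Real.exp 6 * z * (1 / (p : ℝ) ^ 2)) := by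
        refine Finset.prod_le_prod (fun p hp => ?_) fun p hp => ?_
        · have h1 := one_le_pow₀ (one_le_pow₀ (one_le_expWeight z p) (n := 2)) (n := 3)
          have : 0 ≤ ((expWeight z p ^ 2) ^ 3 - 1) / (p : ℝ) :=
            div_nonneg (by linarith) (by positivity)
          linarith
        · have hzp : (z : ℝ) ≤ p := by exact_mod_cast hP p hp
          have hp0 : (0 : ℝ) < p := hz0.trans_le hzp
          have h1 : (expWeight z p ^ 2) ^ 3 = Real.exp (6 * (z / p)) := by
            rw [expWeight, if_pos (hP p hp), ← pow_mul, ← Real.exp_nat_mul]; norm_num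
          have hu : (z : ℝ) / p ≤ 1 := div_le_one_of_le₀ hzp hp0.le
          have hu0 : 0 < (z : ℝ) / p := by positivity
          set u := (z : ℝ) / p with hudef
          have h2 : Real.exp (6 * u) - 1 ≤ 6 * u * Real.exp 6 := by
            have h3 := Real.add_one_le_exp (-(6 * u))
            have h4 : Real.exp (6 * u) * Real.exp (-(6 * u)) = 1 := by
              rw [← Real.exp_add]; simp
            have h5 : Real.exp (6 * u) ≤ Real.exp 6 := Real.exp_le_exp.2 (by linarith)
            have h6 := Real.exp_pos (6 * u)
            nlinarith
          rw [h1]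
          refine le_trans ?_ (Real.add_one_le_exp _)
          have h7 : 6 * Real.exp 6 * z * (1 / (p : ℝ) ^ 2) = 6 * u * Real.exp 6 / p := by
            rw [hudef]; field_simp
          rw [h7, add_comm]
          gcongr
    _ = Real.exp (6 * Real.exp 6 * z * ∑ p ∈ P, 1 / (p : ℝ) ^ 2) := by
        rw [← Real.exp_sum, Finset.mul_sum]
    _ ≤ Real.exp (12 * Real.exp 6) := by
        refine Real.exp_le_exp.2 ?_
        calc 6 * Real.exp 6 * z * ∑ p ∈ P, 1 / (p : ℝ) ^ 2
            ≤ 6 * Real.exp 6 * z * (2 / z) :=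
              mul_le_mul_of_nonneg_left (sum_inv_sq_le hz P hP) (by positivity)
          _ = _ := by field_simp; ring

lemma not_dvd_div_gcd {a N p : ℕ} (ha : a ≠ 0) (hN : N ≠ 0) (hp : p.Prime)
    (h : a.factorization p = N.factorization p) : ¬ p ∣ a / a.gcd N ∧ ¬ p ∣ N / a.gcd N := by
  have hg : 0 < a.gcd N := Nat.gcd_pos_of_pos_left _ (Nat.pos_of_ne_zero ha)
  have h1 : (a / a.gcd N).factorization p = 0 := by
    rw [Nat.factorization_div (Nat.gcd_dvd_left _ _), Nat.factorization_gcd ha hN]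
    simp [h]
  have h2 : (N / a.gcd N).factorization p = 0 := by
    rw [Nat.factorization_div (Nat.gcd_dvd_right _ _), Nat.factorization_gcd ha hN]
    simp [h]
  have ha' : a / a.gcd N ≠ 0 :=
    (Nat.div_pos (Nat.le_of_dvd (Nat.pos_of_ne_zero ha) (Nat.gcd_dvd_left _ _)) hg).ne'
  have hN' : N / a.gcd N ≠ 0 :=
    (Nat.div_pos (Nat.le_of_dvd (Nat.pos_of_ne_zero hN) (Nat.gcd_dvd_right _ _)) hg).ne'
  exact ⟨fun hd => (hp.factorization_pos_of_dvd ha' hd).ne' h1,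
    fun hd => (hp.factorization_pos_of_dvd hN' hd).ne' h2⟩

/-- If at every prime one of `a`, `b` agrees with `N`, the quotients by the gcd factor. -/
lemma div_gcd_of_good {a b N : ℕ} (ha : a ≠ 0) (hb : b ≠ 0) (hN : N ≠ 0)
    (h : ∀ p : ℕ, p.Prime →
      a.factorization p = N.factorization p ∨ b.factorization p = N.factorization p) :
    a / a.gcd b = a / a.gcd N * (N / b.gcd N) ∧ b / a.gcd b = b / b.gcd N * (N / a.gcd N) := by
  have hga : 0 < a.gcd N := Nat.gcd_pos_of_pos_left _ (Nat.pos_of_ne_zero ha)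
  have hgb : 0 < b.gcd N := Nat.gcd_pos_of_pos_left _ (Nat.pos_of_ne_zero hb)
  have h1 : a.gcd N * (a / a.gcd N) = a := Nat.mul_div_cancel' (Nat.gcd_dvd_left _ _)
  have h2 : a.gcd N * (N / a.gcd N) = N := Nat.mul_div_cancel' (Nat.gcd_dvd_right _ _)
  have h3 : b.gcd N * (b / b.gcd N) = b := Nat.mul_div_cancel' (Nat.gcd_dvd_left _ _)
  have h4 : b.gcd N * (N / b.gcd N) = N := Nat.mul_div_cancel' (Nat.gcd_dvd_right _ _)
  have hc1 : (a / a.gcd N).Coprime (N / a.gcd N) := Nat.coprime_div_gcd_div_gcd hga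
  have hc2 : (b / b.gcd N).Coprime (N / b.gcd N) := Nat.coprime_div_gcd_div_gcd hgb
  have hss : (a / a.gcd N).Coprime (b / b.gcd N) := Nat.coprime_of_dvd fun p hp hpa hpb => by
    rcases h p hp with h | h
    · exact (not_dvd_div_gcd ha hN hp h).1 hpa
    · exact (not_dvd_div_gcd hb hN hp h).1 hpb
  have hrr : (N / a.gcd N).Coprime (N / b.gcd N) := Nat.coprime_of_dvd fun p hp hpa hpb => by
    rcases h p hp with h | h
    · exact (not_dvd_div_gcd ha hN hp h).2 hpa
    · exact (not_dvd_div_gcd hb hN hp h).2 hpb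
  refine div_gcd_eq_of_mul_eq ha ((hss.mul_right hc1).mul_left (hc2.symm.mul_right hrr.symm)) ?_
  set s := a / a.gcd N
  set r := N / a.gcd N
  set s' := b / b.gcd N
  set r' := N / b.gcd N
  calc a * (s' * r) = (a.gcd N * s) * (s' * r) := by rw [h1]
    _ = (a.gcd N * r) * (s * s') := by ring
    _ = (b.gcd N * r') * (s * s') := by rw [h2, h4]
    _ = (b.gcd N * s') * (s * r') := by ring
    _ = _ := by rw [h3]

open Classical in
/-- Weighted degrees in the graph of good edges. -/
lemma degree_le {z : ℕ} (hz : 1 ≤ z) {P : Finset ℕ} (hP : ∀ p ∈ P, p.Prime)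
    (hPz : ∀ p ∈ P, z ≤ p) {N : ℕ} (hN : N ≠ 0) (hNP : N.primeFactors ⊆ P) {V : Finset ℕ}
    {a : ℕ → ℕ} {ψ f : ℕ → ℝ} (hV : Adm P V a f) {X : ℝ} (hX : 0 < X)
    (hXV : ∀ v ∈ V, ((a v / (a v).gcd N : ℕ) : ℝ) ≤
      X * wprod (expWeight z) (a v / (a v).gcd N * (N / (a v).gcd N)) ^ 2)
    (E : ℕ → Prop) (s : ℝ)
    (hE : ∀ v ∈ V, E v → ψ v * (s * (N / (a v).gcd N : ℕ)) ≤ 1) :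
    s * ∑ v ∈ V, (if E v then ψ v * f v *
      wprod (expWeight z) (a v / (a v).gcd N * (N / (a v).gcd N)) ^ 2 else 0) ≤
      4 * Real.exp (12 * Real.exp 6) ^ 2 * X := by
  simp_rw [wprod_pow] at *
  have hγ : ∀ p, 1 ≤ expWeight z p ^ 2 := fun p => one_le_pow₀ (one_le_expWeight z p)
  have h1 := sum_counting_le hγ P hP hN hNP V a hV.inj hV.ne_zero hV.subset f hV.le hX hXV
  have h2 := prod_expWeight_le hz P hPz
  have h3 : 0 ≤ ∏ p ∈ P, (1 + ((expWeight z p ^ 2) ^ 3 - 1) / (p : ℝ)) :=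
    Finset.prod_nonneg fun p _ => by
      have h1 := one_le_pow₀ (hγ p) (n := 3)
      have : 0 ≤ ((expWeight z p ^ 2) ^ 3 - 1) / (p : ℝ) :=
        div_nonneg (by linarith) (by positivity)
      linarith
  refine le_trans ?_ (h1.trans (by gcongr))
  rw [Finset.mul_sum]
  refine Finset.sum_le_sum fun v hv => ?_
  have hr : 0 < ((N / (a v).gcd N : ℕ) : ℝ) := by
    exact_mod_cast Nat.div_pos (Nat.gcd_le_right _ (Nat.pos_of_ne_zero hN))
      (Nat.gcd_pos_of_pos_right _ (Nat.pos_of_ne_zero hN))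
  have hH := (wprod_pos hγ (a v / (a v).gcd N * (N / (a v).gcd N))).le
  have hf := hV.nonneg v
  split_ifs with h
  · rw [le_div_iff₀ hr]
    have := mul_le_mul_of_nonneg_right (hE v hv h) (mul_nonneg hf hH)
    linarith
  · rw [mul_zero]; positivity

lemma factorization_prod_pow {P : Finset ℕ} (hP : ∀ p ∈ P, p.Prime) (k : ℕ → ℕ) {q : ℕ} :
    (∏ p ∈ P, p ^ k p).factorization q = if q ∈ P then k q else 0 := by
  rw [Nat.factorization_prod fun p hp => pow_ne_zero _ (hP p hp).ne_zero, Finset.sum_apply']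
  rw [Finset.sum_congr rfl (g := fun p => if p = q then k p else 0)]
  · simp [Finset.sum_ite_eq']
  · intro p hp
    rw [(hP p hp).factorization_pow, Finsupp.single_apply]

/-- The bound for the contribution of good edges. -/
noncomputable def goodConst : ℝ := Real.sqrt (2 * (4 * Real.exp (12 * Real.exp 6) ^ 2))

open Classical in
lemma bil_good_le {z : ℕ} (hz : 1 ≤ z) {P : Finset ℕ} (hP : ∀ p ∈ P, p.Prime)
    (hPz : ∀ p ∈ P, z ≤ p) {V W : Finset ℕ} {a b : ℕ → ℕ} {ψ f θ g : ℕ → ℝ}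
    (hψ : ∀ v, 0 ≤ ψ v) (hθ : ∀ w, 0 ≤ θ w) (hV : Adm P V a f) (hW : Adm P W b g) (k : ℕ → ℕ) :
    ∑ v ∈ V, ∑ w ∈ W,
      (if (∀ p ∈ P, (a v).factorization p = k p ∨ (b w).factorization p = k p) then
        if ψ v * (b w / (a v).gcd (b w) : ℕ) ≤ 1 ∧ θ w * (a v / (a v).gcd (b w) : ℕ) ≤ 1 then
          ψ v * f v * (θ w * g w) *
            wprod (expWeight z) (a v / (a v).gcd (b w) * (b w / (a v).gcd (b w)))
        else 0
      else 0) ≤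
      goodConst * ((∑ v ∈ V, ψ v * f v) * ∑ w ∈ W, θ w * g w) ^ (3 / 4 : ℝ) := by
  set N := ∏ p ∈ P, p ^ k p with hNdef
  have hN : N ≠ 0 := Finset.prod_ne_zero_iff.2 fun p hp => pow_ne_zero _ (hP p hp).ne_zero
  have hNf : ∀ q, N.factorization q = if q ∈ P then k q else 0 := fun q =>
    factorization_prod_pow hP k
  have hNP : N.primeFactors ⊆ P := fun q hq => by
    by_contra hqP
    have h := hNf q
    rw [if_neg hqP] at h
    exact ((Nat.prime_of_mem_primeFactors hq).factorization_pos_of_dvd hN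
      (Nat.dvd_of_mem_primeFactors hq)).ne' h
  have hoff : ∀ {n : ℕ}, n.primeFactors ⊆ P → ∀ q, q.Prime → q ∉ P → n.factorization q = 0 :=
    fun {n} hn q hq hqP => by
      by_contra h
      exact hqP (hn (Nat.support_factorization n ▸ Finsupp.mem_support_iff.2 h))
  set sa : ℕ → ℕ := fun v => a v / (a v).gcd N
  set ra : ℕ → ℕ := fun v => N / (a v).gcd N
  set sb : ℕ → ℕ := fun v => b v / (b v).gcd N
  set rb : ℕ → ℕ := fun v => N / (b v).gcd N
  have hra : ∀ v, ra v ≠ 0 := fun v => (Nat.div_pos (Nat.gcd_le_right _ (Nat.pos_of_ne_zero hN))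
      (Nat.gcd_pos_of_pos_right _ (Nat.pos_of_ne_zero hN))).ne'
  have hrb : ∀ v, rb v ≠ 0 := fun v => (Nat.div_pos (Nat.gcd_le_right _ (Nat.pos_of_ne_zero hN))
      (Nat.gcd_pos_of_pos_right _ (Nat.pos_of_ne_zero hN))).ne'
  have hsa : ∀ v ∈ V, sa v ≠ 0 := fun v hv =>
    (Nat.div_pos (Nat.gcd_le_left _ (Nat.pos_of_ne_zero (hV.ne_zero v hv)))
      (Nat.gcd_pos_of_pos_right _ (Nat.pos_of_ne_zero hN))).ne'
  have hsb : ∀ v ∈ W, sb v ≠ 0 := fun v hv =>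
    (Nat.div_pos (Nat.gcd_le_left _ (Nat.pos_of_ne_zero (hW.ne_zero v hv)))
      (Nat.gcd_pos_of_pos_right _ (Nat.pos_of_ne_zero hN))).ne'
  set E : ℕ → ℕ → Prop := fun v w =>
    ψ v * ((sb w : ℝ) * ra v) ≤ 1 ∧ θ w * ((sa v : ℝ) * rb w) ≤ 1 with hE
  have hone := one_le_expWeight z
  have main := sum_edges_sqrt_le E (fun v => ψ v * f v)
    (fun v => wprod (expWeight z) (sa v * ra v)) (fun v => (sa v : ℝ))
    (fun w => θ w * g w) (fun w => wprod (expWeight z) (sb w * rb w)) (fun w => (sb w : ℝ))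
    (4 * Real.exp (12 * Real.exp 6) ^ 2) (by positivity)
    (fun v => mul_nonneg (hψ v) (hV.nonneg v)) (fun w => mul_nonneg (hθ w) (hW.nonneg w))
    (fun v => wprod_pos hone _) (fun w => wprod_pos hone _) V W
    (fun v hv => by exact_mod_cast Nat.pos_of_ne_zero (hsa v hv))
    (fun v hv => by exact_mod_cast Nat.pos_of_ne_zero (hsb v hv))
    (fun V' hV' X hX hXV w hw => degree_le hz hP hPz hN hNP (hV.mono hV') hX hXV
      (fun v => E v w) _ fun v _ hvE => hvE.1)
    (fun W' hW' X hX hXW v hv => degree_le hz hP hPz hN hNP (hW.mono hW') hX hXW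
      (fun w => E v w) _ fun w _ hwE => hwE.2)
  refine le_trans (Finset.sum_le_sum fun v hv => Finset.sum_le_sum fun w hw => ?_) main
  have hwt : 0 ≤ ψ v * f v * (θ w * g w) :=
    mul_nonneg (mul_nonneg (hψ v) (hV.nonneg v)) (mul_nonneg (hθ w) (hW.nonneg w))
  have hHa := wprod_pos hone (sa v * ra v)
  have hHb := wprod_pos hone (sb w * rb w)
  have hrhs : 0 ≤ ψ v * f v * wprod (expWeight z) (sa v * ra v) *
      (θ w * g w * wprod (expWeight z) (sb w * rb w)) := by
    have := mul_nonneg hwt (mul_pos hHa hHb).le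
    calc (0 : ℝ) ≤ _ := this
      _ = _ := by ring
  by_cases hgood : ∀ p ∈ P, (a v).factorization p = k p ∨ (b w).factorization p = k p
  · rw [if_pos hgood]
    obtain ⟨hx, hy⟩ := div_gcd_of_good (hV.ne_zero v hv) (hW.ne_zero w hw) hN fun p hp => by
      rw [hNf]
      split_ifs with hpP
      · exact hgood p hpP
      · exact Or.inl (hoff (hV.subset v hv) p hp hpP)
    rw [hx, hy]
    have hcond : (ψ v * (b w / (b w).gcd N * (N / (a v).gcd N) : ℕ) ≤ 1 ∧
        θ w * (a v / (a v).gcd N * (N / (b w).gcd N) : ℕ) ≤ 1) ↔ E v w := by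
      rw [hE]; push_cast; rfl
    by_cases hc : E v w
    · rw [if_pos (hcond.2 hc), if_pos hc]
      have hwp : wprod (expWeight z) (sa v * rb w * (sb w * ra v)) ≤
          wprod (expWeight z) (sa v * ra v) * wprod (expWeight z) (sb w * rb w) := by
        rw [show sa v * rb w * (sb w * ra v) = (sa v * ra v) * (sb w * rb w) by ring]
        exact wprod_mul_le hone (mul_ne_zero (hsa v hv) (hra v)) (mul_ne_zero (hsb w hw) (hrb w))
      calc _ ≤ ψ v * f v * (θ w * g w) *
            (wprod (expWeight z) (sa v * ra v) * wprod (expWeight z) (sb w * rb w)) :=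
            mul_le_mul_of_nonneg_left hwp hwt
        _ = _ := by ring
    · rw [if_neg (fun h => hc (hcond.1 h)), if_neg hc]
  · rw [if_neg hgood]
    split_ifs
    · exact hrhs
    · exact le_rfl

lemma Adm.term_nonneg {P P' V W : Finset ℕ} {a b : ℕ → ℕ} {ψ f θ g : ℕ → ℝ} (z n : ℕ)
    (hψ : ∀ v, 0 ≤ ψ v) (hθ : ∀ w, 0 ≤ θ w) (hV : Adm P V a f) (hW : Adm P' W b g) (v w : ℕ) :
    0 ≤ ψ v * f v * (θ w * g w) * wprod (expWeight z) n :=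
  mul_nonneg (mul_nonneg (mul_nonneg (hψ v) (hV.nonneg v)) (mul_nonneg (hθ w) (hW.nonneg w)))
    (wprod_pos (one_le_expWeight z) _).le

open Classical in
lemma bil_le_bad_add_good {z : ℕ} {P : Finset ℕ} {V W : Finset ℕ} {a b : ℕ → ℕ}
    {ψ f θ g : ℕ → ℝ} (hψ : ∀ v, 0 ≤ ψ v) (hθ : ∀ w, 0 ≤ θ w) (hV : Adm P V a f)
    (hW : Adm P W b g) (k : ℕ → ℕ) :
    bil z V W a b ψ f θ g ≤
      ∑ p ∈ P, bil z (V.filter fun v => (a v).factorization p ≠ k p)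
        (W.filter fun w => (b w).factorization p ≠ k p) a b ψ f θ g +
      ∑ v ∈ V, ∑ w ∈ W,
        (if (∀ p ∈ P, (a v).factorization p = k p ∨ (b w).factorization p = k p) then
          if ψ v * (b w / (a v).gcd (b w) : ℕ) ≤ 1 ∧ θ w * (a v / (a v).gcd (b w) : ℕ) ≤ 1 then
            ψ v * f v * (θ w * g w) *
              wprod (expWeight z) (a v / (a v).gcd (b w) * (b w / (a v).gcd (b w)))
          else 0
        else 0) := by
  unfold bil
  simp_rw [Finset.sum_filter]
  set t : ℕ → ℕ → ℝ := fun v w =>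
    if ψ v * (b w / (a v).gcd (b w) : ℕ) ≤ 1 ∧ θ w * (a v / (a v).gcd (b w) : ℕ) ≤ 1 then
      ψ v * f v * (θ w * g w) *
        wprod (expWeight z) (a v / (a v).gcd (b w) * (b w / (a v).gcd (b w)))
    else 0 with ht
  have ht0 : ∀ v w, 0 ≤ t v w := fun v w => by
    rw [ht]; dsimp only
    split_ifs
    · exact hV.term_nonneg z _ hψ hθ hW v w
    · exact le_rfl
  have h1 : ∑ p ∈ P, ∑ v ∈ V, (if (a v).factorization p ≠ k p then
      ∑ w ∈ W, (if (b w).factorization p ≠ k p then t v w else 0) else 0) =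
      ∑ v ∈ V, ∑ w ∈ W, ∑ p ∈ P,
        (if (a v).factorization p ≠ k p ∧ (b w).factorization p ≠ k p then t v w else 0) := by
    rw [Finset.sum_comm]
    refine Finset.sum_congr rfl fun v _ => ?_
    rw [Finset.sum_comm]
    refine Finset.sum_congr rfl fun p _ => ?_
    by_cases hp : (a v).factorization p ≠ k p
    · simp [hp]
    · simp [hp]
  rw [h1, ← Finset.sum_add_distrib]
  refine Finset.sum_le_sum fun v _ => ?_
  rw [← Finset.sum_add_distrib]
  refine Finset.sum_le_sum fun w _ => ?_
  have hnn : ∀ p ∈ P, 0 ≤ (if (a v).factorization p ≠ k p ∧ (b w).factorization p ≠ k p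
      then t v w else 0) := fun p _ => by
    split_ifs
    · exact ht0 v w
    · exact le_rfl
  by_cases hg : ∀ p ∈ P, (a v).factorization p = k p ∨ (b w).factorization p = k p
  · rw [if_pos hg]
    have := Finset.sum_nonneg hnn
    change t v w ≤ _ + t v w
    linarith
  · rw [if_neg hg, add_zero]
    push Not at hg
    obtain ⟨p, hp, h⟩ := hg
    refine le_trans ?_ (Finset.single_le_sum hnn hp)
    rw [if_pos h]

lemma rpow_neg_quarter_le {p : ℕ} (hp : 10 ^ 22 ≤ p) :
    (p : ℝ) ^ (-(1 / 4) : ℝ) ≤ 1 / 10000 := by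
  have hp' : (10 : ℝ) ^ 22 ≤ p := by exact_mod_cast hp
  have h1 : ((10 : ℝ) ^ 16) ^ (1 / 4 : ℝ) ≤ (p : ℝ) ^ (1 / 4 : ℝ) :=
    Real.rpow_le_rpow (by positivity) (by linarith) (by norm_num)
  have h2 : ((10 : ℝ) ^ 16) ^ (1 / 4 : ℝ) = 10000 := by
    rw [← Real.rpow_natCast, ← Real.rpow_mul (by norm_num)]
    norm_num
  rw [h2] at h1
  rw [Real.rpow_neg (by positivity), ← one_div]
  exact one_div_le_one_div_of_le (by norm_num) h1

lemma kern_const_le {s : ℝ} (hs : 0 ≤ s) (hs1 : s ≤ 1 / 10000) :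
    1 + Real.exp 1 * (2 * s / (1 - s)) ≤ 2 := by
  have he := Real.exp_one_lt_d9
  have : 2 * s / (1 - s) ≤ 0.00021 := by
    rw [div_le_iff₀ (by linarith)]; linarith
  have h0 : 0 ≤ 2 * s / (1 - s) := div_nonneg (by linarith) (by linarith)
  nlinarith

lemma bad_rpow_le {p : ℕ} (hp : 0 < p) {M N : ℝ} (hM : 0 ≤ M) (hN : 0 ≤ N) :
    (100000 * (p : ℝ)⁻¹ * M * (100000 * (p : ℝ)⁻¹ * N)) ^ (3 / 4 : ℝ) ≤
      10 ^ 9 * (1 / Real.sqrt p ^ 3) * (M * N) ^ (3 / 4 : ℝ) := by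
  have hp0 : (0 : ℝ) < p := by exact_mod_cast hp
  have h1 : (100000 * (p : ℝ)⁻¹ * M * (100000 * (p : ℝ)⁻¹ * N)) ≤
      (1000 ^ 4 * (1 / Real.sqrt p) ^ 4) * (M * N) := by
    have : (1 / Real.sqrt p) ^ 4 = ((p : ℝ)⁻¹) ^ 2 := by
      rw [show (4 : ℕ) = 2 * 2 by norm_num, pow_mul, one_div, inv_pow, Real.sq_sqrt hp0.le]
    rw [this]
    have : 0 ≤ ((p : ℝ)⁻¹) ^ 2 * (M * N) := by positivity
    nlinarith
  refine (Real.rpow_le_rpow (by positivity) h1 (by norm_num)).trans ?_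
  rw [Real.mul_rpow (by positivity) (by positivity), ← mul_pow, ← Real.rpow_natCast,
    ← Real.rpow_mul (by positivity)]
  norm_num
  rw [mul_pow]
  norm_num

/-- The bilinear estimate when all primes are large. -/
lemma bilBound_of_large {z : ℕ} (hz : 10 ^ 22 ≤ z) (n : ℕ) :
    ∀ P : Finset ℕ, P.card = n → (∀ p ∈ P, p.Prime) → (∀ p ∈ P, z ≤ p) →
      BilBound z P (2 * goodConst) := by
  classical
  induction n with
  | zero =>
    intro P hP0 hP hPz V W a b ψ f θ g hψ hθ hV hW
    have hM : 0 ≤ (∑ v ∈ V, ψ v * f v) * ∑ w ∈ W, θ w * g w :=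
      mul_nonneg (Finset.sum_nonneg fun v _ => mul_nonneg (hψ v) (hV.nonneg v))
        (Finset.sum_nonneg fun v _ => mul_nonneg (hθ v) (hW.nonneg v))
    have h1 := bil_le_bad_add_good (z := z) hψ hθ hV hW (fun _ => 0)
    have h2 := bil_good_le (le_trans (by norm_num) hz) hP hPz hψ hθ hV hW (fun _ => 0)
    have h0 : 0 ≤ goodConst := Real.sqrt_nonneg _
    have h3 := mul_nonneg h0 (Real.rpow_nonneg hM (3 / 4))
    rw [Finset.card_eq_zero.1 hP0, Finset.sum_empty] at h1
    rw [Finset.card_eq_zero.1 hP0] at h2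
    linarith
  | succ n ih =>
    intro P hPn hP hPz V W a b ψ f θ g hψ hθ hV hW
    have h0 : 0 ≤ goodConst := Real.sqrt_nonneg _
    have hIH : ∀ p ∈ P, BilBound z (P.erase p) (2 * goodConst) := fun p hp =>
      ih (P.erase p) (by rw [Finset.card_erase_of_mem hp, hPn]; rfl)
        (fun q hq => hP q (Finset.mem_of_mem_erase hq))
        (fun q hq => hPz q (Finset.mem_of_mem_erase hq))
    set M := ∑ v ∈ V, ψ v * f v with hMdef
    set N := ∑ w ∈ W, θ w * g w with hNdef
    have hμ : ∀ v, 0 ≤ ψ v * f v := fun v => mul_nonneg (hψ v) (hV.nonneg v)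
    have hν : ∀ v, 0 ≤ θ v * g v := fun v => mul_nonneg (hθ v) (hW.nonneg v)
    have hM0 : 0 ≤ M := Finset.sum_nonneg fun v _ => hμ v
    have hN0 : 0 ≤ N := Finset.sum_nonneg fun v _ => hν v
    by_cases hk : ∀ p ∈ P, ∃ k : ℕ,
        ∑ v ∈ V.filter (fun v => (a v).factorization p ≠ k), ψ v * f v ≤ 100000 * (p : ℝ)⁻¹ * M ∧
        ∑ w ∈ W.filter (fun w => (b w).factorization p ≠ k), θ w * g w ≤ 100000 * (p : ℝ)⁻¹ * N
    · choose! k hk1 hk2 using hk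
      have h1 := bil_le_bad_add_good (z := z) hψ hθ hV hW k
      have h2 := bil_good_le (le_trans (by norm_num) hz) hP hPz hψ hθ hV hW k
      have h3 : ∑ p ∈ P, bil z (V.filter fun v => (a v).factorization p ≠ k p)
          (W.filter fun w => (b w).factorization p ≠ k p) a b ψ f θ g ≤
          ∑ p ∈ P, 2 * goodConst * 2 *
            (10 ^ 9 * (1 / Real.sqrt p ^ 3) * (M * N) ^ (3 / 4 : ℝ)) := by
        refine Finset.sum_le_sum fun p hp => ?_
        have hs := rpow_neg_quarter_le (hz.trans (hPz p hp))
        have hs0 : 0 ≤ (p : ℝ) ^ (-(1 / 4) : ℝ) := by positivity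
        refine (bil_le_mul_rpow (mul_nonneg zero_le_two h0) (hP p hp) (hIH p hp) hψ hθ
          (hV.mono (Finset.filter_subset _ _)) (hW.mono (Finset.filter_subset _ _)) rfl
          (by linarith) (kern_const_le hs0 hs)).trans ?_
        refine mul_le_mul_of_nonneg_left ?_ (by positivity)
        refine le_trans ?_ (bad_rpow_le (hP p hp).pos hM0 hN0)
        have hA := Finset.sum_nonneg (s := V.filter fun v => (a v).factorization p ≠ k p)
          fun v _ => hμ v
        have hB := Finset.sum_nonneg (s := W.filter fun w => (b w).factorization p ≠ k p)
          fun v _ => hν v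
        refine Real.rpow_le_rpow (mul_nonneg hA hB) ?_ (by norm_num)
        exact mul_le_mul (hk1 p hp) (hk2 p hp) hB (by positivity)
      have h4 : ∑ p ∈ P, 2 * goodConst * 2 *
            (10 ^ 9 * (1 / Real.sqrt p ^ 3) * (M * N) ^ (3 / 4 : ℝ)) =
          4 * goodConst * 10 ^ 9 * (M * N) ^ (3 / 4 : ℝ) * ∑ p ∈ P, 1 / Real.sqrt p ^ 3 := by
        generalize (M * N) ^ (3 / 4 : ℝ) = T
        rw [Finset.mul_sum]
        exact Finset.sum_congr rfl fun p _ => by ring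
      have h5 : ∑ p ∈ P, 1 / Real.sqrt p ^ 3 ≤ 6 / 10 ^ 11 := by
        refine (sum_inv_mul_sqrt_le (le_trans (by norm_num) hz) P hPz).trans ?_
        refine div_le_div_of_nonneg_left (by norm_num) (by norm_num) (Real.le_sqrt_of_sq_le ?_)
        have : ((10 ^ 22 : ℕ) : ℝ) ≤ z := by exact_mod_cast hz
        push_cast at this
        norm_num at this ⊢
        exact this
      have h6 : 0 ≤ (M * N) ^ (3 / 4 : ℝ) := by positivity
      have h7 : 4 * goodConst * 10 ^ 9 * (M * N) ^ (3 / 4 : ℝ) * ∑ p ∈ P, 1 / Real.sqrt p ^ 3 ≤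
          4 * goodConst * 10 ^ 9 * (M * N) ^ (3 / 4 : ℝ) * (6 / 10 ^ 11) :=
        mul_le_mul_of_nonneg_left h5 (by positivity)
      have h8 : 0 ≤ goodConst * (M * N) ^ (3 / 4 : ℝ) := by positivity
      linarith
    · push Not at hk
      obtain ⟨p, hp, hk⟩ := hk
      set R := V.image (fun v => (a v).factorization p) ∪ W.image (fun v => (b v).factorization p)
      have hRV : ∀ v ∈ V, (a v).factorization p ∈ R := fun v hv =>
        Finset.mem_union_left _ (Finset.mem_image_of_mem _ hv)
      have hRW : ∀ v ∈ W, (b v).factorization p ∈ R := fun v hv =>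
        Finset.mem_union_right _ (Finset.mem_image_of_mem _ hv)
      refine (bil_le_sum_kern (hP p hp) (hIH p hp) hψ hθ hV hW R hRV hRW).trans
        (mul_le_mul_of_nonneg_left ?_ (mul_nonneg zero_le_two h0))
      by_contra! hcon
      have hs := rpow_neg_quarter_le (hz.trans (hPz p hp))
      have hs0 : 0 ≤ (p : ℝ) ^ (-(1 / 4) : ℝ) := by positivity
      have hs4 : ((p : ℝ) ^ (-(1 / 4) : ℝ)) ^ 4 = (p : ℝ)⁻¹ := by
        rw [← Real.rpow_natCast, ← Real.rpow_mul (by positivity), ← Real.rpow_neg_one]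
        norm_num
      have hMf := sum_fiber hRV (fun v => ψ v * f v)
      have hNf := sum_fiber hRW (fun v => θ v * g v)
      rw [hMdef, hNdef, hMf, hNf] at hcon
      obtain ⟨k, hkR, h1, h2⟩ := kern_concentration hs0 hs R _ _
        (fun i => Finset.sum_nonneg fun v _ => hμ v)
        (fun i => Finset.sum_nonneg fun v _ => hν v) hcon
      rw [hs4, ← hMf] at h1
      rw [hs4, ← hNf] at h2
      have e1 : ∑ v ∈ V.filter (fun v => (a v).factorization p ≠ k), ψ v * f v =
          ∑ i ∈ R.erase k, ∑ v ∈ V.filter (fun v => (a v).factorization p = i), ψ v * f v := by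
        have ha := Finset.sum_erase_add R
          (fun i => ∑ v ∈ V.filter (fun v => (a v).factorization p = i), ψ v * f v) hkR
        have hb := Finset.sum_filter_add_sum_filter_not V
          (fun v => (a v).factorization p = k) (fun v => ψ v * f v)
        linarith
      have e2 : ∑ v ∈ W.filter (fun v => (b v).factorization p ≠ k), θ v * g v =
          ∑ i ∈ R.erase k, ∑ v ∈ W.filter (fun v => (b v).factorization p = i), θ v * g v := by
        have ha := Finset.sum_erase_add R
          (fun i => ∑ v ∈ W.filter (fun v => (b v).factorization p = i), θ v * g v) hkR
        have hb := Finset.sum_filter_add_sum_filter_not W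
          (fun v => (b v).factorization p = k) (fun v => θ v * g v)
        linarith
      have := hk k (e1 ▸ h1)
      rw [e2] at this
      linarith

/-- The constant lost for each small prime. -/
noncomputable def smallPrimeConst : ℝ :=
  1 + Real.exp 1 * (2 * (2 : ℝ) ^ (-(1 / 4) : ℝ) / (1 - (2 : ℝ) ^ (-(1 / 4) : ℝ)))

lemma two_rpow_neg_quarter_lt_one : (2 : ℝ) ^ (-(1 / 4) : ℝ) < 1 :=
  Real.rpow_lt_one_of_one_lt_of_neg (by norm_num) (by norm_num)

lemma one_le_smallPrimeConst : 1 ≤ smallPrimeConst := by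
  have := two_rpow_neg_quarter_lt_one
  have : 0 ≤ 2 * (2 : ℝ) ^ (-(1 / 4) : ℝ) / (1 - (2 : ℝ) ^ (-(1 / 4) : ℝ)) :=
    div_nonneg (by positivity) (by linarith)
  have := mul_nonneg (Real.exp_pos 1).le this
  unfold smallPrimeConst
  linarith

/-- The general bilinear estimate. -/
lemma bilBound {z : ℕ} (hz : 10 ^ 22 ≤ z) (n : ℕ) :
    ∀ P : Finset ℕ, (∀ p ∈ P, p.Prime) → (P.filter (· < z)).card = n →
      BilBound z P (2 * goodConst * smallPrimeConst ^ n) := by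
  have h0 : 0 ≤ goodConst := Real.sqrt_nonneg _
  have hc := one_le_smallPrimeConst
  induction n with
  | zero =>
    intro P hP hn
    rw [pow_zero, mul_one]
    refine bilBound_of_large hz _ P rfl hP fun p hp => ?_
    by_contra! h
    have := Finset.card_eq_zero.1 hn
    exact Finset.notMem_empty p (this ▸ Finset.mem_filter.2 ⟨hp, h⟩)
  | succ n ih =>
    intro P hP hn V W a b ψ f θ g hψ hθ hV hW
    obtain ⟨p, hp⟩ := Finset.card_pos.1 (by omega : 0 < (P.filter (· < z)).card)
    have hpP := (Finset.mem_filter.1 hp).1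
    have hIH := ih (P.erase p) (fun q hq => hP q (Finset.mem_of_mem_erase hq))
      (by rw [Finset.filter_erase, Finset.card_erase_of_mem hp, hn]; rfl)
    have hp2 : (2 : ℝ) ≤ p := by exact_mod_cast (hP p hpP).two_le
    have hs : (p : ℝ) ^ (-(1 / 4) : ℝ) ≤ (2 : ℝ) ^ (-(1 / 4) : ℝ) :=
      Real.rpow_le_rpow_of_nonpos (by norm_num) hp2 (by norm_num)
    have h2 := two_rpow_neg_quarter_lt_one
    have hs0 : 0 ≤ (p : ℝ) ^ (-(1 / 4) : ℝ) := by positivity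
    rw [pow_succ, ← mul_assoc]
    refine bil_le_mul_rpow (by positivity) (hP p hpP) hIH hψ hθ hV hW rfl (by linarith) ?_
    unfold smallPrimeConst
    gcongr

/-- The part of `m / φ(m)` coming from the primes larger than `X`. -/
noncomputable def tailProd (X : ℝ) (m : ℕ) : ℝ :=
  ∏ p ∈ m.primeFactors.filter (fun p : ℕ => X < p), (1 - (p : ℝ)⁻¹)⁻¹

lemma one_le_inv_factor {p : ℕ} (hp : p.Prime) : 1 ≤ (1 - (p : ℝ)⁻¹)⁻¹ :=
  (one_le_inv₀ (totRatio_factor_pos hp)).2 (totRatio_factor_le_one p)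

lemma tailProd_nonneg (X : ℝ) (m : ℕ) : 0 ≤ tailProd X m :=
  Finset.prod_nonneg fun _ hp => zero_le_one.trans
    (one_le_inv_factor (Nat.prime_of_mem_primeFactors (Finset.mem_filter.1 hp).1))

lemma tailProd_anti {X Y : ℝ} (h : X ≤ Y) (m : ℕ) : tailProd Y m ≤ tailProd X m := by
  unfold tailProd
  refine Finset.prod_le_prod_of_subset_of_one_le (fun p hp => ?_) (fun p hp => ?_)
    fun p hp _ => ?_
  · exact Finset.mem_filter.2 ⟨(Finset.mem_filter.1 hp).1, h.trans_lt (Finset.mem_filter.1 hp).2⟩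
  · exact zero_le_one.trans
      (one_le_inv_factor (Nat.prime_of_mem_primeFactors (Finset.mem_filter.1 hp).1))
  · exact one_le_inv_factor (Nat.prime_of_mem_primeFactors (Finset.mem_filter.1 hp).1)

lemma prod_Ico_inv_factor {s : ℕ} (hs : 1 ≤ s) (k : ℕ) :
    ∏ n ∈ Finset.Ico (s + 1) (s + 1 + k), (1 - (n : ℝ)⁻¹)⁻¹ = (s + k : ℝ) / s := by
  have hs' : (1 : ℝ) ≤ s := by exact_mod_cast hs
  induction k with
  | zero => simp; field_simp
  | succ k ih =>
    rw [← add_assoc, Finset.prod_Ico_succ_top (by omega), ih]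
    push_cast
    have h1 : (s : ℝ) + k ≠ 0 := by positivity
    have h2 : (s : ℝ) + 1 + k ≠ 0 := by positivity
    have : 1 - ((s : ℝ) + 1 + k)⁻¹ = (s + k) / (s + 1 + k) := by field_simp; ring
    rw [this]
    field_simp
    ring

lemma log_expWeight_prod (z m : ℕ) : wprod (expWeight z) m =
    Real.exp (z * ∑ p ∈ m.primeFactors.filter (z ≤ ·), (p : ℝ)⁻¹) := by
  unfold wprod expWeight
  rw [Finset.prod_ite, Finset.prod_const_one, mul_one, ← Real.exp_sum, Finset.mul_sum]
  simp only [div_eq_mul_inv]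

lemma inv_factor_le_exp {p : ℕ} (hp : p.Prime) : (1 - (p : ℝ)⁻¹)⁻¹ ≤ Real.exp (2 * (p : ℝ)⁻¹) := by
  have h2 : (2 : ℝ) ≤ p := by exact_mod_cast hp.two_le
  have hx : (p : ℝ)⁻¹ ≤ 1 / 2 := by
    rw [one_div]; exact inv_anti₀ (by norm_num) h2
  have hx0 : 0 ≤ (p : ℝ)⁻¹ := by positivity
  set x := (p : ℝ)⁻¹
  refine le_trans ?_ (Real.add_one_le_exp _)
  rw [inv_le_iff_one_le_mul₀ (by linarith)]
  nlinarith

lemma tailProd_le_mul_exp {s z : ℕ} (hs : 1 ≤ s) (hsz : s + 1 ≤ z) (m : ℕ) :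
    tailProd s m ≤ z / s *
      Real.exp (2 * ∑ p ∈ m.primeFactors.filter (z ≤ ·), (p : ℝ)⁻¹) := by
  have hprime : ∀ p ∈ m.primeFactors, p.Prime := fun p hp => Nat.prime_of_mem_primeFactors hp
  unfold tailProd
  rw [← Finset.prod_filter_mul_prod_filter_not _ (fun p => p < z)]
  have hs0 : (0 : ℝ) < s := by exact_mod_cast hs
  refine mul_le_mul ?_ ?_ ?_ (by positivity)
  · have h1 := prod_Ico_inv_factor hs (z - (s + 1))
    rw [Nat.add_sub_cancel' hsz] at h1
    calc _ ≤ ∏ n ∈ Finset.Ico (s + 1) z, (1 - (n : ℝ)⁻¹)⁻¹ := by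
          refine Finset.prod_le_prod_of_subset_of_one_le (fun p hp => ?_) (fun p hp => ?_)
            fun n hn _ => ?_
          · simp only [Finset.mem_filter, Nat.cast_lt] at hp
            exact Finset.mem_Ico.2 ⟨by omega, hp.2⟩
          · simp only [Finset.mem_filter] at hp
            exact zero_le_one.trans (one_le_inv_factor (hprime p hp.1.1))
          · have hn2 : 2 ≤ n := by have := Finset.mem_Ico.1 hn; omega
            have : (n : ℝ)⁻¹ < 1 := inv_lt_one_of_one_lt₀ (by exact_mod_cast hn2)
            have : 0 ≤ (n : ℝ)⁻¹ := by positivity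
            exact (one_le_inv₀ (by linarith)).2 (by linarith)
      _ ≤ _ := by
          rw [h1]
          gcongr
          rw [Nat.cast_sub hsz]; push_cast; linarith
  · rw [Finset.mul_sum, Real.exp_sum]
    have he : (m.primeFactors.filter fun p : ℕ => (s : ℝ) < p).filter (fun p => ¬ p < z) =
        m.primeFactors.filter (z ≤ ·) := by
      ext p
      simp only [Finset.mem_filter, Nat.cast_lt, not_lt]
      constructor
      · rintro ⟨⟨h1, -⟩, h2⟩; exact ⟨h1, h2⟩
      · rintro ⟨h1, h2⟩; exact ⟨⟨h1, by omega⟩, h2⟩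
    rw [he]
    exact Finset.prod_le_prod (fun p hp => zero_le_one.trans
      (one_le_inv_factor (hprime p (Finset.mem_filter.1 hp).1)))
      fun p hp => inv_factor_le_exp (hprime p (Finset.mem_filter.1 hp).1)
  · refine Finset.prod_nonneg fun p hp => zero_le_one.trans (one_le_inv_factor (hprime p ?_))
    exact (Finset.mem_filter.1 (Finset.mem_filter.1 hp).1).1

lemma tailProd_le_add {s z : ℕ} (hs : 1 ≤ s) (hsz : s + 1 ≤ z) {c : ℝ} (m : ℕ) :
    tailProd s m ≤ z / s * (Real.exp c + Real.exp (-c * (z / 2 - 1)) * wprod (expWeight z) m) := by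
  refine (tailProd_le_mul_exp hs hsz m).trans ?_
  rw [log_expWeight_prod]
  set S := ∑ p ∈ m.primeFactors.filter (z ≤ ·), (p : ℝ)⁻¹
  have hz2 : (2 : ℝ) ≤ z := by exact_mod_cast (by omega : 2 ≤ z)
  refine mul_le_mul_of_nonneg_left ?_ (by positivity)
  rw [← Real.exp_add]
  rcases le_total (2 * S) c with h | h
  · have := Real.exp_le_exp.2 h
    have := Real.exp_pos (-c * (z / 2 - 1) + z * S)
    linarith
  · have : Real.exp (2 * S) ≤ Real.exp (-c * (z / 2 - 1) + z * S) := Real.exp_le_exp.2 (by nlinarith)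
    have := Real.exp_pos c
    linarith

/-- The size parameter of the pair of moduli `(v, w)`. -/
noncomputable def pairSize (ψ : ℕ → ℝ) (v w : ℕ) : ℝ :=
  max (ψ v * (w / v.gcd w : ℕ)) (ψ w * (v / v.gcd w : ℕ))

/-- The reduced product `(v / g) (w / g)`, `g = gcd v w`. -/
def pairMod (v w : ℕ) : ℕ := v / v.gcd w * (w / v.gcd w)

lemma exists_dyadic {D : ℝ} (hD : 1 / 2 < D) : ∃ j : ℕ, D ≤ 2 ^ j ∧ (2 : ℝ) ^ j ≤ 2 * D := by
  classical
  have hex : ∃ j : ℕ, D ≤ 2 ^ j := by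
    obtain ⟨n, hn⟩ := pow_unbounded_of_one_lt D (one_lt_two)
    exact ⟨n, hn.le⟩
  refine ⟨Nat.find hex, Nat.find_spec hex, ?_⟩
  rcases h : Nat.find hex with _ | k
  · simp; linarith
  · have := Nat.find_min hex (show k < Nat.find hex by omega)
    push Not at this
    rw [pow_succ]; linarith

lemma level_sum_le {V : Finset ℕ} (hV : ∀ v ∈ V, v ≠ 0) {ψ : ℕ → ℝ} (hψ : ∀ v, 0 ≤ ψ v)
    (hS : ∑ v ∈ V, ψ v * totRatio v ≤ 2) {t : ℝ} (ht : 1 ≤ t) {z : ℕ} (hz : 10 ^ 22 ≤ z) :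
    ∑ v ∈ V, ∑ w ∈ V, (if pairSize ψ v w ≤ t then
        ψ v * totRatio v * (ψ w * totRatio w) * wprod (expWeight z) (pairMod v w) else 0) ≤
      t ^ 2 * (8 * goodConst * smallPrimeConst ^ z) := by
  have ht0 : 0 < t := by linarith
  set P := V.biUnion Nat.primeFactors
  have hP : ∀ p ∈ P, p.Prime := fun p hp => by
    obtain ⟨v, -, h⟩ := Finset.mem_biUnion.1 hp
    exact Nat.prime_of_mem_primeFactors h
  have hadm : Adm P V id totRatio := ⟨Function.injective_id.injOn, hV,
    fun v hv => Finset.subset_biUnion_of_mem Nat.primeFactors hv, fun v => (totRatio_pos v).le,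
    fun v _ => le_rfl⟩
  have hb := bilBound hz _ P hP rfl V V id id (fun v => ψ v / t) totRatio (fun v => ψ v / t) totRatio
    (fun v => div_nonneg (hψ v) ht0.le) (fun v => div_nonneg (hψ v) ht0.le) hadm hadm
  have hcard : (P.filter (· < z)).card ≤ z := by
    calc _ ≤ (Finset.range z).card := Finset.card_le_card fun p hp =>
          Finset.mem_range.2 (Finset.mem_filter.1 hp).2
      _ = z := Finset.card_range z
  have hsum : ∑ v ∈ V, ψ v / t * totRatio v = (∑ v ∈ V, ψ v * totRatio v) / t := by
    rw [Finset.sum_div]; exact Finset.sum_congr rfl fun v _ => by ring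
  have hS0 : 0 ≤ ∑ v ∈ V, ψ v * totRatio v :=
    Finset.sum_nonneg fun v _ => mul_nonneg (hψ v) (totRatio_pos v).le
  have hS2 : (∑ v ∈ V, ψ v * totRatio v) / t ≤ 2 := by
    rw [div_le_iff₀ ht0]; nlinarith
  have hS3 : 0 ≤ (∑ v ∈ V, ψ v * totRatio v) / t := by positivity
  have hbil : t ^ 2 * bil z V V id id (fun v => ψ v / t) totRatio (fun v => ψ v / t) totRatio =
      ∑ v ∈ V, ∑ w ∈ V, (if pairSize ψ v w ≤ t then
        ψ v * totRatio v * (ψ w * totRatio w) * wprod (expWeight z) (pairMod v w) else 0) := by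
    unfold bil
    rw [Finset.mul_sum]
    refine Finset.sum_congr rfl fun v _ => ?_
    rw [Finset.mul_sum]
    refine Finset.sum_congr rfl fun w _ => ?_
    rw [mul_ite, mul_zero]
    refine if_congr ?_ ?_ rfl
    · rw [pairSize, max_le_iff, div_mul_eq_mul_div, div_le_one ht0, div_mul_eq_mul_div,
        div_le_one ht0]
      rfl
    · simp only [id, pairMod]
      field_simp
  rw [← hbil]
  refine mul_le_mul_of_nonneg_left (hb.trans ?_) (by positivity)
  have hg : 0 ≤ goodConst := Real.sqrt_nonneg _
  have hc := one_le_smallPrimeConst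
  rw [hsum]
  have hr : ((∑ v ∈ V, ψ v * totRatio v) / t * ((∑ v ∈ V, ψ v * totRatio v) / t)) ^ (3 / 4 : ℝ) ≤ 4 := by
    calc _ ≤ (4 : ℝ) ^ (3 / 4 : ℝ) := Real.rpow_le_rpow (by positivity) (by nlinarith) (by norm_num)
      _ ≤ (4 : ℝ) ^ (1 : ℝ) := Real.rpow_le_rpow_of_exponent_le (by norm_num) (by norm_num)
      _ = 4 := Real.rpow_one 4
  have hpw : smallPrimeConst ^ (P.filter (· < z)).card ≤ smallPrimeConst ^ z :=
    pow_le_pow_right₀ hc hcard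
  calc _ ≤ 2 * goodConst * smallPrimeConst ^ z * 4 := by gcongr
    _ = _ := by ring

/-- The pair correlations of a finite set of moduli of bounded mass are bounded. -/
lemma exists_sum_tailProd_le : ∃ C : ℝ, ∀ (V : Finset ℕ) (ψ : ℕ → ℝ), (∀ v ∈ V, v ≠ 0) →
    (∀ v, 0 ≤ ψ v) → ∑ v ∈ V, ψ v * totRatio v ≤ 2 →
    ∑ v ∈ V, ∑ w ∈ V, (if 1 / 2 < pairSize ψ v w then
      ψ v * totRatio v * (ψ w * totRatio w) * tailProd (2 * pairSize ψ v w) (pairMod v w) else 0) ≤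
      C := by
  set K : ℕ := 10 ^ 22 with hK
  set c : ℝ := 4 * Real.log smallPrimeConst + 4 with hc
  have hc1 := one_le_smallPrimeConst
  have hlog : 0 ≤ Real.log smallPrimeConst := Real.log_nonneg hc1
  have hg : 0 ≤ goodConst := Real.sqrt_nonneg _
  refine ⟨K * Real.exp c * 4 + K * (Real.exp c * 8 * goodConst) * 2,
    fun V ψ hV hψ hS => ?_⟩
  have hμ : ∀ v, 0 ≤ ψ v * totRatio v := fun v => mul_nonneg (hψ v) (totRatio_pos v).le
  have hS0 : 0 ≤ ∑ v ∈ V, ψ v * totRatio v := Finset.sum_nonneg fun v _ => hμ v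
  choose! j hj using fun D : ℝ => @exists_dyadic D
  set J := (V ×ˢ V).sup (fun q => j (pairSize ψ q.1 q.2)) + 1
  have hJ : ∀ v ∈ V, ∀ w ∈ V, j (pairSize ψ v w) < J := fun v hv w hw =>
    Nat.lt_succ_of_le (Finset.le_sup (f := fun q : ℕ × ℕ => j (pairSize ψ q.1 q.2))
      (Finset.mem_product.2 ⟨hv, hw⟩ : (v, w) ∈ V ×ˢ V))
  set E : ℕ → ℝ := fun i => Real.exp (-c * ((K * 2 ^ i : ℕ) / 2 - 1)) with hE
  have hK0 : (K : ℝ) ≠ 0 := by rw [hK]; positivity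
  have hpt : ∀ v ∈ V, ∀ w ∈ V, (if 1 / 2 < pairSize ψ v w then
      ψ v * totRatio v * (ψ w * totRatio w) * tailProd (2 * pairSize ψ v w) (pairMod v w) else 0) ≤
      K * Real.exp c * (ψ v * totRatio v * (ψ w * totRatio w)) +
      ∑ i ∈ Finset.range J, K * E i * (if pairSize ψ v w ≤ 2 ^ i then
        ψ v * totRatio v * (ψ w * totRatio w) *
          wprod (expWeight (K * 2 ^ i)) (pairMod v w) else 0) := by
    intro v hv w hw
    have hm : 0 ≤ ψ v * totRatio v * (ψ w * totRatio w) := mul_nonneg (hμ v) (hμ w)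
    have hH : ∀ i, 0 ≤ wprod (expWeight (K * 2 ^ i)) (pairMod v w) := fun i =>
      (wprod_pos (one_le_expWeight _) _).le
    have hterm : ∀ i ∈ Finset.range J, 0 ≤ K * E i * (if pairSize ψ v w ≤ 2 ^ i then
        ψ v * totRatio v * (ψ w * totRatio w) *
          wprod (expWeight (K * 2 ^ i)) (pairMod v w) else 0) := fun i _ => by
      refine mul_nonneg (mul_nonneg (Nat.cast_nonneg _) (Real.exp_pos _).le) ?_
      split_ifs
      · exact mul_nonneg hm (hH i)
      · exact le_rfl
    split_ifs with hD
    · obtain ⟨h1, h2⟩ := hj _ hD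
      set i := j (pairSize ψ v w)
      refine le_trans ?_ (add_le_add_right (Finset.single_le_sum hterm
        (Finset.mem_range.2 (hJ v hv w hw))) _)
      rw [if_pos h1]
      have hi1 : 1 ≤ 2 ^ i := Nat.one_le_two_pow
      have h3 : tailProd (2 * pairSize ψ v w) (pairMod v w) ≤ K *
          (Real.exp c + E i * wprod (expWeight (K * 2 ^ i)) (pairMod v w)) := by
        refine (tailProd_anti (X := ((2 ^ i : ℕ) : ℝ)) (by push_cast; exact h2) _).trans ?_
        refine (tailProd_le_add (z := K * 2 ^ i) (c := c) hi1 (by rw [hK]; omega) _).trans_eq ?_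
        rw [hE]
        congr 1
        push_cast
        field_simp
      calc _ ≤ ψ v * totRatio v * (ψ w * totRatio w) * (K *
          (Real.exp c + E i * wprod (expWeight (K * 2 ^ i)) (pairMod v w))) :=
            mul_le_mul_of_nonneg_left h3 hm
        _ = _ := by ring
    · exact add_nonneg (mul_nonneg (mul_nonneg (Nat.cast_nonneg _) (Real.exp_pos _).le) hm)
        (Finset.sum_nonneg hterm)
  refine (Finset.sum_le_sum fun v hv => Finset.sum_le_sum fun w hw => hpt v hv w hw).trans ?_
  simp only [Finset.sum_add_distrib]
  refine add_le_add ?_ ?_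
  · simp only [← Finset.mul_sum]
    refine mul_le_mul_of_nonneg_left ?_ (mul_nonneg (Nat.cast_nonneg _) (Real.exp_pos _).le)
    rw [← Finset.sum_mul]
    nlinarith
  · have hcomm : ∑ v ∈ V, ∑ w ∈ V, ∑ i ∈ Finset.range J, K * E i * (if pairSize ψ v w ≤ 2 ^ i then
        ψ v * totRatio v * (ψ w * totRatio w) *
          wprod (expWeight (K * 2 ^ i)) (pairMod v w) else 0) =
        ∑ i ∈ Finset.range J, K * E i * ∑ v ∈ V, ∑ w ∈ V, (if pairSize ψ v w ≤ 2 ^ i then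
        ψ v * totRatio v * (ψ w * totRatio w) *
          wprod (expWeight (K * 2 ^ i)) (pairMod v w) else 0) := by
      simp only [Finset.mul_sum]
      rw [Finset.sum_comm' (s := Finset.range J) (t' := V) (s' := fun _ => Finset.range J)
        (t := fun _ => V) (by simp [and_comm])]
      refine Finset.sum_congr rfl fun v _ => ?_
      rw [Finset.sum_comm]
    rw [hcomm]
    have hlev : ∀ i ∈ Finset.range J, K * E i * ∑ v ∈ V, ∑ w ∈ V, (if pairSize ψ v w ≤ 2 ^ i then
        ψ v * totRatio v * (ψ w * totRatio w) *
          wprod (expWeight (K * 2 ^ i)) (pairMod v w) else 0) ≤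
        K * (Real.exp c * 8 * goodConst) * (1 / 2) ^ i := by
      intro i _
      set t : ℝ := 2 ^ i with ht
      have ht1 : 1 ≤ t := one_le_pow₀ (by norm_num)
      have hz : 10 ^ 22 ≤ K * 2 ^ i := Nat.le_mul_of_pos_right _ (by positivity)
      have h1 := level_sum_le hV hψ hS ht1 hz
      set z := K * 2 ^ i with hzdef
      have hzr : (z : ℝ) = K * t := by rw [hzdef, ht]; push_cast; ring
      have hzt : 3 / 2 * t ≤ z := by
        rw [hzr]
        refine mul_le_mul_of_nonneg_right ?_ (by linarith)
        rw [hK]; norm_num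
      have hEz : E i * smallPrimeConst ^ z ≤ Real.exp c * Real.exp (-(2 * z)) := by
        have : smallPrimeConst ^ z = Real.exp (z * Real.log smallPrimeConst) := by
          rw [mul_comm, Real.exp_mul, Real.exp_log (by linarith), Real.rpow_natCast]
        have hEi : E i = Real.exp (-c * ((z : ℝ) / 2 - 1)) := rfl
        rw [this, hEi, ← Real.exp_add, ← Real.exp_add]
        refine Real.exp_le_exp.2 ?_
        have : 0 ≤ (z : ℝ) * Real.log smallPrimeConst := by positivity
        rw [hc]
        nlinarith
      have hexp : t ^ 2 * Real.exp (-(2 * z)) ≤ (1 / 2) ^ i := by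
        rw [one_div, inv_pow, ← ht, Real.exp_neg, ← div_eq_mul_inv, div_le_iff₀ (Real.exp_pos _),
          ← div_eq_inv_mul, le_div_iff₀ (by linarith)]
        have h3 : t ≤ Real.exp (2 * z / 3) := by
          have := Real.add_one_le_exp (2 * (z : ℝ) / 3)
          linarith
        calc t ^ 2 * t = t ^ 3 := by ring
          _ ≤ Real.exp (2 * z / 3) ^ 3 := by gcongr
          _ = Real.exp (2 * z) := by rw [← Real.exp_nat_mul]; congr 1; push_cast; ring
      calc K * E i * _ ≤ K * E i * (t ^ 2 * (8 * goodConst * smallPrimeConst ^ z)) :=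
            mul_le_mul_of_nonneg_left h1 (mul_nonneg (Nat.cast_nonneg _) (Real.exp_pos _).le)
        _ = K * 8 * goodConst * t ^ 2 * (E i * smallPrimeConst ^ z) := by ring
        _ ≤ K * 8 * goodConst * t ^ 2 * (Real.exp c * Real.exp (-(2 * z))) :=
            mul_le_mul_of_nonneg_left hEz (by positivity)
        _ = K * (Real.exp c * 8 * goodConst) * (t ^ 2 * Real.exp (-(2 * z))) := by ring
        _ ≤ _ := mul_le_mul_of_nonneg_left hexp (by positivity)
    refine (Finset.sum_le_sum hlev).trans ?_
    rw [← Finset.mul_sum]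
    refine mul_le_mul_of_nonneg_left ?_ (by positivity)
    exact sum_geometric_two_le J

/-- The primes up to `N`. -/
def primesUpTo (N : ℕ) : Finset ℕ := (Finset.Icc 1 N).filter Nat.Prime

lemma mem_primesUpTo {N p : ℕ} : p ∈ primesUpTo N ↔ p ≤ N ∧ p.Prime := by
  simp only [primesUpTo, Finset.mem_filter, Finset.mem_Icc]
  exact ⟨fun h => ⟨h.1.2, h.2⟩, fun h => ⟨⟨h.2.one_lt.le, h.1⟩, h.2⟩⟩

lemma sum_log_prime_le (N : ℕ) : ∑ p ∈ primesUpTo N, Real.log p ≤ 2 * N := by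
  have h := Chebyshev.theta_le_log4_mul_x (x := N) (Nat.cast_nonneg N)
  have h4 : Real.log 4 ≤ 2 := by
    rw [show (4 : ℝ) = 2 ^ 2 by norm_num, Real.log_pow]
    have := Real.log_two_lt_d9
    push_cast; linarith
  have e : Chebyshev.theta (N : ℝ) = ∑ p ∈ primesUpTo N, Real.log p := by
    rw [Chebyshev.theta, Nat.floor_natCast]
    refine Finset.sum_congr ?_ fun _ _ => rfl
    ext p
    simp only [mem_primesUpTo, Finset.mem_filter, Finset.mem_Ioc]
    exact ⟨fun h => ⟨h.1.2, h.2⟩, fun h => ⟨⟨h.2.pos, h.1⟩, h.2⟩⟩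
  rw [← e]
  exact h.trans (mul_le_mul_of_nonneg_right h4 (Nat.cast_nonneg N))

lemma sum_log_primeFactors_le {n : ℕ} (hn : n ≠ 0) :
    ∑ p ∈ n.primeFactors, Real.log p ≤ Real.log n := by
  rw [← Real.log_prod fun p hp =>
    Nat.cast_ne_zero.2 (Nat.prime_of_mem_primeFactors hp).ne_zero]
  refine Real.log_le_log (Finset.prod_pos fun p hp =>
    Nat.cast_pos.2 (Nat.prime_of_mem_primeFactors hp).pos) ?_
  rw [← Nat.cast_prod]
  exact Nat.cast_le.2 (Nat.le_of_dvd (Nat.pos_of_ne_zero hn) (Nat.prod_primeFactors_dvd n))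

lemma sum_log_div_le {N : ℕ} (hN : 1 ≤ N) :
    ∑ p ∈ primesUpTo N, Real.log p / p ≤ Real.log N + 2 := by
  have hN0 : (0 : ℝ) < N := by exact_mod_cast hN
  have h1 : ∑ p ∈ primesUpTo N, Real.log p * (N / p : ℕ) ≤ N * Real.log N := by
    calc _ = ∑ p ∈ primesUpTo N, ∑ n ∈ Finset.Ioc 0 N, if p ∣ n then Real.log p else 0 := by
          refine Finset.sum_congr rfl fun p _ => ?_
          rw [← Finset.sum_filter, Finset.sum_const, Nat.Ioc_filter_dvd_card_eq_div, nsmul_eq_mul,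
            mul_comm]
      _ = ∑ n ∈ Finset.Ioc 0 N, ∑ p ∈ n.primeFactors, Real.log p := by
          rw [Finset.sum_comm]
          refine Finset.sum_congr rfl fun n hn => ?_
          rw [← Finset.sum_filter]
          refine Finset.sum_congr ?_ fun _ _ => rfl
          have := Finset.mem_Ioc.1 hn
          ext p
          simp only [Finset.mem_filter, mem_primesUpTo, Nat.mem_primeFactors]
          exact ⟨fun h => ⟨h.1.2, h.2, by omega⟩, fun h =>
            ⟨⟨(Nat.le_of_dvd this.1 h.2.1).trans this.2, h.1⟩, h.2.1⟩⟩
      _ ≤ ∑ n ∈ Finset.Ioc 0 N, Real.log N := by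
          refine Finset.sum_le_sum fun n hn => ?_
          have := Finset.mem_Ioc.1 hn
          refine (sum_log_primeFactors_le (by omega)).trans ?_
          exact Real.log_le_log (by exact_mod_cast this.1) (by exact_mod_cast this.2)
      _ = N * Real.log N := by simp
  have h2 : ∀ p ∈ primesUpTo N, N * (Real.log p / p) ≤
      Real.log p * (N / p : ℕ) + Real.log p := by
    intro p hp
    have hp1 := (mem_primesUpTo.1 hp).2
    have hp0 : (0 : ℝ) < p := by exact_mod_cast hp1.pos
    have hl : 0 ≤ Real.log p := Real.log_nonneg (by exact_mod_cast hp1.one_lt.le)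
    have : (N : ℝ) / p ≤ (N / p : ℕ) + 1 := by
      rw [div_le_iff₀ hp0]
      have := Nat.lt_mul_div_succ N hp1.pos
      have : (N : ℝ) < p * ((N / p : ℕ) + 1) := by exact_mod_cast this
      linarith
    calc N * (Real.log p / p) = Real.log p * (N / p) := by ring
      _ ≤ Real.log p * ((N / p : ℕ) + 1) := mul_le_mul_of_nonneg_left this hl
      _ = _ := by ring
  have h3 := Finset.sum_le_sum h2
  rw [← Finset.mul_sum, Finset.sum_add_distrib] at h3
  have h4 := sum_log_prime_le N
  refine le_of_mul_le_mul_left ?_ hN0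
  linarith

lemma sum_rpow_le {σ : ℝ} (hσ : 0 < σ) :
    Summable (fun n : ℕ => (n : ℝ) ^ (-(1 + σ))) ∧
      ∑' n : ℕ, (n : ℝ) ^ (-(1 + σ)) ≤ 1 + 1 / σ := by
  have hs : Summable (fun n : ℕ => (n : ℝ) ^ (-(1 + σ))) :=
    Real.summable_nat_rpow.2 (by linarith)
  refine ⟨hs, ?_⟩
  rw [hs.tsum_eq_zero_add, Nat.cast_zero, Real.zero_rpow (by linarith), zero_add]
  have h := ZetaAsymptotics.zeta_limit_aux1 (s := 1 + σ) (by linarith)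
  have h2 : 0 ≤ ZetaAsymptotics.termTSum (1 + σ) :=
    tsum_nonneg fun n => ZetaAsymptotics.term_nonneg _ _
  have h3 : ∑' n : ℕ, ((n + 1 : ℕ) : ℝ) ^ (-(1 + σ)) = ∑' n : ℕ, 1 / (n + 1 : ℝ) ^ (1 + σ) := by
    refine tsum_congr fun n => ?_
    rw [Real.rpow_neg (by positivity), one_div]; push_cast; rfl
  rw [h3]
  rw [add_sub_cancel_left] at h
  have : 0 ≤ (1 + σ) * ZetaAsymptotics.termTSum (1 + σ) := by positivity
  linarith

/-- An upper bound of Mertens type. -/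
lemma prod_inv_factor_le {N : ℕ} (hN : 1 ≤ N) :
    ∏ p ∈ primesUpTo N, (1 - (p : ℝ)⁻¹)⁻¹ ≤ Real.exp 8 * (1 + Real.log N) := by
  rcases hN.eq_or_lt with rfl | hN2
  · have : primesUpTo 1 = ∅ := by
      ext p
      simp only [mem_primesUpTo, Finset.notMem_empty, iff_false, not_and]
      exact fun h1 h2 => absurd h2.two_le (by omega)
    rw [this]
    simp
  have hlog2 : 1 / 2 ≤ Real.log N := by
    have := Real.log_two_gt_d9
    have : Real.log 2 ≤ Real.log N := Real.log_le_log (by norm_num) (by exact_mod_cast hN2)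
    linarith
  set σ : ℝ := 1 / Real.log N with hσdef
  have hσ : 0 < σ := by positivity
  obtain ⟨hs, hz⟩ := sum_rpow_le hσ
  let f : ℕ →* ℝ :=
    { toFun := fun n => (n : ℝ) ^ (-(1 + σ))
      map_one' := by simp
      map_mul' := fun m n => by
        push_cast
        exact Real.mul_rpow (Nat.cast_nonneg _) (Nat.cast_nonneg _) }
  have hf : ∀ n, f n = (n : ℝ) ^ (-(1 + σ)) := fun _ => rfl
  have hprod : ∏ p ∈ primesUpTo N, (1 - f p)⁻¹ ≤ 1 + 1 / σ := by
    have h := EulerProduct.prod_filter_prime_geometric_eq_tsum_factoredNumbers (f := f) hs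
      (Finset.Icc 1 N)
    rw [primesUpTo, h]
    exact (Summable.tsum_subtype_le (fun n => f n) _ (fun n => by rw [hf]; positivity) hs).trans hz
  have hpt : ∀ p ∈ primesUpTo N, (1 - (p : ℝ)⁻¹)⁻¹ ≤
      (1 - f p)⁻¹ * Real.exp (2 * σ * (Real.log p / p)) := by
    intro p hp
    have hpp := (mem_primesUpTo.1 hp).2
    have hp2 : (2 : ℝ) ≤ p := by exact_mod_cast hpp.two_le
    have hl : 0 ≤ Real.log p := Real.log_nonneg (by linarith)
    have hfp : f p = Real.exp (-(σ * Real.log p)) * (p : ℝ)⁻¹ := by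
      rw [hf, neg_add, Real.rpow_add (by linarith), Real.rpow_neg_one, mul_comm,
        Real.rpow_def_of_pos (by linarith)]
      congr 2; ring
    have hx0 : 0 < (p : ℝ)⁻¹ := by positivity
    have hx1 : (p : ℝ)⁻¹ ≤ 1 / 2 := by rw [one_div]; exact inv_anti₀ (by norm_num) hp2
    have he : 2 * σ * (Real.log p / p) = 2 * (σ * Real.log p) * (p : ℝ)⁻¹ := by
      rw [div_eq_mul_inv]; ring
    rw [hfp, he]
    have hu : 0 ≤ σ * Real.log p := by positivity
    generalize σ * Real.log p = u at hu ⊢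
    generalize (p : ℝ)⁻¹ = x at hx0 hx1 ⊢
    have h1 := Real.add_one_le_exp (-u)
    have h2 := Real.add_one_le_exp (2 * u * x)
    have h3 : Real.exp (-u) ≤ 1 := Real.exp_le_one_iff.2 (by linarith)
    have h4 : 0 < 1 - Real.exp (-u) * x := by nlinarith
    rw [inv_le_iff_one_le_mul₀ (by linarith), mul_assoc, ← div_eq_inv_mul, le_div_iff₀ h4, one_mul]
    have h5 : (1 + 2 * u * x) * (1 - x) ≤ Real.exp (2 * u * x) * (1 - x) :=
      mul_le_mul_of_nonneg_right (by linarith) (by linarith)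
    have h6 : (1 - u) * x ≤ Real.exp (-u) * x := mul_le_mul_of_nonneg_right (by linarith) hx0.le
    nlinarith [mul_nonneg (mul_nonneg hu hx0.le) (by linarith : 0 ≤ 1 - 2 * x)]
  have hexp : ∏ p ∈ primesUpTo N, Real.exp (2 * σ * (Real.log p / p)) ≤ Real.exp 8 * 1 := by
    rw [← Real.exp_sum, ← Finset.mul_sum, mul_one]
    refine Real.exp_le_exp.2 ?_
    have h1 := sum_log_div_le hN
    have h2 : Real.log N + 2 ≤ 5 * Real.log N := by linarith
    calc 2 * σ * ∑ p ∈ primesUpTo N, Real.log p / p ≤ 2 * σ * (Real.log N + 2) := by gcongr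
      _ = 2 + 4 * σ := by
        rw [hσdef]; field_simp; ring
      _ ≤ _ := by
        have : σ ≤ 3 / 2 := by
          rw [hσdef, div_le_iff₀ (by linarith)]
          have := Real.log_two_gt_d9
          have : Real.log 2 ≤ Real.log N := Real.log_le_log (by norm_num) (by exact_mod_cast hN2)
          linarith
        linarith
  calc _ ≤ ∏ p ∈ primesUpTo N, ((1 - f p)⁻¹ * Real.exp (2 * σ * (Real.log p / p))) :=
        Finset.prod_le_prod (fun p hp => zero_le_one.trans
          (one_le_inv_factor (mem_primesUpTo.1 hp).2)) hpt
    _ = (∏ p ∈ primesUpTo N, (1 - f p)⁻¹) *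
          ∏ p ∈ primesUpTo N, Real.exp (2 * σ * (Real.log p / p)) := Finset.prod_mul_distrib
    _ ≤ (1 + 1 / σ) * (Real.exp 8 * 1) :=
        mul_le_mul hprod hexp (Finset.prod_nonneg fun _ _ => (Real.exp_pos _).le) (by positivity)
    _ = _ := by rw [hσdef, one_div_one_div]; ring

lemma sum_inv_le_prod (s : Finset ℕ) (hs : ∀ p ∈ s, p.Prime) (A : Finset ℕ)
    (hA : ∀ n ∈ A, n ≠ 0 ∧ n.primeFactors ⊆ s) :
    ∑ n ∈ A, (n : ℝ)⁻¹ ≤ ∏ p ∈ s, (1 - (p : ℝ)⁻¹)⁻¹ := by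
  classical
  let f : ℕ →* ℝ :=
    { toFun := fun n => (n : ℝ)⁻¹
      map_one' := by simp
      map_mul' := fun m n => by push_cast; exact mul_inv _ _ }
  have hf : ∀ n, f n = (n : ℝ)⁻¹ := fun _ => rfl
  have h := EulerProduct.summable_and_hasSum_factoredNumbers_prod_filter_prime_geometric (f := f)
    (fun {p} hp => by
      rw [hf, Real.norm_of_nonneg (by positivity)]
      exact inv_lt_one_of_one_lt₀ (by exact_mod_cast hp.one_lt)) s
  rw [Finset.filter_true_of_mem hs] at h
  rw [← Finset.sum_subtype_of_mem (p := (· ∈ Nat.factoredNumbers s)) (fun n : ℕ => (n : ℝ)⁻¹)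
    fun n hn => Nat.mem_factoredNumbers_of_primeFactors_subset (hA n hn).1 (hA n hn).2]
  exact sum_le_hasSum _ (fun n _ => inv_nonneg.2 (Nat.cast_nonneg _)) h.2

lemma filter_dvd_Icc {N d : ℕ} (hd : d ≠ 0) :
    (Finset.Icc 1 N).filter (d ∣ ·) = (Finset.Icc 1 (N / d)).image (d * ·) := by
  ext n
  simp only [Finset.mem_filter, Finset.mem_Icc, Finset.mem_image]
  have hd' := Nat.pos_of_ne_zero hd
  constructor
  · rintro ⟨⟨h1, h2⟩, k, rfl⟩
    refine ⟨k, ⟨Nat.pos_of_ne_zero fun h => by simp [h] at h1, ?_⟩, rfl⟩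
    rw [Nat.le_div_iff_mul_le hd']; linarith
  · rintro ⟨k, ⟨h1, h2⟩, rfl⟩
    rw [Nat.le_div_iff_mul_le hd'] at h2
    exact ⟨⟨Nat.mul_pos hd' h1, by linarith⟩, dvd_mul_right _ _⟩

lemma sum_filter_dvd_Icc {N d : ℕ} (hd : d ≠ 0) (g : ℕ → ℝ) :
    ∑ n ∈ (Finset.Icc 1 N).filter (d ∣ ·), g n = ∑ e ∈ Finset.Icc 1 (N / d), g (d * e) := by
  rw [filter_dvd_Icc hd, Finset.sum_image]
  exact fun a _ b _ h => Nat.eq_of_mul_eq_mul_left (Nat.pos_of_ne_zero hd) h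

open ArithmeticFunction in
/-- Hall's inequality for functions with bounded values at prime powers. -/
lemma sum_mul_log_le {f : ℕ → ℝ} (hf : ∀ n, 0 ≤ f n)
    (hf2 : ∀ p k e : ℕ, p.Prime → e ≠ 0 → f (p ^ k * e) ≤ 2 * f e) {N : ℕ} (hN : 1 ≤ N) :
    (∑ n ∈ Finset.Icc 1 N, f n) * Real.log N ≤ 13 * N * ∑ n ∈ Finset.Icc 1 N, f n / n := by
  have hN0 : (0 : ℝ) < N := by exact_mod_cast hN
  have hsplit : (∑ n ∈ Finset.Icc 1 N, f n) * Real.log N =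
      ∑ n ∈ Finset.Icc 1 N, f n * Real.log (N / n) + ∑ n ∈ Finset.Icc 1 N, f n * Real.log n := by
    rw [Finset.sum_mul, ← Finset.sum_add_distrib]
    refine Finset.sum_congr rfl fun n hn => ?_
    have : (n : ℝ) ≠ 0 := by have := (Finset.mem_Icc.1 hn).1; positivity
    rw [Real.log_div hN0.ne' this]; ring
  have h1 : ∑ n ∈ Finset.Icc 1 N, f n * Real.log (N / n) ≤
      N * ∑ n ∈ Finset.Icc 1 N, f n / n := by
    rw [Finset.mul_sum]
    refine Finset.sum_le_sum fun n hn => ?_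
    have hn0 : (0 : ℝ) < n := by exact_mod_cast (Finset.mem_Icc.1 hn).1
    calc f n * Real.log (N / n) ≤ f n * (N / n) :=
          mul_le_mul_of_nonneg_left (Real.log_le_self (by positivity)) (hf n)
      _ = _ := by ring
  have h2 : ∑ n ∈ Finset.Icc 1 N, f n * Real.log n ≤
      12 * N * ∑ n ∈ Finset.Icc 1 N, f n / n := by
    calc ∑ n ∈ Finset.Icc 1 N, f n * Real.log n
        = ∑ n ∈ Finset.Icc 1 N, ∑ d ∈ Finset.Icc 1 N, if d ∣ n then Λ d * f n else 0 := by
          refine Finset.sum_congr rfl fun n hn => ?_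
          rw [← vonMangoldt_sum, mul_comm, Finset.sum_mul, ← Finset.sum_filter]
          refine Finset.sum_congr ?_ fun _ _ => rfl
          have := Finset.mem_Icc.1 hn
          ext d
          simp only [Nat.mem_divisors, Finset.mem_filter, Finset.mem_Icc]
          exact ⟨fun h => ⟨⟨Nat.pos_of_dvd_of_pos h.1 this.1,
            (Nat.le_of_dvd this.1 h.1).trans this.2⟩, h.1⟩, fun h => ⟨h.2, by omega⟩⟩
      _ = ∑ d ∈ Finset.Icc 1 N, Λ d * ∑ e ∈ Finset.Icc 1 (N / d), f (d * e) := by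
          rw [Finset.sum_comm]
          refine Finset.sum_congr rfl fun d hd => ?_
          have hd0 : d ≠ 0 := by have := (Finset.mem_Icc.1 hd).1; omega
          rw [← Finset.sum_filter, ← Finset.mul_sum, sum_filter_dvd_Icc hd0]
      _ ≤ ∑ d ∈ Finset.Icc 1 N, Λ d * ∑ e ∈ Finset.Icc 1 (N / d), 2 * f e := by
          refine Finset.sum_le_sum fun d hd => ?_
          by_cases hpp : IsPrimePow d
          · obtain ⟨p, k, hp, -, rfl⟩ := (isPrimePow_nat_iff _).1 hpp
            refine mul_le_mul_of_nonneg_left (Finset.sum_le_sum fun e he => ?_) vonMangoldt_nonneg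
            exact hf2 p k e hp (by have := (Finset.mem_Icc.1 he).1; omega)
          · rw [vonMangoldt_eq_zero_iff.2 hpp]; simp
      _ = ∑ e ∈ Finset.Icc 1 N, 2 * f e * ∑ d ∈ Finset.Icc 1 (N / e), Λ d := by
          simp only [Finset.mul_sum]
          rw [Finset.sum_comm' (t' := Finset.Icc 1 N) (s' := fun e => Finset.Icc 1 (N / e))]
          · exact Finset.sum_congr rfl fun e _ => Finset.sum_congr rfl fun d _ => by ring
          · intro d e
            simp only [Finset.mem_Icc]
            constructor
            · rintro ⟨⟨h1, h2⟩, h3, h4⟩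
              rw [Nat.le_div_iff_mul_le (by omega)] at h4
              exact ⟨⟨h1, (Nat.le_div_iff_mul_le (by omega)).2 (by linarith)⟩, h3, by nlinarith⟩
            · rintro ⟨⟨h1, h2⟩, h3, h4⟩
              rw [Nat.le_div_iff_mul_le (by omega)] at h2
              exact ⟨⟨h1, by nlinarith⟩, h3, (Nat.le_div_iff_mul_le (by omega)).2 (by linarith)⟩
      _ ≤ ∑ e ∈ Finset.Icc 1 N, 12 * N * (f e / e) := by
          refine Finset.sum_le_sum fun e he => ?_
          have he0 : (0 : ℝ) < e := by exact_mod_cast (Finset.mem_Icc.1 he).1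
          have hpsi := Chebyshev.psi_le_const_mul_self (x := ((N / e : ℕ) : ℝ)) (Nat.cast_nonneg _)
          rw [Chebyshev.psi, Nat.floor_natCast] at hpsi
          have h4 : Real.log 4 ≤ 2 := by
            rw [show (4 : ℝ) = 2 ^ 2 by norm_num, Real.log_pow]
            have := Real.log_two_lt_d9
            push_cast; linarith
          have h5 : ((N / e : ℕ) : ℝ) ≤ N / e := Nat.cast_div_le
          have h6 : ∑ d ∈ Finset.Icc 1 (N / e), Λ d ≤ 6 * (N / e) :=
            hpsi.trans (mul_le_mul (by linarith) h5 (Nat.cast_nonneg _) (by norm_num))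
          calc 2 * f e * ∑ d ∈ Finset.Icc 1 (N / e), Λ d ≤ 2 * f e * (6 * (N / e)) :=
                mul_le_mul_of_nonneg_left h6 (mul_nonneg zero_le_two (hf e))
            _ = _ := by ring
      _ = _ := by rw [Finset.mul_sum]
  rw [hsplit]
  linarith

/-- The local factors of `n / φ(n)`. -/
noncomputable def invFactor (p : ℕ) : ℝ := if p.Prime then (1 - (p : ℝ)⁻¹)⁻¹ else 1

lemma one_le_invFactor (p : ℕ) : 1 ≤ invFactor p := by
  unfold invFactor
  split_ifs with hp
  · exact one_le_inv_factor hp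
  · exact le_rfl

lemma wprod_invFactor (n : ℕ) : wprod invFactor n = (totRatio n)⁻¹ := by
  unfold wprod totRatio invFactor
  rw [← Finset.prod_inv_distrib]
  exact Finset.prod_congr rfl fun p hp => if_pos (Nat.prime_of_mem_primeFactors hp)

lemma invFactor_le_two {p : ℕ} (hp : p.Prime) : invFactor p ≤ 2 := by
  have h2 : (2 : ℝ) ≤ p := by exact_mod_cast hp.two_le
  have hx : (p : ℝ)⁻¹ ≤ 1 / 2 := by
    rw [one_div]; exact inv_anti₀ (by norm_num) h2
  rw [invFactor, if_pos hp, inv_le_comm₀ (by linarith) (by norm_num)]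
  linarith

lemma inv_totRatio_mul_le {p k e : ℕ} (hp : p.Prime) (he : e ≠ 0) :
    (totRatio (p ^ k * e))⁻¹ ≤ 2 * (totRatio e)⁻¹ := by
  simp only [← wprod_invFactor]
  refine (wprod_mul_le one_le_invFactor (pow_ne_zero _ hp.ne_zero) he).trans ?_
  refine mul_le_mul_of_nonneg_right ?_ (wprod_pos one_le_invFactor e).le
  rcases k.eq_zero_or_pos with rfl | hk
  · simp [wprod]
  · rw [wprod, Nat.primeFactors_prime_pow hk.ne' hp, Finset.prod_singleton]
    exact invFactor_le_two hp

lemma sum_inv_totRatio_div_le (N m : ℕ) :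
    ∑ n ∈ (Finset.Icc 1 N).filter (Nat.Coprime m), (totRatio n)⁻¹ * (n : ℝ)⁻¹ ≤
      Real.exp 4 * ∏ p ∈ (primesUpTo N).filter (¬ · ∣ m), (1 - (p : ℝ)⁻¹)⁻¹ := by
  set S := (Finset.Icc 1 N).filter (Nat.Coprime m)
  have hS : ∀ n ∈ S, 1 ≤ n ∧ n ≤ N ∧ m.Coprime n := fun n hn => by
    simpa [S, and_assoc] using hn
  have hS0 : ∀ n ∈ S, n ≠ 0 := fun n hn => by have := (hS n hn).1; omega
  have hSP : ∀ n ∈ S, n.primeFactors ⊆ primesUpTo N := fun n hn p hp =>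
    mem_primesUpTo.2 ⟨(Nat.le_of_mem_primeFactors hp).trans (hS n hn).2.1,
      Nat.prime_of_mem_primeFactors hp⟩
  set Y := ∑ n ∈ S, (n : ℝ)⁻¹ with hYdef
  have hY : ∀ d : ℕ, d ≠ 0 → ∑ n ∈ S.filter (d ∣ ·), (n : ℝ)⁻¹ ≤ Y / d := by
    intro d hd
    have hd' := Nat.pos_of_ne_zero hd
    calc ∑ n ∈ S.filter (d ∣ ·), (n : ℝ)⁻¹ ≤ ∑ n ∈ S.image (d * ·), (n : ℝ)⁻¹ := by
          refine Finset.sum_le_sum_of_subset_of_nonneg (fun n hn => ?_) fun _ _ _ => by positivity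
          obtain ⟨hn1, k, rfl⟩ := Finset.mem_filter.1 hn
          have h := hS _ hn1
          refine Finset.mem_image.2 ⟨k, ?_, rfl⟩
          simp only [S, Finset.mem_filter, Finset.mem_Icc]
          exact ⟨⟨Nat.pos_of_ne_zero fun h0 => by simp [h0] at h, by nlinarith⟩,
            Nat.Coprime.coprime_mul_left_right h.2.2⟩
      _ = Y / d := by
          rw [Finset.sum_image fun a _ b _ h => Nat.eq_of_mul_eq_mul_left hd' h, hYdef,
            Finset.sum_div]
          refine Finset.sum_congr rfl fun n _ => ?_
          push_cast
          rw [mul_inv, div_eq_mul_inv, mul_comm]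
  have h := sum_wprod_mul_le one_le_invFactor (primesUpTo N) (fun p hp => (mem_primesUpTo.1 hp).2)
    S hS0 hSP (fun n => (n : ℝ)⁻¹) Y hY
  simp only [wprod_invFactor] at h
  refine h.trans ?_
  have hY2 : Y ≤ ∏ p ∈ (primesUpTo N).filter (¬ · ∣ m), (1 - (p : ℝ)⁻¹)⁻¹ := by
    refine sum_inv_le_prod _ (fun p hp => (mem_primesUpTo.1 (Finset.mem_filter.1 hp).1).2) S
      fun n hn => ⟨hS0 n hn, fun p hp => Finset.mem_filter.2 ⟨hSP n hn hp, fun hpm => ?_⟩⟩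
    exact (Nat.prime_of_mem_primeFactors hp).one_lt.ne'
      (Nat.eq_one_of_dvd_coprimes (hS n hn).2.2 hpm (Nat.dvd_of_mem_primeFactors hp))
  have hexp : ∏ p ∈ primesUpTo N, (1 + (invFactor p - 1) / p) ≤ Real.exp 4 := by
    calc _ ≤ ∏ p ∈ primesUpTo N, Real.exp (2 * (1 / (p : ℝ) ^ 2)) := by
          refine Finset.prod_le_prod (fun p _ => ?_) fun p hp => ?_
          · have := one_le_invFactor p
            have : 0 ≤ (invFactor p - 1) / p := div_nonneg (by linarith) (Nat.cast_nonneg _)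
            linarith
          · have hpp := (mem_primesUpTo.1 hp).2
            have hp2 : (2 : ℝ) ≤ p := by exact_mod_cast hpp.two_le
            have : (invFactor p - 1) / p ≤ 2 * (1 / (p : ℝ) ^ 2) := by
              rw [invFactor, if_pos hpp]
              have : (1 - (p : ℝ)⁻¹)⁻¹ - 1 = 1 / (p - 1) := by
                have : (p : ℝ) - 1 ≠ 0 := by linarith
                field_simp
                ring
              rw [this, div_div, mul_one_div, div_le_div_iff₀ (by nlinarith) (by positivity)]
              nlinarith
            have := Real.add_one_le_exp (2 * (1 / (p : ℝ) ^ 2))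
            linarith
      _ ≤ Real.exp 4 := by
          rw [← Real.exp_sum, ← Finset.mul_sum]
          refine Real.exp_le_exp.2 ?_
          have := sum_inv_sq_le le_rfl (primesUpTo N) fun p hp => (mem_primesUpTo.1 hp).2.one_lt.le
          push_cast at this
          linarith
  have hY0 : 0 ≤ Y := Finset.sum_nonneg fun _ _ => by positivity
  calc _ ≤ (∏ p ∈ (primesUpTo N).filter (¬ · ∣ m), (1 - (p : ℝ)⁻¹)⁻¹) * Real.exp 4 :=
        mul_le_mul hY2 hexp (Finset.prod_nonneg fun p _ => by
          have := one_le_invFactor p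
          have : 0 ≤ (invFactor p - 1) / p := div_nonneg (by linarith) (Nat.cast_nonneg _)
          linarith) (hY0.trans hY2)
    _ = _ := mul_comm _ _

/-- The sieve bound. -/
lemma sum_inv_totRatio_le {N : ℕ} (hN : 1 ≤ N) (m : ℕ) :
    ∑ n ∈ (Finset.Icc 1 N).filter (Nat.Coprime m), (totRatio n)⁻¹ ≤
      39 * Real.exp 12 * N * ∏ p ∈ (primesUpTo N).filter (· ∣ m), (1 - (p : ℝ)⁻¹) := by
  have hR : ∀ Q : Finset ℕ, Q ⊆ primesUpTo N → 0 < ∏ p ∈ Q, (1 - (p : ℝ)⁻¹) := fun Q hQ =>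
    Finset.prod_pos fun p hp => totRatio_factor_pos (mem_primesUpTo.1 (hQ hp)).2
  set R := ∏ p ∈ (primesUpTo N).filter (· ∣ m), (1 - (p : ℝ)⁻¹) with hRdef
  have hRpos : 0 < R := hR _ (Finset.filter_subset _ _)
  have hN0 : (0 : ℝ) < N := by exact_mod_cast hN
  set f : ℕ → ℝ := fun n => if m.Coprime n then (totRatio n)⁻¹ else 0 with hfdef
  have hf0 : ∀ n, 0 ≤ f n := fun n => by
    simp only [hfdef]; split_ifs
    · exact (inv_pos.2 (totRatio_pos n)).le
    · exact le_rfl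
  have hf2 : ∀ p k e : ℕ, p.Prime → e ≠ 0 → f (p ^ k * e) ≤ 2 * f e := by
    intro p k e hp he
    simp only [hfdef]
    split_ifs with h1 h2 h2
    · exact inv_totRatio_mul_le hp he
    · exact absurd (Nat.Coprime.coprime_mul_left_right h1) h2
    · exact mul_nonneg zero_le_two (inv_pos.2 (totRatio_pos e)).le
    · simp
  have hall := sum_mul_log_le hf0 hf2 hN
  rw [Finset.sum_filter]
  change ∑ n ∈ Finset.Icc 1 N, f n ≤ _
  have hfd : ∑ n ∈ Finset.Icc 1 N, f n / n =
      ∑ n ∈ (Finset.Icc 1 N).filter (Nat.Coprime m), (totRatio n)⁻¹ * (n : ℝ)⁻¹ := by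
    rw [Finset.sum_filter]
    refine Finset.sum_congr rfl fun n _ => ?_
    simp only [hfdef, div_eq_mul_inv, ite_mul, zero_mul]
  have hsum := sum_inv_totRatio_div_le N m
  have hprod : ∏ p ∈ (primesUpTo N).filter (¬ · ∣ m), (1 - (p : ℝ)⁻¹)⁻¹ =
      (∏ p ∈ primesUpTo N, (1 - (p : ℝ)⁻¹)⁻¹) * R := by
    rw [← Finset.prod_filter_mul_prod_filter_not (primesUpTo N) (· ∣ m)]
    simp only [Finset.prod_inv_distrib]
    rw [← hRdef]
    field_simp
  have hM := prod_inv_factor_le hN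
  rcases hN.eq_or_lt with rfl | hN2
  · have hP : primesUpTo 1 = ∅ := by
      ext p
      simp only [mem_primesUpTo, Finset.notMem_empty, iff_false, not_and]
      exact fun h1 h2 => absurd h2.two_le (by omega)
    have hR1 : R = 1 := by rw [hRdef, hP]; simp
    rw [hR1]
    have : f 1 = 1 := by simp [hfdef, totRatio]
    have h12 := Real.add_one_le_exp (12 : ℝ)
    simp only [Finset.Icc_self, Finset.sum_singleton, this]
    push_cast; linarith
  · have hlog2 : 1 / 2 ≤ Real.log N := by
      have := Real.log_two_gt_d9
      have : Real.log 2 ≤ Real.log N := Real.log_le_log (by norm_num) (by exact_mod_cast hN2)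
      linarith
    refine le_of_mul_le_mul_right ?_ (by linarith : 0 < Real.log N)
    have h12 : Real.exp 12 = Real.exp 4 * Real.exp 8 := by rw [← Real.exp_add]; norm_num
    calc _ ≤ 13 * N * ∑ n ∈ Finset.Icc 1 N, f n / n := hall
      _ ≤ 13 * N * (Real.exp 4 * ((Real.exp 8 * (1 + Real.log N)) * R)) := by
          rw [hfd]
          refine mul_le_mul_of_nonneg_left (hsum.trans ?_) (by positivity)
          rw [hprod]
          gcongr
      _ ≤ 13 * N * (Real.exp 4 * ((Real.exp 8 * (3 * Real.log N)) * R)) := by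
          gcongr; linarith
      _ = _ := by rw [h12]; ring

lemma card_filter_forall_le {g : ℕ} (hg : g ≠ 0) (G : ℕ → ℕ → Prop)
    [∀ p k, Decidable (G p k)] (hG : ∀ p k, G p k → G p (k % p)) :
    (((Finset.range g).filter fun k => ∀ p ∈ g.primeFactors, G p k).card : ℝ) ≤
      g * ∏ p ∈ g.primeFactors, ((((Finset.range p).filter (G p)).card : ℝ) / p) := by
  set r := ∏ p ∈ g.primeFactors, p with hr
  have hrg : r ∣ g := Nat.prod_primeFactors_dvd g
  have hr0 : 0 < r := Nat.pos_of_dvd_of_pos hrg (Nat.pos_of_ne_zero hg)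
  have hcard : ((Finset.range g).filter fun k => ∀ p ∈ g.primeFactors, G p k).card ≤
      ((g.primeFactors.pi fun p => (Finset.range p).filter (G p)) ×ˢ Finset.range (g / r)).card := by
    refine Finset.card_le_card_of_injOn (fun k => (fun p _ => k % p, k / r)) ?_ ?_
    · intro k hk
      simp only [Finset.coe_filter, Finset.mem_range, Set.mem_ofPred_eq] at hk
      simp only [Finset.coe_product, Set.mem_prod, Finset.mem_coe, Finset.mem_pi, Finset.mem_filter,
        Finset.mem_range]
      refine ⟨fun p hp => ⟨Nat.mod_lt _ (Nat.prime_of_mem_primeFactors hp).pos,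
        hG p k (hk.2 p hp)⟩, ?_⟩
      rw [Nat.div_lt_iff_lt_mul hr0, Nat.div_mul_cancel hrg]
      exact hk.1
    · intro k _ k' _ h
      obtain ⟨h1, h2⟩ := Prod.mk.inj h
      have h3 : (r : ℤ) ∣ (k' : ℤ) - k := by
        refine Int.natCast_dvd.2 (Finset.prod_primes_dvd _
          (fun p hp => (Nat.prime_of_mem_primeFactors hp).prime) fun p hp => ?_)
        exact Int.natCast_dvd.1 (Nat.modEq_iff_dvd.1 (congrFun (congrFun h1 p) hp))
      have h4 : k % r = k' % r := Nat.modEq_iff_dvd.2 h3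
      rw [← Nat.div_add_mod k r, ← Nat.div_add_mod k' r, h2, h4]
  rw [Finset.card_product, Finset.card_pi, Finset.card_range] at hcard
  have : (g : ℝ) * ∏ p ∈ g.primeFactors, ((((Finset.range p).filter (G p)).card : ℝ) / p) =
      ((∏ p ∈ g.primeFactors, ((Finset.range p).filter (G p)).card) * (g / r) : ℕ) := by
    rw [Finset.prod_div_distrib, ← Nat.cast_prod (fun p => p), ← hr]
    push_cast [Nat.cast_div hrg (Nat.cast_ne_zero.2 hr0.ne')]
    ring
  rw [this]
  exact_mod_cast hcard

lemma exists_lt_dvd_add_mul {p x : ℕ} (hp : p.Prime) (hx : ¬ p ∣ x) (a : ℕ) :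
    ∃ k < p, p ∣ a + x * k := by
  have := Fact.mk hp
  have hx' : (x : ZMod p) ≠ 0 := fun h => hx ((ZMod.natCast_eq_zero_iff _ _).1 h)
  refine ⟨(-(a : ZMod p) / x).val, ZMod.val_lt _, ?_⟩
  rw [← ZMod.natCast_eq_zero_iff]
  push_cast
  rw [ZMod.natCast_val, ZMod.cast_id]
  field_simp
  ring

lemma card_range_filter_div_le_one {p : ℕ} (hp : p.Prime) {G : ℕ → Prop} [DecidablePred G]
    {k : ℕ} (hk : k < p) (hG : ¬ G k) :
    (((Finset.range p).filter G).card : ℝ) / p ≤ 1 - (p : ℝ)⁻¹ := by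
  have h1 : ((Finset.range p).filter G).card ≤ ((Finset.range p).erase k).card :=
    Finset.card_le_card fun i hi => by
      simp only [Finset.mem_filter, Finset.mem_erase] at hi ⊢
      exact ⟨fun h => hG (h ▸ hi.2), hi.1⟩
  rw [Finset.card_erase_of_mem (Finset.mem_range.2 hk), Finset.card_range] at h1
  have hp0 : (0 : ℝ) < p := by exact_mod_cast hp.pos
  have h2 : (((Finset.range p).filter G).card : ℝ) ≤ p - 1 := by
    have : ((Finset.range p).filter G).card + 1 ≤ p := by have := hp.pos; omega
    have : (((Finset.range p).filter G).card : ℝ) + 1 ≤ p := by exact_mod_cast this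
    linarith
  rw [div_le_iff₀ hp0, sub_mul, inv_mul_cancel₀ hp0.ne', one_mul]
  exact h2

lemma card_range_filter_div_le_two {p : ℕ} (hp : p.Prime) {G : ℕ → Prop} [DecidablePred G]
    {k l : ℕ} (hk : k < p) (hl : l < p) (hkl : k ≠ l) (hG : ¬ G k) (hG' : ¬ G l) :
    (((Finset.range p).filter G).card : ℝ) / p ≤ (1 - (p : ℝ)⁻¹) * (1 - (p : ℝ)⁻¹) := by
  have h1 : ((Finset.range p).filter G).card ≤ (((Finset.range p).erase k).erase l).card :=
    Finset.card_le_card fun i hi => by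
      simp only [Finset.mem_filter, Finset.mem_erase] at hi ⊢
      exact ⟨fun h => hG' (h ▸ hi.2), fun h => hG (h ▸ hi.2), hi.1⟩
  rw [Finset.card_erase_of_mem (Finset.mem_erase.2 ⟨hkl.symm, Finset.mem_range.2 hl⟩),
    Finset.card_erase_of_mem (Finset.mem_range.2 hk), Finset.card_range] at h1
  have hp0 : (0 : ℝ) < p := by exact_mod_cast hp.pos
  have h2 : (((Finset.range p).filter G).card : ℝ) ≤ p - 2 := by
    have : ((Finset.range p).filter G).card + 2 ≤ p := by have := hp.two_le; omega
    have : (((Finset.range p).filter G).card : ℝ) + 2 ≤ p := by exact_mod_cast this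
    linarith
  calc _ ≤ ((p : ℝ) - 2) / p := by gcongr
    _ = 1 - 2 * (p : ℝ)⁻¹ := by field_simp
    _ ≤ _ := by nlinarith [sq_nonneg ((p : ℝ)⁻¹)]

lemma totRatio_mul_totRatio {g x y : ℕ} (hg : g ≠ 0) (hx : x ≠ 0) (hy : y ≠ 0)
    (hxy : x.Coprime y) :
    totRatio (g * x) * totRatio (g * y) = totRatio (g * (x * y)) * totRatio g := by
  unfold totRatio
  rw [← Finset.prod_union_inter, Nat.primeFactors_mul hg hx, Nat.primeFactors_mul hg hy,
    Nat.primeFactors_mul hg (mul_ne_zero hx hy), Nat.primeFactors_mul hx hy]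
  congr 1
  · refine Finset.prod_congr ?_ fun _ _ => rfl
    ext p; simp only [Finset.mem_union]; tauto
  · refine Finset.prod_congr ?_ fun _ _ => rfl
    have := Finset.disjoint_left.1 hxy.disjoint_primeFactors
    ext p; simp only [Finset.mem_union, Finset.mem_inter]
    have := @this p
    tauto

lemma totRatio_mul_of_coprime {m n : ℕ} (h : m.Coprime n) :
    totRatio (m * n) = totRatio m * totRatio n := wprod_mul_of_coprime _ h

/-- The pairs of reduced residues `(a, c)` modulo `(g x, g y)` with `a y - c x ≡ n`. -/
def solutions (g x y : ℕ) (n : ℤ) : Finset (ℕ × ℕ) :=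
  ((Finset.range (g * x)) ×ˢ (Finset.range (g * y))).filter fun q =>
    q.1.Coprime (g * x) ∧ q.2.Coprime (g * y) ∧
      ((g * x * y : ℕ) : ℤ) ∣ ((q.1 : ℤ) * y - q.2 * x - n)

lemma mem_solutions {g x y : ℕ} {n : ℤ} {a c : ℕ} : (a, c) ∈ solutions g x y n ↔
    (a < g * x ∧ c < g * y) ∧ a.Coprime (g * x) ∧ c.Coprime (g * y) ∧
      ((g * x * y : ℕ) : ℤ) ∣ ((a : ℤ) * y - c * x - n) := by
  simp [solutions, and_assoc]

lemma coprime_of_mem_solutions {g x y : ℕ} (hxy : x.Coprime y) {n : ℤ} {a c : ℕ}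
    (h : (a, c) ∈ solutions g x y n) : (x * y).Coprime n.natAbs := by
  obtain ⟨-, ha, hc, hd⟩ := mem_solutions.1 h
  refine Nat.coprime_of_dvd fun p hp hp1 hp2 => ?_
  have hpn : (p : ℤ) ∣ n := Int.natCast_dvd.2 hp2
  have hd' : (p : ℤ) ∣ (a : ℤ) * y - c * x - n := by
    refine dvd_trans ?_ hd
    rw [mul_assoc]
    exact_mod_cast Dvd.dvd.mul_left hp1 g
  have hd2 : (p : ℤ) ∣ (a : ℤ) * y - c * x := (dvd_sub_left hpn).1 hd'
  have hpp := Nat.prime_iff_prime_int.1 hp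
  rcases hp.dvd_mul.1 hp1 with hx | hy
  · have hx' : (p : ℤ) ∣ (c : ℤ) * x := Dvd.dvd.mul_left (by exact_mod_cast hx) _
    rcases hpp.dvd_mul.1 ((dvd_sub_left hx').1 hd2) with h1 | h1
    · exact hp.one_lt.ne' (Nat.eq_one_of_dvd_coprimes ha (by exact_mod_cast h1)
        (Dvd.dvd.mul_left hx g))
    · exact hp.one_lt.ne' (Nat.eq_one_of_dvd_coprimes hxy hx (by exact_mod_cast h1))
  · have hy' : (p : ℤ) ∣ (a : ℤ) * y := Dvd.dvd.mul_left (by exact_mod_cast hy) _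
    rcases hpp.dvd_mul.1 ((dvd_sub_right hy').1 hd2) with h1 | h1
    · exact hp.one_lt.ne' (Nat.eq_one_of_dvd_coprimes hc (by exact_mod_cast h1)
        (Dvd.dvd.mul_left hy g))
    · exact hp.one_lt.ne' (Nat.eq_one_of_dvd_coprimes hxy (by exact_mod_cast h1) hy)

lemma exists_shift {g x y : ℕ} (hg : 0 < g) (hx : 0 < x) (hxy : x.Coprime y) {n : ℤ}
    {a c a₀ c₀ : ℕ} (h : (a, c) ∈ solutions g x y n) (h₀ : (a₀, c₀) ∈ solutions g x y n) :
    ∃ k < g, a ≡ a₀ + x * k [MOD g * x] ∧ c ≡ c₀ + y * k [MOD g * y] := by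
  obtain ⟨-, -, -, hd⟩ := mem_solutions.1 h
  obtain ⟨-, -, -, hd₀⟩ := mem_solutions.1 h₀
  have h1 : ((g * x * y : ℕ) : ℤ) ∣ ((a : ℤ) - a₀) * y - ((c : ℤ) - c₀) * x := by
    have := dvd_sub hd hd₀
    have e : (a : ℤ) * y - c * x - n - (a₀ * y - c₀ * x - n) =
      ((a : ℤ) - a₀) * y - ((c : ℤ) - c₀) * x := by ring
    rwa [e] at this
  have hxa : (x : ℤ) ∣ (a : ℤ) - a₀ := by
    have h2 : (x : ℤ) ∣ ((a : ℤ) - a₀) * y - ((c : ℤ) - c₀) * x :=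
      dvd_trans (by push_cast; exact ⟨g * y, by ring⟩) h1
    have h3 : (x : ℤ) ∣ ((a : ℤ) - a₀) * y := (dvd_sub_left (dvd_mul_left _ _)).1 h2
    exact IsCoprime.dvd_of_dvd_mul_right (Nat.isCoprime_iff_coprime.2 hxy) h3
  obtain ⟨t, ht⟩ := hxa
  have hgy : ((g * y : ℕ) : ℤ) ∣ y * t - ((c : ℤ) - c₀) := by
    have hx' : (x : ℤ) ≠ 0 := by exact_mod_cast hx.ne'
    refine (mul_dvd_mul_iff_left hx').1 ?_
    have e : (x : ℤ) * (y * t - ((c : ℤ) - c₀)) = ((a : ℤ) - a₀) * y - ((c : ℤ) - c₀) * x := by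
      rw [ht]; ring
    rw [e]
    refine dvd_trans ?_ h1
    exact ⟨1, by push_cast; ring⟩
  have hg' : (g : ℤ) ≠ 0 := by exact_mod_cast hg.ne'
  have hnn := Int.emod_nonneg t hg'
  have hlt := Int.emod_lt_of_pos t (by exact_mod_cast hg : (0 : ℤ) < g)
  have hk : ((t % g).toNat : ℤ) = t % g := Int.toNat_of_nonneg hnn
  have hdiv := Int.mul_ediv_add_emod t g
  refine ⟨(t % g).toNat, by omega, ?_, ?_⟩
  · rw [Nat.modEq_iff_dvd]
    push_cast
    rw [hk]
    refine ⟨-(t / g), ?_⟩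
    linear_combination (-1 : ℤ) * ht + (x : ℤ) * hdiv
  · rw [Nat.modEq_iff_dvd]
    push_cast
    rw [hk]
    obtain ⟨s, hs⟩ := hgy
    push_cast at hs
    refine ⟨s - t / g, ?_⟩
    linear_combination hs + (y : ℤ) * hdiv

lemma card_solutions_le {g x y : ℕ} (hg : 0 < g) (hx : 0 < x) (hy : 0 < y) (hxy : x.Coprime y)
    {n : ℤ} (hn : n ≠ 0) :
    ((solutions g x y n).card : ℝ) ≤ if (x * y).Coprime n.natAbs then
      g * (totRatio (g * x) * totRatio (g * y)) * (totRatio (x * y))⁻¹ * (totRatio n.natAbs)⁻¹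
      else 0 := by
  classical
  rcases (solutions g x y n).eq_empty_or_nonempty with he | ⟨⟨a₀, c₀⟩, h₀⟩
  · rw [he, Finset.card_empty, Nat.cast_zero]
    have := totRatio_pos
    split_ifs
    · have h1 := totRatio_pos (g * x)
      have h2 := totRatio_pos (g * y)
      have h3 := totRatio_pos (x * y)
      have h4 := totRatio_pos n.natAbs
      positivity
    · exact le_rfl
  have hcop := coprime_of_mem_solutions hxy h₀
  rw [if_pos hcop]
  set G : ℕ → ℕ → Prop := fun p k => ¬ p ∣ a₀ + x * k ∧ ¬ p ∣ c₀ + y * k with hGdef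
  have hmod : ∀ p a x k : ℕ, p ∣ a + x * (k % p) ↔ p ∣ a + x * k := fun p a x k =>
    Nat.ModEq.dvd_iff (Nat.ModEq.add_left a ((Nat.mod_modEq k p).mul_left x)) dvd_rfl
  have hG : ∀ p k, G p k → G p (k % p) := fun p k h => by
    simp only [hGdef, hmod] at h ⊢
    exact h
  have hcount := card_filter_forall_le hg.ne' G hG
  have hinj : (solutions g x y n).card ≤
      ((Finset.range g).filter fun k => ∀ p ∈ g.primeFactors, G p k).card := by
    have hex : ∀ q ∈ solutions g x y n, ∃ k < g, q.1 ≡ a₀ + x * k [MOD g * x] ∧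
        q.2 ≡ c₀ + y * k [MOD g * y] := fun q hq => exists_shift hg hx hxy hq h₀
    choose! k hk using hex
    refine Finset.card_le_card_of_injOn k (fun q hq => ?_) fun q hq q' hq' h => ?_
    · obtain ⟨h1, h2, h3⟩ := hk q hq
      obtain ⟨-, ha, hc, -⟩ := mem_solutions.1 (show (q.1, q.2) ∈ solutions g x y n from hq)
      simp only [Finset.coe_filter, Finset.mem_range, Set.mem_ofPred_eq]
      refine ⟨h1, fun p hp => ⟨fun hd => ?_, fun hd => ?_⟩⟩
      · have hpg : p ∣ g * x := Dvd.dvd.mul_right (Nat.dvd_of_mem_primeFactors hp) x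
        exact (Nat.prime_of_mem_primeFactors hp).one_lt.ne'
          (Nat.eq_one_of_dvd_coprimes ha ((h2.dvd_iff hpg).2 hd) hpg)
      · have hpg : p ∣ g * y := Dvd.dvd.mul_right (Nat.dvd_of_mem_primeFactors hp) y
        exact (Nat.prime_of_mem_primeFactors hp).one_lt.ne'
          (Nat.eq_one_of_dvd_coprimes hc ((h3.dvd_iff hpg).2 hd) hpg)
    · obtain ⟨-, h2, h3⟩ := hk q hq
      obtain ⟨-, h2', h3'⟩ := hk q' hq'
      obtain ⟨hl, -⟩ := mem_solutions.1 (show (q.1, q.2) ∈ solutions g x y n from hq)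
      obtain ⟨hl', -⟩ := mem_solutions.1 (show (q'.1, q'.2) ∈ solutions g x y n from hq')
      rw [← h] at h2' h3'
      exact Prod.ext ((h2.trans h2'.symm).eq_of_lt_of_lt hl.1 hl'.1)
        ((h3.trans h3'.symm).eq_of_lt_of_lt hl.2 hl'.2)
  set m := x * y * n.natAbs with hm
  have hn0 : n.natAbs ≠ 0 := Int.natAbs_ne_zero.2 hn
  have hm0 : m ≠ 0 := mul_ne_zero (mul_ne_zero hx.ne' hy.ne') hn0
  obtain ⟨-, -, -, hd₀⟩ := mem_solutions.1 h₀
  have hlocal : ∀ p ∈ g.primeFactors, (((Finset.range p).filter (G p)).card : ℝ) / p ≤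
      (1 - (p : ℝ)⁻¹) * if p ∈ m.primeFactors then 1 else 1 - (p : ℝ)⁻¹ := by
    intro p hp
    have hpp := Nat.prime_of_mem_primeFactors hp
    split_ifs with hpm
    · rw [mul_one]
      by_cases hpx : p ∣ x
      · have hpy : ¬ p ∣ y := fun h => hpp.one_lt.ne' (Nat.eq_one_of_dvd_coprimes hxy hpx h)
        obtain ⟨k, hk, hd⟩ := exists_lt_dvd_add_mul hpp hpy c₀
        exact card_range_filter_div_le_one hpp hk fun h => h.2 hd
      · obtain ⟨k, hk, hd⟩ := exists_lt_dvd_add_mul hpp hpx a₀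
        exact card_range_filter_div_le_one hpp hk fun h => h.1 hd
    · have hpm' : ¬ p ∣ m := fun h => hpm (Nat.mem_primeFactors.2 ⟨hpp, h, hm0⟩)
      have hpx : ¬ p ∣ x := fun h => hpm' ((h.mul_right y).mul_right _)
      have hpy : ¬ p ∣ y := fun h => hpm' ((h.mul_left x).mul_right _)
      obtain ⟨k, hk, hdk⟩ := exists_lt_dvd_add_mul hpp hpx a₀
      obtain ⟨l, hl, hdl⟩ := exists_lt_dvd_add_mul hpp hpy c₀
      refine card_range_filter_div_le_two hpp hk hl ?_ (fun h => h.1 hdk) fun h => h.2 hdl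
      rintro rfl
      apply hpm'
      refine Dvd.dvd.mul_left ?_ _
      rw [← Int.natCast_dvd]
      have hd1 : (p : ℤ) ∣ (a₀ : ℤ) * y - c₀ * x - n := by
        refine dvd_trans ?_ hd₀
        exact_mod_cast ((Nat.dvd_of_mem_primeFactors hp).mul_right x).mul_right y
      have hd2 : (p : ℤ) ∣ (a₀ : ℤ) + x * k := by exact_mod_cast hdk
      have hd3 : (p : ℤ) ∣ (c₀ : ℤ) + y * k := by exact_mod_cast hdl
      have := dvd_sub (dvd_sub (hd2.mul_right y) (hd3.mul_right x)) hd1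
      have e : ((a₀ : ℤ) + x * k) * y - (c₀ + y * k) * x - (a₀ * y - c₀ * x - n) = n := by ring
      rwa [e] at this
  have hprod : ∏ p ∈ g.primeFactors, ((((Finset.range p).filter (G p)).card : ℝ) / p) ≤
      totRatio g * totRatio (g * m) * (totRatio m)⁻¹ := by
    refine (Finset.prod_le_prod (fun p _ => by positivity) hlocal).trans_eq ?_
    have hsplit : totRatio (g * m) = (∏ p ∈ g.primeFactors, if p ∈ m.primeFactors then (1 : ℝ) else
        1 - (p : ℝ)⁻¹) * totRatio m := by
      rw [totRatio, totRatio, Nat.primeFactors_mul hg.ne' hm0, ← Finset.sdiff_union_self_eq_union,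
        Finset.prod_union Finset.sdiff_disjoint, Finset.prod_ite, Finset.prod_const_one, one_mul,
        Finset.sdiff_eq_filter]
    rw [hsplit, Finset.prod_mul_distrib, ← mul_assoc, mul_inv_cancel_right₀ (totRatio_pos m).ne']
    rfl
  have hmono : totRatio (g * m) ≤ totRatio (g * (x * y)) :=
    totRatio_le_of_dvd (mul_dvd_mul_left g (dvd_mul_right _ _)) (mul_ne_zero hg.ne' hm0)
  have hmm : totRatio m = totRatio (x * y) * totRatio n.natAbs := totRatio_mul_of_coprime hcop
  have h1 := totRatio_pos g
  have h2 := totRatio_pos m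
  calc ((solutions g x y n).card : ℝ) ≤
        (((Finset.range g).filter fun k => ∀ p ∈ g.primeFactors, G p k).card : ℝ) := by
          exact_mod_cast hinj
    _ ≤ g * (totRatio g * totRatio (g * m) * (totRatio m)⁻¹) :=
        hcount.trans (mul_le_mul_of_nonneg_left hprod (Nat.cast_nonneg _))
    _ ≤ g * (totRatio g * totRatio (g * (x * y)) * (totRatio m)⁻¹) := by gcongr
    _ = _ := by
        rw [hmm, totRatio_mul_totRatio hg.ne' hx.ne' hy.ne' hxy, mul_inv]; ring

/-- The total number of solutions with `0 < |n| ≤ N`. -/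
lemma sum_card_solutions_le {g x y : ℕ} (hg : 0 < g) (hx : 0 < x) (hy : 0 < y) (hxy : x.Coprime y)
    {X : ℝ} (hX : 1 ≤ X) :
    ∑ n ∈ Finset.Icc 1 ⌊X⌋₊, (((solutions g x y n).card : ℝ) + (solutions g x y (-n)).card) ≤
      78 * Real.exp 12 * X * (g * (totRatio (g * x) * totRatio (g * y))) * tailProd X (x * y) := by
  set N := ⌊X⌋₊
  have hN : 1 ≤ N := Nat.le_floor (by exact_mod_cast hX)
  have hNX : (N : ℝ) ≤ X := Nat.floor_le (by linarith)
  set B := (g : ℝ) * (totRatio (g * x) * totRatio (g * y)) with hB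
  have hB0 : 0 ≤ B := mul_nonneg (Nat.cast_nonneg _)
    (mul_nonneg (totRatio_pos _).le (totRatio_pos _).le)
  have hxy0 : x * y ≠ 0 := mul_ne_zero hx.ne' hy.ne'
  have h1 : ∀ n ∈ Finset.Icc 1 N, ((solutions g x y n).card : ℝ) + (solutions g x y (-n)).card ≤
      2 * B * (totRatio (x * y))⁻¹ * if (x * y).Coprime n then (totRatio n)⁻¹ else 0 := by
    intro n hn
    have hn0 : (n : ℤ) ≠ 0 := by have := (Finset.mem_Icc.1 hn).1; omega
    have ha := card_solutions_le hg hx hy hxy hn0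
    have hb := card_solutions_le hg hx hy hxy (neg_ne_zero.2 hn0)
    rw [Int.natAbs_neg] at hb
    rw [Int.natAbs_natCast] at ha hb
    refine (add_le_add ha hb).trans_eq ?_
    split_ifs <;> ring
  refine (Finset.sum_le_sum h1).trans ?_
  rw [← Finset.mul_sum, ← Finset.sum_filter]
  have htail : (totRatio (x * y))⁻¹ * ∏ p ∈ (primesUpTo N).filter (· ∣ x * y), (1 - (p : ℝ)⁻¹) =
      tailProd X (x * y) := by
    have hs : totRatio (x * y) = (∏ p ∈ (primesUpTo N).filter (· ∣ x * y), (1 - (p : ℝ)⁻¹)) *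
        ∏ p ∈ (x * y).primeFactors.filter (fun p : ℕ => X < p), (1 - (p : ℝ)⁻¹) := by
      rw [totRatio, ← Finset.prod_filter_mul_prod_filter_not _ (fun p : ℕ => (p : ℝ) ≤ X)]
      simp only [not_le]
      congr 1
      refine Finset.prod_congr ?_ fun _ _ => rfl
      ext p
      simp only [Finset.mem_filter, mem_primesUpTo, Nat.mem_primeFactors, N,
        Nat.le_floor_iff (by linarith : 0 ≤ X)]
      tauto
    have hpos : 0 < ∏ p ∈ (primesUpTo N).filter (· ∣ x * y), (1 - (p : ℝ)⁻¹) :=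
      Finset.prod_pos fun p hp => totRatio_factor_pos
        (mem_primesUpTo.1 (Finset.mem_filter.1 hp).1).2
    rw [hs, mul_inv, tailProd, Finset.prod_inv_distrib, mul_comm, ← mul_assoc,
      mul_inv_cancel₀ hpos.ne', one_mul]
  calc _ ≤ 2 * B * (totRatio (x * y))⁻¹ * (39 * Real.exp 12 * N *
        ∏ p ∈ (primesUpTo N).filter (· ∣ x * y), (1 - (p : ℝ)⁻¹)) :=
        mul_le_mul_of_nonneg_left (sum_inv_totRatio_le hN (x * y))
          (mul_nonneg (mul_nonneg zero_le_two hB0) (inv_pos.2 (totRatio_pos _)).le)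
    _ = 78 * Real.exp 12 * N * B * tailProd X (x * y) := by rw [← htail]; ring
    _ ≤ _ := by
        have := tailProd_nonneg X (x * y)
        gcongr

/-- If neighbourhoods of two distinct reduced fractions on the circle meet, the pair of
numerators solves one of the counted congruences. -/
lemma exists_mem_solutions {g x y a c : ℕ} (hg : 0 < g) (hx : 0 < x) (hy : 0 < y) (hxy : x ≠ y)
    (hcop : x.Coprime y) (ha : a < g * x) (hax : a.Coprime (g * x)) (hc : c < g * y)
    (hcy : c.Coprime (g * y)) {s t : ℝ} {z : UnitAddCircle}
    (h1 : ‖z - (((a : ℝ) / (g * x : ℕ) : ℝ) : UnitAddCircle)‖ < s / (g * x : ℕ))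
    (h2 : ‖z - (((c : ℝ) / (g * y : ℕ) : ℝ) : UnitAddCircle)‖ < t / (g * y : ℕ)) :
    ∃ n : ℤ, n ≠ 0 ∧ |(n : ℝ)| < 2 * max (s * y) (t * x) ∧ (a, c) ∈ solutions g x y n := by
  have hg' : (0 : ℝ) < g := by exact_mod_cast hg
  have hx' : (0 : ℝ) < x := by exact_mod_cast hx
  have hy' : (0 : ℝ) < y := by exact_mod_cast hy
  set k : ℤ := round ((a : ℝ) / (g * x : ℕ) - c / (g * y : ℕ)) with hk
  have h3 : |(a : ℝ) / (g * x : ℕ) - c / (g * y : ℕ) - k| < s / (g * x : ℕ) + t / (g * y : ℕ) := by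
    rw [hk, ← UnitAddCircle.norm_eq]
    rw [AddCircle.coe_sub]
    refine lt_of_le_of_lt ?_ (add_lt_add h1 h2)
    rw [norm_sub_rev z]
    exact norm_sub_le_norm_sub_add_norm_sub _ _ _
  refine ⟨a * y - c * x - k * (g * x * y : ℕ), fun h0 => hxy ?_, ?_, ?_⟩
  · have hxa : (x : ℤ) ∣ a * y :=
      ⟨c + k * g * y, by push_cast at h0; linear_combination h0⟩
    have hyc : (y : ℤ) ∣ c * x :=
      ⟨a - k * g * x, by push_cast at h0; linear_combination -h0⟩
    have hx1 : x = 1 := Nat.eq_one_of_dvd_coprimes hax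
      (hcop.dvd_of_dvd_mul_right (by exact_mod_cast hxa)) (dvd_mul_left _ _)
    have hy1 : y = 1 := Nat.eq_one_of_dvd_coprimes hcy
      (hcop.symm.dvd_of_dvd_mul_right (by exact_mod_cast hyc)) (dvd_mul_left _ _)
    rw [hx1, hy1]
  · have e : ((a * y - c * x - k * (g * x * y : ℕ) : ℤ) : ℝ) =
        (g * x * y) * ((a : ℝ) / (g * x : ℕ) - c / (g * y : ℕ) - k) := by
      push_cast
      field_simp
    rw [e, abs_mul, abs_of_pos (by positivity)]
    calc _ < (g * x * y) * (s / (g * x : ℕ) + t / (g * y : ℕ)) :=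
          mul_lt_mul_of_pos_left h3 (by positivity)
      _ = s * y + t * x := by push_cast; field_simp
      _ ≤ _ := by
          have := le_max_left (s * (y : ℝ)) (t * x)
          have := le_max_right (s * (y : ℝ)) (t * x)
          linarith
  · refine mem_solutions.2 ⟨⟨ha, hc⟩, hax, hcy, k, ?_⟩
    push_cast
    ring

lemma volume_inter_le_aux {g x y : ℕ} (hg : 0 < g) (hx : 0 < x) (hy : 0 < y) (hxy : x ≠ y)
    (hcop : x.Coprime y) {s t : ℝ} (hs : 0 ≤ s) (ht : 0 ≤ t) :
    volume (approxAddOrderOf UnitAddCircle (g * x) (s / (g * x : ℕ)) ∩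
      approxAddOrderOf UnitAddCircle (g * y) (t / (g * y : ℕ))) ≤
    ENNReal.ofReal (if 1 / 2 < max (s * y) (t * x) then 312 * Real.exp 12 *
      (s * totRatio (g * x) * (t * totRatio (g * y)) *
        tailProd (2 * max (s * y) (t * x)) (x * y)) else 0) := by
  classical
  have hg' : (0 : ℝ) < g := by exact_mod_cast hg
  have hx' : (0 : ℝ) < x := by exact_mod_cast hx
  have hy' : (0 : ℝ) < y := by exact_mod_cast hy
  set X := 2 * max (s * (y : ℝ)) (t * x) with hX
  set r := min (s / (g * x : ℕ)) (t / (g * y : ℕ)) with hr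
  set S := (Finset.Icc 1 ⌊X⌋₊).biUnion fun n : ℕ => solutions g x y n ∪ solutions g x y (-n) with hS
  set cen : ℕ × ℕ → UnitAddCircle := fun q => if s / (g * x : ℕ) ≤ t / (g * y : ℕ) then
    (((q.1 : ℝ) / (g * x : ℕ) : ℝ) : UnitAddCircle) else
    (((q.2 : ℝ) / (g * y : ℕ) : ℝ) : UnitAddCircle) with hcen
  have hsub : approxAddOrderOf UnitAddCircle (g * x) (s / (g * x : ℕ)) ∩
      approxAddOrderOf UnitAddCircle (g * y) (t / (g * y : ℕ)) ⊆
      {z | 1 < X ∧ z ∈ ⋃ q ∈ S, Metric.closedBall (cen q) r} := by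
    rintro z ⟨h1, h2⟩
    obtain ⟨a, ha, hax, h1⟩ := (UnitAddCircle.mem_approxAddOrderOf_iff (Nat.mul_pos hg hx)).1 h1
    obtain ⟨c, hc, hcy, h2⟩ := (UnitAddCircle.mem_approxAddOrderOf_iff (Nat.mul_pos hg hy)).1 h2
    obtain ⟨n, hn, hnX, hmem⟩ := exists_mem_solutions hg hx hy hxy hcop ha hax hc hcy h1 h2
    have habs : ((n.natAbs : ℕ) : ℝ) < X := by rwa [Nat.cast_natAbs, Int.cast_abs]
    have hn1 : 1 ≤ n.natAbs := Int.natAbs_pos.2 hn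
    refine ⟨lt_of_le_of_lt (by exact_mod_cast hn1) habs, ?_⟩
    refine Set.mem_iUnion₂.2 ⟨(a, c), ?_, ?_⟩
    · refine Finset.mem_biUnion.2 ⟨n.natAbs, Finset.mem_Icc.2 ⟨hn1, Nat.le_floor habs.le⟩, ?_⟩
      rcases Int.natAbs_eq n with h | h
      · exact Finset.mem_union_left _ (h ▸ hmem)
      · refine Finset.mem_union_right _ ?_
        rwa [← h]
    · rw [Metric.mem_closedBall, dist_eq_norm, hcen, hr]
      dsimp only
      split_ifs with h
      · rw [min_eq_left h]; exact h1.le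
      · rw [min_eq_right (not_le.1 h).le]; exact h2.le
  have hhalf : 1 / 2 < max (s * (y : ℝ)) (t * x) ↔ 1 < X := by
    rw [hX]; constructor <;> intro h <;> linarith
  simp only [hhalf]
  split_ifs with hX1
  · have hr0 : 0 ≤ r := le_min (by positivity) (by positivity)
    have hcard : (S.card : ℝ) ≤ 78 * Real.exp 12 * X *
        (g * (totRatio (g * x) * totRatio (g * y))) * tailProd X (x * y) := by
      refine le_trans ?_ (sum_card_solutions_le hg hx hy hcop hX1.le)
      have : S.card ≤ ∑ n ∈ Finset.Icc 1 ⌊X⌋₊,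
          ((solutions g x y n).card + (solutions g x y (-n)).card) :=
        Finset.card_biUnion_le.trans (Finset.sum_le_sum fun n _ => Finset.card_union_le _ _)
      exact_mod_cast this
    have hrX : X * g * r = 2 * (s * t) := by
      have e : X = 2 * (g * x * y * max (s / (g * x : ℕ)) (t / (g * y : ℕ))) := by
        rw [hX]
        congr 1
        rw [mul_max_of_nonneg _ _ (by positivity)]
        congr 1 <;> push_cast <;> field_simp
      rw [e, hr]
      have := max_mul_min (s / (g * x : ℕ)) (t / (g * y : ℕ))
      calc _ = 2 * (g * g * x * y) * (max (s / (g * x : ℕ)) (t / (g * y : ℕ)) *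
            min (s / (g * x : ℕ)) (t / (g * y : ℕ))) := by ring
        _ = _ := by rw [this]; push_cast; field_simp
    calc _ ≤ volume (⋃ q ∈ S, Metric.closedBall (cen q) r) :=
          measure_mono fun z hz => (hsub hz).2
      _ ≤ ∑ q ∈ S, volume (Metric.closedBall (cen q) r) := measure_biUnion_finset_le _ _
      _ ≤ ∑ q ∈ S, ENNReal.ofReal (2 * r) := by
          refine Finset.sum_le_sum fun q _ => ?_
          rw [AddCircle.volume_closedBall]
          exact ENNReal.ofReal_le_ofReal (min_le_right _ _)
      _ = ENNReal.ofReal (S.card * (2 * r)) := by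
          rw [Finset.sum_const, nsmul_eq_mul, ENNReal.ofReal_mul (Nat.cast_nonneg _),
            ENNReal.ofReal_natCast]
      _ ≤ _ := by
          refine ENNReal.ofReal_le_ofReal ((mul_le_mul_of_nonneg_right hcard
            (by positivity)).trans_eq ?_)
          linear_combination (156 * Real.exp 12 * (totRatio (g * x) * totRatio (g * y)) *
            tailProd X (x * y)) * hrX
  · rw [ENNReal.ofReal_zero, nonpos_iff_eq_zero]
    exact measure_mono_null (fun z hz => (hX1 (hsub hz).1).elim) (measure_empty (μ := volume))

/-- The overlap estimate. -/
lemma volume_inter_le {ψ : ℕ → ℝ} (hψ : ∀ v, 0 ≤ ψ v) {v w : ℕ} (hv : 0 < v) (hw : 0 < w)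
    (hvw : v ≠ w) :
    volume (approxAddOrderOf UnitAddCircle v (ψ v / v) ∩
      approxAddOrderOf UnitAddCircle w (ψ w / w)) ≤
    ENNReal.ofReal (312 * Real.exp 12 * (if 1 / 2 < pairSize ψ v w then
      ψ v * totRatio v * (ψ w * totRatio w) *
        tailProd (2 * pairSize ψ v w) (pairMod v w) else 0)) := by
  have hg : 0 < v.gcd w := Nat.gcd_pos_of_pos_left w hv
  have hx : 0 < v / v.gcd w := Nat.div_pos (Nat.gcd_le_left w hv) hg
  have hy : 0 < w / v.gcd w := Nat.div_pos (Nat.gcd_le_right v hw) hg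
  have ev : v.gcd w * (v / v.gcd w) = v := Nat.mul_div_cancel' (Nat.gcd_dvd_left v w)
  have ew : v.gcd w * (w / v.gcd w) = w := Nat.mul_div_cancel' (Nat.gcd_dvd_right v w)
  have := volume_inter_le_aux hg hx hy (fun h => hvw (by rw [← ev, h, ew]))
    (Nat.coprime_div_gcd_div_gcd hg) (hψ v) (hψ w)
  rw [ev, ew] at this
  refine this.trans_eq ?_
  rw [pairSize, pairMod, mul_ite, mul_zero]

/-- Mertens' lower bound for `φ(d)/d`, with an explicit constant. -/
lemma inv_totRatio_le {d : ℕ} (hd : d ≠ 0) :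
    (totRatio d)⁻¹ ≤ 3 * Real.exp 12 * max 1 (Real.log (max 1 (Real.log d))) := by
  set y := max 1 (Real.log d) with hy
  have hy1 : 1 ≤ y := le_max_left _ _
  set N := ⌈y⌉₊ with hN
  have hyN : y ≤ N := Nat.le_ceil y
  have hN1 : 1 ≤ N := by exact_mod_cast hy1.trans hyN
  have hN2 : (N : ℝ) ≤ 2 * y := by
    have := (Nat.ceil_lt_add_one (by linarith : 0 ≤ y)).le
    linarith
  have hpr : ∀ p ∈ d.primeFactors, p.Prime := fun p hp => Nat.prime_of_mem_primeFactors hp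
  have hsmall : ∏ p ∈ d.primeFactors.filter (· ≤ N), (1 - (p : ℝ)⁻¹)⁻¹ ≤
      Real.exp 8 * (3 * max 1 (Real.log y)) := by
    calc _ ≤ ∏ p ∈ primesUpTo N, (1 - (p : ℝ)⁻¹)⁻¹ := by
          refine Finset.prod_le_prod_of_subset_of_one_le (fun p hp => ?_) (fun p hp => ?_)
            fun p hp _ => ?_
          · obtain ⟨hp, hpN⟩ := Finset.mem_filter.1 hp
            exact mem_primesUpTo.2 ⟨hpN, hpr p hp⟩
          · exact (inv_pos.2 (totRatio_factor_pos (hpr p (Finset.mem_filter.1 hp).1))).le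
          · exact one_le_inv_factor (mem_primesUpTo.1 hp).2
      _ ≤ Real.exp 8 * (1 + Real.log N) := prod_inv_factor_le hN1
      _ ≤ _ := by
          have h1 : Real.log N ≤ Real.log 2 + Real.log y := by
            rw [← Real.log_mul two_ne_zero (by linarith)]
            exact Real.log_le_log (by exact_mod_cast hN1) hN2
          have h2 := Real.log_two_lt_d9
          have h3 := le_max_left 1 (Real.log y)
          have h4 := le_max_right 1 (Real.log y)
          refine mul_le_mul_of_nonneg_left ?_ (Real.exp_pos _).le
          linarith
  have hlarge : ∏ p ∈ d.primeFactors.filter (fun p => ¬ p ≤ N), (1 - (p : ℝ)⁻¹)⁻¹ ≤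
      Real.exp 4 := by
    calc _ ≤ ∏ p ∈ d.primeFactors.filter (fun p => ¬ p ≤ N), Real.exp (4 / y * Real.log p) := by
          refine Finset.prod_le_prod (fun p hp => ?_) fun p hp => ?_
          · exact (inv_pos.2 (totRatio_factor_pos (hpr p (Finset.mem_filter.1 hp).1))).le
          · obtain ⟨hp, hpN⟩ := Finset.mem_filter.1 hp
            have hpp := hpr p hp
            refine (inv_factor_le_exp hpp).trans (Real.exp_le_exp.2 ?_)
            have hpy : y ≤ p := hyN.trans (by exact_mod_cast (not_le.1 hpN).le)
            have h2 : Real.log 2 ≤ Real.log p :=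
              Real.log_le_log two_pos (by exact_mod_cast hpp.two_le)
            have h3 := Real.log_two_gt_d9
            have h4 : (p : ℝ)⁻¹ ≤ y⁻¹ := inv_anti₀ (by linarith) hpy
            have h5 : 0 ≤ y⁻¹ := inv_nonneg.2 (by linarith)
            rw [div_eq_mul_inv]
            nlinarith
      _ = Real.exp (4 / y * ∑ p ∈ d.primeFactors.filter (fun p => ¬ p ≤ N), Real.log p) := by
          rw [← Real.exp_sum, Finset.mul_sum]
      _ ≤ _ := by
          refine Real.exp_le_exp.2 ?_
          have h1 : ∑ p ∈ d.primeFactors.filter (fun p => ¬ p ≤ N), Real.log p ≤ y :=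
            (Finset.sum_le_sum_of_subset_of_nonneg (Finset.filter_subset _ _) fun p hp _ =>
              Real.log_natCast_nonneg p).trans ((sum_log_primeFactors_le hd).trans (le_max_right _ _))
          rw [div_mul_eq_mul_div, div_le_iff₀ (by linarith)]
          linarith
  rw [totRatio, ← Finset.prod_inv_distrib,
    ← Finset.prod_filter_mul_prod_filter_not _ (fun p => p ≤ N)]
  refine (mul_le_mul hsmall hlarge (Finset.prod_nonneg fun p hp => ?_) (by positivity)).trans_eq ?_
  · exact (inv_pos.2 (totRatio_factor_pos (hpr p (Finset.mem_filter.1 hp).1))).le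
  · rw [show (12 : ℝ) = 8 + 4 by norm_num, Real.exp_add]
    ring

lemma measureReal_approxAddOrderOf {v : ℕ} (hv : 0 < v) {s : ℝ} (hs : 0 ≤ s) (hs' : s ≤ 1 / 2) :
    volume.real (approxAddOrderOf UnitAddCircle v (s / v)) = 2 * (s * totRatio v) := by
  have hv' : (1 : ℝ) ≤ v := by exact_mod_cast hv
  have hfin : {u : UnitAddCircle | addOrderOf u = v}.Finite :=
    AddCircle.finite_setOfPred_addOrderOf_eq 1 hv
  have hset : approxAddOrderOf UnitAddCircle v (s / v) =
      ⋃ u ∈ hfin.toFinset, Metric.ball u (s / v) := by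
    rw [approxAddOrderOf, Metric.thickening_eq_biUnion_ball]
    simp
  have hcard : hfin.toFinset.card = v.totient := by
    rw [← AddCircle.card_addOrderOf_eq_totient (1 : ℝ) (n := v),
      ← Nat.card_eq_card_finite_toFinset hfin]
    rfl
  have hball : ∀ u : UnitAddCircle, volume.real (Metric.ball u (s / v)) = 2 * (s / v) := by
    intro u
    rw [measureReal_def, ← measure_congr AddCircle.closedBall_ae_eq_ball,
      AddCircle.volume_closedBall, min_eq_right, ENNReal.toReal_ofReal (by positivity)]
    have : s / v ≤ s := div_le_self hs hv'
    linarith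
  rw [hset, measureReal_biUnion_finset]
  · rw [Finset.sum_congr rfl fun u _ => hball u, Finset.sum_const, hcard, nsmul_eq_mul,
      totient_eq_mul_totRatio]
    field_simp
  · intro u hu u' hu' hne
    have hu1 : addOrderOf u = v := by simpa using hu
    have hu2 : addOrderOf u' = v := by simpa using hu'
    have hz : v • (u - u') = 0 := by
      rw [smul_sub, ← hu1, addOrderOf_nsmul_eq_zero, hu1, ← hu2, addOrderOf_nsmul_eq_zero, sub_zero]
    have h1 := AddCircle.le_add_order_smul_norm_of_isOfFinAddOrder
      (isOfFinAddOrder_iff_nsmul_eq_zero.2 ⟨v, hv, hz⟩) (sub_ne_zero.2 hne)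
    have h2 : (addOrderOf (u - u') : ℝ) ≤ v := by
      exact_mod_cast Nat.le_of_dvd hv (addOrderOf_dvd_of_nsmul_eq_zero hz)
    rw [nsmul_eq_mul] at h1
    have h3 : 1 ≤ v * ‖u - u'‖ := h1.trans (mul_le_mul_of_nonneg_right h2 (norm_nonneg _))
    refine Metric.ball_disjoint_ball ?_
    rw [dist_eq_norm, ← add_div, div_le_iff₀ (by linarith)]
    linarith
  · exact fun _ _ => measurableSet_ball

/-- A second-moment lower bound for the measure of a union. -/
lemma le_measureReal_biUnion {Ω ι : Type*} [MeasurableSpace Ω] {μ : Measure Ω} [IsFiniteMeasure μ]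
    {V : Finset ι} {A : ι → Set Ω} (hA : ∀ i, MeasurableSet (A i)) (t : ℝ) :
    2 * t * ∑ v ∈ V, μ.real (A v) - t ^ 2 * ∑ v ∈ V, ∑ w ∈ V, μ.real (A v ∩ A w) ≤
      μ.real (⋃ v ∈ V, A v) := by
  have hind : ∀ {B : Set Ω}, MeasurableSet B → Integrable (B.indicator (1 : Ω → ℝ)) μ :=
    fun hB => (integrable_const (1 : ℝ)).indicator hB
  have hU : MeasurableSet (⋃ v ∈ V, A v) := V.measurableSet_biUnion fun v _ => hA v
  have hI1 : Integrable (fun z => ∑ v ∈ V, (A v).indicator (1 : Ω → ℝ) z) μ :=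
    integrable_finsetSum _ fun v _ => hind (hA v)
  have hI2 : Integrable (fun z => ∑ v ∈ V, ∑ w ∈ V, (A v ∩ A w).indicator (1 : Ω → ℝ) z) μ :=
    integrable_finsetSum _ fun v _ => integrable_finsetSum _ fun w _ => hind ((hA v).inter (hA w))
  have e1 : ∫ z, (∑ v ∈ V, (A v).indicator (1 : Ω → ℝ) z) ∂μ = ∑ v ∈ V, μ.real (A v) := by
    rw [integral_finsetSum _ fun v _ => hind (hA v)]
    exact Finset.sum_congr rfl fun v _ => integral_indicator_one (hA v)
  have e2 : ∫ z, (∑ v ∈ V, ∑ w ∈ V, (A v ∩ A w).indicator (1 : Ω → ℝ) z) ∂μ =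
      ∑ v ∈ V, ∑ w ∈ V, μ.real (A v ∩ A w) := by
    rw [integral_finsetSum _ fun v _ =>
      integrable_finsetSum _ fun w _ => hind ((hA v).inter (hA w))]
    refine Finset.sum_congr rfl fun v _ => ?_
    rw [integral_finsetSum _ fun w _ => hind ((hA v).inter (hA w))]
    exact Finset.sum_congr rfl fun w _ => integral_indicator_one ((hA v).inter (hA w))
  rw [← integral_indicator_one hU, ← e1, ← e2, ← integral_const_mul, ← integral_const_mul,
    ← integral_sub (hI1.const_mul _) (hI2.const_mul _)]
  refine integral_mono ((hI1.const_mul _).sub (hI2.const_mul _)) (hind hU) fun z => ?_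
  have hsq : ∑ v ∈ V, ∑ w ∈ V, (A v ∩ A w).indicator (1 : Ω → ℝ) z =
      (∑ v ∈ V, (A v).indicator (1 : Ω → ℝ) z) ^ 2 := by
    rw [sq, Finset.sum_mul_sum]
    refine Finset.sum_congr rfl fun v _ => Finset.sum_congr rfl fun w _ => ?_
    rw [← Set.inter_indicator_mul]
    simp
    rfl
  simp only [hsq]
  by_cases hz : z ∈ ⋃ v ∈ V, A v
  · rw [Set.indicator_of_mem hz, Pi.one_apply]
    nlinarith [sq_nonneg (t * (∑ v ∈ V, (A v).indicator (1 : Ω → ℝ) z) - 1)]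
  · rw [Set.indicator_of_notMem hz]
    have : ∑ v ∈ V, (A v).indicator (1 : Ω → ℝ) z = 0 := by
      refine Finset.sum_eq_zero fun v hv => Set.indicator_of_notMem (fun h => hz ?_) _
      exact Set.mem_iUnion₂.2 ⟨v, hv, h⟩
    rw [this]
    simp

lemma exists_block {f : ℕ → ℝ} (h0 : ∀ n, 0 ≤ f n) (h1 : ∀ n, f n ≤ 1) (hf : ¬ Summable f)
    (n₀ : ℕ) : ∃ n, 1 ≤ ∑ i ∈ Finset.Ico n₀ n, f i ∧ ∑ i ∈ Finset.Ico n₀ n, f i ≤ 2 := by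
  classical
  have hex : ∃ n, 1 ≤ ∑ i ∈ Finset.Ico n₀ n, f i := by
    have := (not_summable_iff_tendsto_nat_atTop_of_nonneg h0).1 hf
    obtain ⟨n, hn, hn0⟩ := ((this.eventually_ge_atTop (1 + ∑ i ∈ Finset.range n₀, f i)).and
      (eventually_ge_atTop n₀)).exists
    refine ⟨n, ?_⟩
    rw [Finset.sum_Ico_eq_sub _ hn0]
    linarith
  refine ⟨Nat.find hex, Nat.find_spec hex, ?_⟩
  have hspec := Nat.find_spec hex
  rcases hm : Nat.find hex with _ | m
  · simp
  · have hlt := not_le.1 (Nat.find_min hex (m := m) (by omega))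
    by_cases hmn : n₀ ≤ m
    · rw [Finset.sum_Ico_succ_top hmn]
      linarith [h1 m]
    · rw [Finset.Ico_eq_empty (by omega)]
      simp

lemma exists_le_measureReal_iUnion : ∃ c > 0, ∀ ψ : ℕ → ℝ, (∀ v, 0 ≤ ψ v) → (∀ v, ψ v ≤ 1 / 2) →
    ¬ Summable (fun v => ψ v * totRatio v) → ∀ n₀ : ℕ, c ≤ volume.real
      (⋃ v ∈ {v | n₀ < v}, approxAddOrderOf UnitAddCircle v (ψ v / v)) := by
  obtain ⟨C, hC⟩ := exists_sum_tailProd_le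
  set K := max 0 (312 * Real.exp 12 * C) + 4 with hK
  have hK0 : 0 < K := by positivity
  refine ⟨4 / K, by positivity, fun ψ h0 h1 hdiv n₀ => ?_⟩
  obtain ⟨n, hn1, hn2⟩ := exists_block
    (fun v => mul_nonneg (h0 v) (totRatio_pos v).le)
    (fun v => (mul_le_one₀ ((h1 v).trans (by norm_num)) (totRatio_pos v).le (totRatio_le_one v)))
    hdiv (n₀ + 1)
  set V := Finset.Ico (n₀ + 1) n with hV
  set A : ℕ → Set UnitAddCircle := fun v => approxAddOrderOf UnitAddCircle v (ψ v / v) with hA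
  have hVpos : ∀ v ∈ V, 0 < v := fun v hv => by have := (Finset.mem_Ico.1 hv).1; omega
  have hmeas : ∀ v, MeasurableSet (A v) := fun v => Metric.isOpen_thickening.measurableSet
  have hvol : ∀ v ∈ V, volume.real (A v) = 2 * (ψ v * totRatio v) := fun v hv =>
    measureReal_approxAddOrderOf (hVpos v hv) (h0 v) (h1 v)
  set R : ℕ → ℕ → ℝ := fun v w => if 1 / 2 < pairSize ψ v w then
    ψ v * totRatio v * (ψ w * totRatio w) * tailProd (2 * pairSize ψ v w) (pairMod v w) else 0
    with hR
  have hR0 : ∀ v w, 0 ≤ R v w := fun v w => by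
    have := totRatio_pos v
    have := totRatio_pos w
    have := h0 v
    have := h0 w
    have := tailProd_nonneg (2 * pairSize ψ v w) (pairMod v w)
    simp only [hR]
    split_ifs <;> positivity
  have hsum : ∑ v ∈ V, volume.real (A v) = 2 * ∑ v ∈ V, ψ v * totRatio v := by
    rw [Finset.sum_congr rfl hvol, Finset.mul_sum]
  have hpair : ∀ v ∈ V, ∀ w ∈ V, volume.real (A v ∩ A w) ≤
      312 * Real.exp 12 * R v w + if v = w then volume.real (A v) else 0 := by
    intro v hv w hw
    by_cases hvw : v = w
    · subst hvw
      rw [Set.inter_self, if_pos rfl]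
      have := hR0 v v
      have : 0 ≤ 312 * Real.exp 12 * R v v := by positivity
      linarith
    · rw [if_neg hvw, add_zero, measureReal_def]
      refine ENNReal.toReal_le_of_le_ofReal (mul_nonneg (by positivity) (hR0 v w)) ?_
      exact volume_inter_le h0 (hVpos v hv) (hVpos w hw) hvw
  have hsecond : ∑ v ∈ V, ∑ w ∈ V, volume.real (A v ∩ A w) ≤ K := by
    calc _ ≤ ∑ v ∈ V, ∑ w ∈ V, (312 * Real.exp 12 * R v w +
          if v = w then volume.real (A v) else 0) :=
          Finset.sum_le_sum fun v hv => Finset.sum_le_sum fun w hw => hpair v hv w hw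
      _ = 312 * Real.exp 12 * ∑ v ∈ V, ∑ w ∈ V, R v w + ∑ v ∈ V, volume.real (A v) := by
          simp only [Finset.sum_add_distrib, Finset.mul_sum]
          congr 1
          exact Finset.sum_congr rfl fun v hv => by rw [Finset.sum_ite_eq, if_pos hv]
      _ ≤ 312 * Real.exp 12 * C + 4 := by
          rw [hsum]
          refine add_le_add (mul_le_mul_of_nonneg_left
            (hC V ψ (fun v hv => (hVpos v hv).ne') h0 hn2) (by positivity)) (by linarith)
      _ ≤ K := by
          have := le_max_right 0 (312 * Real.exp 12 * C)
          linarith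
  calc 4 / K = 2 * (2 / K) * 2 - (2 / K) ^ 2 * K := by field_simp; norm_num
    _ ≤ 2 * (2 / K) * ∑ v ∈ V, volume.real (A v) -
        (2 / K) ^ 2 * ∑ v ∈ V, ∑ w ∈ V, volume.real (A v ∩ A w) := by
        rw [hsum]
        gcongr
        linarith
    _ ≤ volume.real (⋃ v ∈ V, A v) := le_measureReal_biUnion hmeas _
    _ ≤ _ := by
        refine measureReal_mono (Set.biUnion_subset_biUnion_left fun v hv => ?_) (measure_ne_top _ _)
        exact (Finset.mem_Ico.1 hv).1

/-- The divergence part of the Duffin–Schaeffer conjecture. -/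
theorem ae_mem_addWellApproximable {ψ : ℕ → ℝ} (h0 : ∀ v, 0 ≤ ψ v) (h1 : ∀ v, ψ v ≤ 1 / 2)
    (hdiv : ¬ Summable (fun v => ψ v * totRatio v)) :
    ∀ᵐ z : UnitAddCircle, z ∈ addWellApproximable UnitAddCircle fun v => ψ v / v := by
  have hlim : Tendsto (fun v => ψ v / v) atTop (nhds 0) := by
    refine squeeze_zero (fun v => div_nonneg (h0 v) (Nat.cast_nonneg v)) (fun v => ?_)
      (tendsto_const_div_atTop_nhds_zero_nat (1 / 2))
    exact div_le_div_of_nonneg_right (h1 v) (Nat.cast_nonneg v)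
  refine (AddCircle.addWellApproximable_ae_empty_or_univ (T := 1) _ hlim).resolve_left fun h => ?_
  obtain ⟨c, hc, hU⟩ := exists_le_measureReal_iUnion
  set U : ℕ → Set UnitAddCircle := fun n₀ =>
    ⋃ v ∈ {v | n₀ < v}, approxAddOrderOf UnitAddCircle v (ψ v / v) with hUdef
  have hmeas : ∀ n, MeasurableSet (U n) := fun n =>
    (isOpen_biUnion fun v _ => Metric.isOpen_thickening).measurableSet
  have hanti : Antitone U := fun m n hmn =>
    Set.biUnion_subset_biUnion_left fun v hv => lt_of_le_of_lt hmn hv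
  have hle : ENNReal.ofReal c ≤ volume (⋂ n, U n) := by
    rw [hanti.measure_iInter (fun n => (hmeas n).nullMeasurableSet) ⟨0, measure_ne_top _ _⟩]
    exact le_iInf fun n => ENNReal.ofReal_le_of_le_toReal (hU ψ h0 h1 hdiv n)
  have hzero : volume (⋂ n, U n) = 0 := by
    refine measure_mono_null (fun z hz => ?_) (ae_iff.1 h)
    simp only [Set.mem_ofPred_eq, not_not]
    rw [mem_add_wellApproximable_iff, ← Nat.cofinite_eq_atTop, cofinite.blimsup_set_eq]
    refine Set.infinite_of_not_bddAbove fun ⟨B, hB⟩ => ?_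
    obtain ⟨v, hv, hzv⟩ := Set.mem_iUnion₂.1 (Set.mem_iInter.1 hz B)
    exact absurd (hB ⟨Nat.zero_lt_of_lt hv, hzv⟩) (not_le.2 hv)
  rw [hzero, nonpos_iff_eq_zero, ENNReal.ofReal_eq_zero] at hle
  exact absurd hc (not_lt.2 hle)

/-- The same statement on the real line. -/
theorem ae_infinite_norm_mul_lt {ψ : ℕ → ℝ} (h0 : ∀ v, 0 ≤ ψ v) (h1 : ∀ v, ψ v ≤ 1 / 2)
    (hdiv : ¬ Summable (fun v => ψ v * totRatio v)) :
    ∀ᵐ α : ℝ, α ∈ Set.Icc (0 : ℝ) 1 →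
      {v : ℕ | 0 < v ∧ |(v : ℝ) * α - round ((v : ℝ) * α)| < ψ v}.Infinite := by
  have h := ae_mem_addWellApproximable h0 h1 hdiv
  have hmp := (UnitAddCircle.measurePreserving_mk 0).quasiMeasurePreserving
  have h2 := hmp.ae h
  rw [ae_restrict_iff' measurableSet_Ioc] at h2
  have h3 : ∀ᵐ α : ℝ, α ≠ 0 := by
    simp [ae_iff]
  filter_upwards [h2, h3] with α hα hα0 hmem
  have := hα ⟨lt_of_le_of_ne hmem.1 hα0.symm, by simpa using hmem.2⟩
  rw [UnitAddCircle.mem_addWellApproximable_iff] at this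
  refine this.mono ?_
  rintro v ⟨m, hm, -, hlt⟩
  have hv : (0 : ℝ) < v := by exact_mod_cast Nat.zero_lt_of_lt hm
  refine ⟨Nat.zero_lt_of_lt hm, ?_⟩
  rw [← AddCircle.coe_sub, UnitAddCircle.norm_eq, lt_div_iff₀ hv] at hlt
  refine lt_of_le_of_lt ?_ hlt
  refine (round_le _ (m + v * round (α - m / v))).trans_eq ?_
  rw [← abs_of_pos hv, ← abs_mul, abs_of_pos hv]
  push_cast
  congr 1
  field_simp
  ring

lemma log_sub_log_le {x y : ℝ} (hx : 0 < x) (hxy : x ≤ y) (h3 : y ≤ 3 * x) :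
    Real.log y - Real.log x ≤ 3 * ((y - x) / y) := by
  have hy : 0 < y := hx.trans_le hxy
  rw [← Real.log_div hy.ne' hx.ne']
  refine (Real.log_le_sub_one_of_pos (div_pos hy hx)).trans ?_
  rw [← mul_div_assoc, le_div_iff₀ hy, div_sub_one hx.ne', div_mul_eq_mul_div, div_le_iff₀ hx]
  nlinarith [mul_nonneg (sub_nonneg.2 hxy) (sub_nonneg.2 h3)]

lemma log_le_three_mul_log {x y : ℝ} (hx : 1 ≤ Real.log x) (hx0 : 0 < x) (hy : 0 < y)
    (h3 : y ≤ 3 * x) : Real.log y ≤ 3 * Real.log x := by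
  have h1 := Real.log_le_log hy h3
  rw [Real.log_mul three_ne_zero hx0.ne'] at h1
  have h2 := Real.log_le_sub_one_of_pos (zero_lt_three (α := ℝ))
  linarith

/-- Comparison of `(y - x) / (y log y log log y)` with an increment of `log log log`. -/
lemma log_log_log_sub_le {x y : ℝ} (hx0 : 0 < x) (hx : 1 ≤ Real.log (Real.log x))
    (hx1 : 1 ≤ Real.log x) (hxy : x ≤ y) (h3 : y ≤ 3 * x) :
    Real.log (Real.log (Real.log y)) - Real.log (Real.log (Real.log x)) ≤
      27 * ((y - x) / (y * (Real.log y * Real.log (Real.log y)))) := by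
  have hy0 : 0 < y := hx0.trans_le hxy
  have hxy1 := Real.log_le_log hx0 hxy
  have hxy2 := Real.log_le_log (by linarith) hxy1
  have h31 := log_le_three_mul_log hx1 hx0 hy0 h3
  have h32 := log_le_three_mul_log hx (by linarith) (by linarith) h31
  have e1 := log_sub_log_le hx0 hxy h3
  have e2 := log_sub_log_le (by linarith) hxy1 h31
  have e3 := log_sub_log_le (by linarith) hxy2 h32
  have p1 : 0 < Real.log y := by linarith
  have p2 : 0 < Real.log (Real.log y) := by linarith
  calc _ ≤ 3 * ((Real.log (Real.log y) - Real.log (Real.log x)) / Real.log (Real.log y)) := e3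
    _ ≤ 3 * ((3 * ((Real.log y - Real.log x) / Real.log y)) / Real.log (Real.log y)) := by gcongr
    _ ≤ 3 * ((3 * ((3 * ((y - x) / y)) / Real.log y)) / Real.log (Real.log y)) := by gcongr
    _ = _ := by field_simp; ring

lemma one_le_LL (x : ℝ) : 1 ≤ LL x := le_max_left _ _

lemma L_mono {x y : ℝ} (hx : 0 < x) (hxy : x ≤ y) : L x ≤ L y :=
  max_le_max le_rfl (Real.log_le_log hx hxy)

lemma LL_mono {x y : ℝ} (hx : 0 < x) (hxy : x ≤ y) : LL x ≤ LL y :=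
  L_mono (zero_lt_one.trans_le (le_max_left _ _)) (L_mono hx hxy)

lemma L_mul_LL_le {x y : ℝ} (hx : 0 < x) (hy1 : 1 ≤ Real.log y) (hy : 1 ≤ Real.log (Real.log y))
    (hxy : x ≤ y) : L x * LL x ≤ Real.log y * Real.log (Real.log y) := by
  have e1 : L y = Real.log y := max_eq_right hy1
  have e2 : LL y = Real.log (Real.log y) := by rw [LL, e1]; exact max_eq_right hy
  rw [← e2, ← e1]
  have := one_le_LL x
  have : 1 ≤ L y := le_max_left _ _
  exact mul_le_mul (L_mono hx hxy) (LL_mono hx hxy) (by linarith) (by linarith)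

/-- The positive differences of `a 1, …, a N`. -/
def posDiff (a : ℕ → ℕ) (N : ℕ) : Finset ℕ :=
  ((Finset.Icc 1 N ×ˢ Finset.Icc 1 N).filter fun p => p.2 < p.1).image fun p => a p.1 - a p.2

lemma mem_posDiff {a : ℕ → ℕ} {N d : ℕ} :
    d ∈ posDiff a N ↔ ∃ m n, 1 ≤ n ∧ n < m ∧ m ≤ N ∧ a m - a n = d := by
  simp only [posDiff, Finset.mem_image, Finset.mem_filter, Finset.mem_product, Finset.mem_Icc,
    Prod.exists]
  constructor
  · rintro ⟨m, n, ⟨⟨h1, h2⟩, h3⟩, h4⟩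
    exact ⟨m, n, h2.1, h3, h1.2, h4⟩
  · rintro ⟨m, n, h1, h2, h3, h4⟩
    exact ⟨m, n, ⟨⟨⟨by omega, h3⟩, h1, by omega⟩, h2⟩, h4⟩

lemma posDiff_mono (a : ℕ → ℕ) : Monotone (posDiff a) := by
  intro M N h d hd
  obtain ⟨m, n, h1, h2, h3, h4⟩ := mem_posDiff.1 hd
  exact mem_posDiff.2 ⟨m, n, h1, h2, h3.trans h, h4⟩

lemma pos_of_mem_posDiff {a : ℕ → ℕ} (hmono : ∀ m n, 1 ≤ m → m < n → a m < a n)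
    {N d : ℕ} (hd : d ∈ posDiff a N) : 0 < d := by
  obtain ⟨m, n, h1, h2, -, rfl⟩ := mem_posDiff.1 hd
  have := hmono n m h1 h2
  omega

lemma le_of_mem_posDiff {a : ℕ → ℕ} (hmono : ∀ m n, 1 ≤ m → m < n → a m < a n)
    {N d : ℕ} (hd : d ∈ posDiff a N) : d ≤ a N := by
  obtain ⟨m, n, h1, h2, h3, rfl⟩ := mem_posDiff.1 hd
  rcases h3.eq_or_lt with rfl | h
  · omega
  · have := hmono m N (by omega) h
    omega

lemma diffCard_eq {a : ℕ → ℕ} (hmono : ∀ m n, 1 ≤ m → m < n → a m < a n)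
    {N : ℕ} (hN : 1 ≤ N) : diffCard a N = 2 * (posDiff a N).card + 1 := by
  have hset : ((Finset.Icc 1 N) ×ˢ (Finset.Icc 1 N)).image
      (fun p : ℕ × ℕ => (a p.1 : ℤ) - (a p.2 : ℤ)) =
      (((posDiff a N).image fun d : ℕ => (d : ℤ)) ∪ (posDiff a N).image fun d : ℕ => -(d : ℤ)) ∪
        {0} := by
    ext z
    simp only [Finset.mem_image, Finset.mem_product, Finset.mem_Icc, Prod.exists, Finset.mem_union,
      Finset.mem_singleton, mem_posDiff]
    constructor
    · rintro ⟨m, n, ⟨⟨hm1, hm2⟩, hn1, hn2⟩, rfl⟩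
      rcases lt_trichotomy m n with h | rfl | h
      · have := hmono m n hm1 h
        exact Or.inl (Or.inr ⟨_, ⟨n, m, hm1, h, hn2, rfl⟩, by omega⟩)
      · exact Or.inr (sub_self _)
      · have := hmono n m hn1 h
        exact Or.inl (Or.inl ⟨_, ⟨m, n, hn1, h, hm2, rfl⟩, by omega⟩)
    · rintro ((⟨d, ⟨m, n, h1, h2, h3, rfl⟩, rfl⟩ | ⟨d, ⟨m, n, h1, h2, h3, rfl⟩, rfl⟩) | rfl)
      · have := hmono n m h1 h2
        exact ⟨m, n, ⟨⟨by omega, h3⟩, h1, by omega⟩, by omega⟩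
      · have := hmono n m h1 h2
        exact ⟨n, m, ⟨⟨h1, by omega⟩, by omega, h3⟩, by omega⟩
      · exact ⟨1, 1, ⟨⟨le_rfl, hN⟩, le_rfl, hN⟩, sub_self _⟩
  rw [diffCard, hset, Finset.card_union_of_disjoint, Finset.card_union_of_disjoint,
    Finset.card_image_of_injective _ Nat.cast_injective,
    Finset.card_image_of_injective (f := fun d : ℕ => -(d : ℤ)) _
      (neg_injective.comp Nat.cast_injective),
    Finset.card_singleton]
  · ring
  · rw [Finset.disjoint_left]
    intro z hz hz'
    obtain ⟨d, hd, rfl⟩ := Finset.mem_image.1 hz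
    obtain ⟨d', hd', h⟩ := Finset.mem_image.1 hz'
    have := pos_of_mem_posDiff hmono hd
    omega
  · rw [Finset.disjoint_singleton_right, Finset.mem_union, not_or]
    constructor <;> intro hz <;> obtain ⟨d, hd, h⟩ := Finset.mem_image.1 hz <;>
      have := pos_of_mem_posDiff hmono hd <;> omega

lemma card_posDiff_succ_le (a : ℕ → ℕ) (N : ℕ) :
    (posDiff a (N + 1)).card ≤ (posDiff a N).card + N := by
  have hsub : posDiff a (N + 1) ⊆
      posDiff a N ∪ (Finset.Icc 1 N).image fun n => a (N + 1) - a n := by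
    intro d hd
    obtain ⟨m, n, h1, h2, h3, rfl⟩ := mem_posDiff.1 hd
    rcases h3.eq_or_lt with rfl | h
    · exact Finset.mem_union_right _ (Finset.mem_image.2 ⟨n, Finset.mem_Icc.2 ⟨h1, by omega⟩, rfl⟩)
    · exact Finset.mem_union_left _ (mem_posDiff.2 ⟨m, n, h1, h2, by omega, rfl⟩)
  refine (Finset.card_le_card hsub).trans ((Finset.card_union_le _ _).trans ?_)
  have := Finset.card_image_le (s := Finset.Icc 1 N) (f := fun n => a (N + 1) - a n)
  rw [Nat.card_Icc] at this
  omega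

lemma le_card_posDiff {a : ℕ → ℕ} (hmono : ∀ m n, 1 ≤ m → m < n → a m < a n) (N : ℕ) :
    N ≤ (posDiff a N).card + 1 := by
  have h : (Finset.Icc 2 N).card ≤ (posDiff a N).card := by
    refine Finset.card_le_card_of_injOn (fun m => a m - a 1) (fun m hm => ?_) fun m hm m' hm' h => ?_
    · obtain ⟨h1, h2⟩ := Finset.mem_Icc.1 hm
      exact mem_posDiff.2 ⟨m, 1, le_rfl, by omega, h2, rfl⟩
    · obtain ⟨h1, -⟩ := Finset.mem_Icc.1 hm
      obtain ⟨h1', -⟩ := Finset.mem_Icc.1 hm'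
      have e1 := hmono 1 m le_rfl (by omega)
      have e2 := hmono 1 m' le_rfl (by omega)
      dsimp only at h
      rcases lt_trichotomy m m' with hlt | heq | hlt
      · have := hmono m m' (by omega) hlt
        omega
      · exact heq
      · have := hmono m' m (by omega) hlt
        omega
  rw [Nat.card_Icc] at h
  omega

lemma deltaMin_le_nint {a : ℕ → ℕ} (α : ℝ) {N m n : ℕ} (hn : 1 ≤ n) (hnm : n < m) (hm : m ≤ N) :
    deltaMin a α N ≤ nint (((a m : ℝ) - a n) * α) := by
  refine csInf_le ⟨0, ?_⟩ ⟨m, n, by omega, hm, hn, by omega, by omega, rfl⟩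
  rintro _ ⟨m, n, -, -, -, -, -, rfl⟩
  exact abs_nonneg _

/-- The bound in the theorem, as a function of `N`. -/
noncomputable def gapBound (a : ℕ → ℕ) (N : ℕ) : ℝ :=
  (1 / (diffCard a N : ℝ)) * (LL (a N) / (L N * LL N))

open Classical in
/-- The approximation function supported on the positive differences, with value
`gapBound a N` where `N` is the first index at which the difference appears. -/
noncomputable def diffApprox (a : ℕ → ℕ) (d : ℕ) : ℝ :=
  if h : ∃ N, d ∈ posDiff a N then min (1 / 2) (gapBound a (Nat.find h)) else 0

lemma gapBound_nonneg (a : ℕ → ℕ) (N : ℕ) : 0 ≤ gapBound a N := by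
  have h1 := one_le_LL (a N)
  have h2 := one_le_LL N
  have h3 : 1 ≤ L N := le_max_left _ _
  rw [gapBound]
  positivity

lemma diffApprox_nonneg (a : ℕ → ℕ) (d : ℕ) : 0 ≤ diffApprox a d := by
  rw [diffApprox]
  split_ifs with h
  · exact le_min (by norm_num) (gapBound_nonneg _ _)
  · exact le_rfl

lemma diffApprox_le_half (a : ℕ → ℕ) (d : ℕ) : diffApprox a d ≤ 1 / 2 := by
  rw [diffApprox]
  split_ifs with h
  · exact min_le_left _ _
  · norm_num

lemma exists_mem_of_lt_diffApprox {a : ℕ → ℕ} {d : ℕ} {t : ℝ} (ht : 0 ≤ t)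
    (h : t < diffApprox a d) :
    ∃ N, d ∈ posDiff a N ∧ t ≤ gapBound a N := by
  classical
  rw [diffApprox] at h
  split_ifs at h with hex
  · exact ⟨Nat.find hex, Nat.find_spec hex, (h.trans_le (min_le_right _ _)).le⟩
  · exact absurd h (not_lt.2 ht)

lemma diffApprox_of_mem_sdiff {a : ℕ → ℕ} {N d : ℕ} (hd : d ∈ posDiff a (N + 1) \ posDiff a N)
    (hN : gapBound a (N + 1) ≤ 1 / 2) : diffApprox a d = gapBound a (N + 1) := by
  classical
  obtain ⟨hd1, hd2⟩ := Finset.mem_sdiff.1 hd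
  have hex : ∃ N, d ∈ posDiff a N := ⟨_, hd1⟩
  have hfind : Nat.find hex = N + 1 := by
    refine (Nat.find_eq_iff hex).2 ⟨hd1, fun n hn h => hd2 (posDiff_mono a (by omega) h)⟩
  rw [diffApprox, dif_pos hex, hfind, min_eq_right hN]

/-- The frequency statement follows from approximability of infinitely many differences. -/
lemma frequently_of_infinite {a : ℕ → ℕ} (hmono : ∀ m n, 1 ≤ m → m < n → a m < a n) {α : ℝ}
    (h : {v : ℕ | 0 < v ∧ |(v : ℝ) * α - round ((v : ℝ) * α)| < diffApprox a v}.Infinite) :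
    ∃ᶠ N in atTop, deltaMin a α N ≤ gapBound a N := by
  rw [frequently_atTop]
  intro B
  obtain ⟨d, ⟨-, hd⟩, hdB⟩ := h.exists_notMem_finset (posDiff a B)
  obtain ⟨N, hdN, hle⟩ := exists_mem_of_lt_diffApprox (abs_nonneg _) hd
  refine ⟨N, le_of_not_ge fun hNB => hdB (posDiff_mono a hNB hdN), ?_⟩
  obtain ⟨m, n, h1, h2, h3, rfl⟩ := mem_posDiff.1 hdN
  refine (deltaMin_le_nint α h1 h2 h3).trans ?_
  rwa [Nat.cast_sub (hmono n m h1 h2).le] at hle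

lemma log_log_log_step {a : ℕ → ℕ} (hmono : ∀ m n, 1 ≤ m → m < n → a m < a n) {N : ℕ}
    (hN : 1 ≤ N) (hN1 : 1 ≤ Real.log N) (hN2 : 1 ≤ Real.log (Real.log N))
    (hgap : gapBound a (N + 1) ≤ 1 / 2) :
    (162 * Real.exp 12)⁻¹ * (Real.log (Real.log (Real.log (diffCard a (N + 1)))) -
      Real.log (Real.log (Real.log (diffCard a N)))) ≤
    ∑ d ∈ posDiff a (N + 1) \ posDiff a N, diffApprox a d * totRatio d := by
  set x := (diffCard a N : ℝ) with hx
  set y := (diffCard a (N + 1) : ℝ) with hy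
  have ex : x = 2 * (posDiff a N).card + 1 := by
    rw [hx, diffCard_eq hmono hN]; push_cast; rfl
  have ey : y = 2 * (posDiff a (N + 1)).card + 1 := by
    rw [hy, diffCard_eq hmono (by omega)]; push_cast; rfl
  have hNp : (N : ℝ) ≤ (posDiff a N).card + 1 := by exact_mod_cast le_card_posDiff hmono N
  have hNp' : ((N + 1 : ℕ) : ℝ) ≤ (posDiff a (N + 1)).card + 1 := by
    exact_mod_cast le_card_posDiff hmono (N + 1)
  have hpp : ((posDiff a (N + 1)).card : ℝ) ≤ (posDiff a N).card + N := by
    exact_mod_cast card_posDiff_succ_le a N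
  have hsub := posDiff_mono a (Nat.le_succ N)
  have hpp' : ((posDiff a N).card : ℝ) ≤ (posDiff a (N + 1)).card := by
    exact_mod_cast Finset.card_le_card hsub
  have hNR : (1 : ℝ) ≤ N := by exact_mod_cast hN
  have hNx : (N : ℝ) ≤ x := by
    have : (0 : ℝ) ≤ (posDiff a N).card := Nat.cast_nonneg _
    linarith
  have hNy : ((N + 1 : ℕ) : ℝ) ≤ y := by
    have : (0 : ℝ) ≤ (posDiff a (N + 1)).card := Nat.cast_nonneg _
    linarith
  have hx0 : 0 < x := by linarith
  have hxy : x ≤ y := by linarith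
  have hx1 : 1 ≤ Real.log x := hN1.trans (Real.log_le_log (by linarith) hNx)
  have hx2 : 1 ≤ Real.log (Real.log x) :=
    hN2.trans (Real.log_le_log (by linarith) (Real.log_le_log (by linarith) hNx))
  have hy1 : 1 ≤ Real.log y := hx1.trans (Real.log_le_log hx0 hxy)
  have hy2 : 1 ≤ Real.log (Real.log y) :=
    hx2.trans (Real.log_le_log (by linarith) (Real.log_le_log hx0 hxy))
  have hmain := log_log_log_sub_le hx0 hx2 hx1 hxy (by linarith)
  have hLL := L_mul_LL_le (by positivity : (0 : ℝ) < (N + 1 : ℕ)) hy1 hy2 hNy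
  have hL0 : 0 < L ((N + 1 : ℕ) : ℝ) * LL ((N + 1 : ℕ) : ℝ) :=
    mul_pos (zero_lt_one.trans_le (le_max_left _ _)) (zero_lt_one.trans_le (one_le_LL _))
  have hterm : ∀ d ∈ posDiff a (N + 1) \ posDiff a N,
      (3 * Real.exp 12)⁻¹ * (1 / (y * (L ((N + 1 : ℕ) : ℝ) * LL ((N + 1 : ℕ) : ℝ)))) ≤
        diffApprox a d * totRatio d := by
    intro d hd
    rw [diffApprox_of_mem_sdiff hd hgap, gapBound, ← hy]
    have hdm := (Finset.mem_sdiff.1 hd).1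
    have hd0 := pos_of_mem_posDiff hmono hdm
    have hd0' : (0 : ℝ) < d := by exact_mod_cast hd0
    have hF := totRatio_pos d
    have h1 : (totRatio d)⁻¹ ≤ 3 * Real.exp 12 * LL (a (N + 1)) :=
      (inv_totRatio_le hd0.ne').trans (mul_le_mul_of_nonneg_left
        (LL_mono hd0' (by exact_mod_cast le_of_mem_posDiff hmono hdm)) (by positivity))
    have h2 : (3 * Real.exp 12)⁻¹ ≤ LL (a (N + 1)) * totRatio d := by
      rw [inv_le_iff_one_le_mul₀ (by positivity)]
      rw [inv_le_iff_one_le_mul₀ hF] at h1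
      linarith
    have hy0 : 0 < y := by linarith
    calc _ ≤ LL (a (N + 1)) * totRatio d *
          (1 / (y * (L ((N + 1 : ℕ) : ℝ) * LL ((N + 1 : ℕ) : ℝ)))) :=
          mul_le_mul_of_nonneg_right h2 (by positivity)
      _ = _ := by field_simp
  have hcard : ((posDiff a (N + 1) \ posDiff a N).card : ℝ) = (y - x) / 2 := by
    rw [Finset.card_sdiff_of_subset hsub, Nat.cast_sub (Finset.card_le_card hsub), ex, ey]
    ring
  have hsum := Finset.card_nsmul_le_sum _ _ _ hterm
  rw [nsmul_eq_mul, hcard] at hsum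
  refine le_trans ?_ hsum
  have hy0 : 0 < y := by linarith
  have hyx : 0 ≤ y - x := by linarith
  calc _ ≤ (162 * Real.exp 12)⁻¹ *
        (27 * ((y - x) / (y * (Real.log y * Real.log (Real.log y))))) := by gcongr
    _ ≤ (162 * Real.exp 12)⁻¹ *
        (27 * ((y - x) / (y * (L ((N + 1 : ℕ) : ℝ) * LL ((N + 1 : ℕ) : ℝ))))) := by gcongr
    _ = _ := by field_simp; ring

lemma not_summable_diffApprox {a : ℕ → ℕ} (hmono : ∀ m n, 1 ≤ m → m < n → a m < a n)
    (hgap : ∀ᶠ N in atTop, gapBound a N ≤ 1 / 2) :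
    ¬ Summable fun d => diffApprox a d * totRatio d := by
  intro hs
  have hnn : ∀ d, 0 ≤ diffApprox a d * totRatio d := fun d =>
    mul_nonneg (diffApprox_nonneg a d) (totRatio_pos d).le
  have hlog : Tendsto (fun N : ℕ => Real.log N) atTop atTop :=
    Real.tendsto_log_atTop.comp tendsto_natCast_atTop_atTop
  have hloglog := Real.tendsto_log_atTop.comp hlog
  obtain ⟨K, hK⟩ := eventually_atTop.1 ((hgap.and (hlog.eventually_ge_atTop 1)).and
    ((hloglog.eventually_ge_atTop 1).and (eventually_ge_atTop 1)))
  set g : ℕ → ℝ := fun N => Real.log (Real.log (Real.log (diffCard a N))) with hg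
  have hpart : ∀ M ≥ K, (162 * Real.exp 12)⁻¹ * (g M - g K) ≤
      ∑ d ∈ posDiff a M \ posDiff a K, diffApprox a d * totRatio d := by
    intro M hM
    induction M, hM using Nat.le_induction with
    | base => simp
    | succ M hM ih =>
      obtain ⟨⟨-, h1⟩, h2, h3⟩ := hK M hM
      have hstep := log_log_log_step hmono h3 h1 h2 (hK (M + 1) (by omega)).1.1
      have hunion : posDiff a (M + 1) \ posDiff a K =
          (posDiff a (M + 1) \ posDiff a M) ∪ (posDiff a M \ posDiff a K) :=
        (Finset.sdiff_union_sdiff_cancel (posDiff_mono a (Nat.le_succ M)) (posDiff_mono a hM)).symm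
      have hdisj : Disjoint (posDiff a (M + 1) \ posDiff a M) (posDiff a M \ posDiff a K) :=
        Finset.sdiff_disjoint.mono_right Finset.sdiff_subset
      rw [hunion, Finset.sum_union hdisj]
      calc _ = (162 * Real.exp 12)⁻¹ * (g (M + 1) - g M) +
            (162 * Real.exp 12)⁻¹ * (g M - g K) := by ring
        _ ≤ _ := add_le_add hstep ih
  have hC : Tendsto (fun N => (diffCard a N : ℝ)) atTop atTop := by
    refine tendsto_atTop_mono' _ ?_ tendsto_natCast_atTop_atTop
    filter_upwards [eventually_ge_atTop 1] with N hN
    have := le_card_posDiff hmono N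
    rw [diffCard_eq hmono hN]
    exact_mod_cast (by omega : N ≤ 2 * (posDiff a N).card + 1)
  have hgt : Tendsto g atTop atTop :=
    Real.tendsto_log_atTop.comp (Real.tendsto_log_atTop.comp (Real.tendsto_log_atTop.comp hC))
  obtain ⟨M, hM, hMK⟩ := ((hgt.eventually_gt_atTop (g K + 162 * Real.exp 12 *
    ∑' d, diffApprox a d * totRatio d)).and (eventually_ge_atTop K)).exists
  have h1 := (hpart M hMK).trans (hs.sum_le_tsum _ fun d _ => hnn d)
  rw [inv_mul_le_iff₀ (by positivity)] at h1
  linarith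

end DuffinSchaeffer

open DuffinSchaeffer

theorem stmt0 (a : ℕ → ℕ)
    (hpos : ∀ n, 1 ≤ n → 0 < a n)
    (hmono : ∀ m n, 1 ≤ m → m < n → a m < a n) :
    ∀ᵐ α ∂(volume : Measure ℝ), α ∈ Set.Icc (0 : ℝ) 1 →
      ∃ᶠ N in atTop,
        deltaMin a α N ≤
          (1 / (diffCard a N : ℝ)) * (LL (a N) / (L N * LL N)) := by
  change ∀ᵐ α : ℝ, α ∈ Set.Icc (0 : ℝ) 1 → ∃ᶠ N in atTop, deltaMin a α N ≤ gapBound a N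
  by_cases hgap : ∀ᶠ N in atTop, gapBound a N ≤ 1 / 2
  · filter_upwards [ae_infinite_norm_mul_lt (diffApprox_nonneg a) (diffApprox_le_half a)
      (not_summable_diffApprox hmono hgap)] with α hα hmem
    exact frequently_of_infinite hmono (hα hmem)
  · refine Eventually.of_forall fun α _ => ?_
    refine ((not_eventually.1 hgap).and_eventually (eventually_ge_atTop 2)).mono ?_
    rintro N ⟨hN, hN2⟩
    exact (deltaMin_le_nint α le_rfl one_lt_two hN2).trans
      ((abs_sub_round _).trans (not_le.1 hN).le)
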